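/- arXiv:nlin/0407024 — 2 statements merged into one kernel-verified Lean document; each statement's English description precedes it below -/
import Mathlib

section
/- Let π be a full sequence with n elements and largest element d_max ≤ n/2, i.e., π contains every integer d with 1 ≤ d ≤ d_max at least once and the sum of its elements is even. Then π is graphic. -/
open SimpleGraph Finset

/-- The normalized Laplacian matrix `I - D^{-1/2} A D^{-1/2}` of a finite simple graph. -/
noncomputable def normLap {n : ℕ} (G : SimpleGraph (Fin n)) [DecidableRel G.Adj] :
    Matrix (Fin n) (Fin n) ℝ :=
  Matrix.of fun v w =>
    if v = w then (if G.degree v = 0 then 0 else 1)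
    else if G.Adj v w then -((Real.sqrt (G.degree v) * Real.sqrt (G.degree w))⁻¹)
    else 0

/-- The smallest nontrivial (nonzero) eigenvalue of the normalized Laplacian. -/
noncomputable def lambda1 {n : ℕ} (G : SimpleGraph (Fin n)) [DecidableRel G.Adj] : ℝ :=
  sInf {μ : ℝ | μ ≠ 0 ∧ μ ∈ spectrum ℝ (normLap G)}

/-- The degree sequence (as a multiset) of a finite simple graph. -/
def degSeq {n : ℕ} (G : SimpleGraph (Fin n)) [DecidableRel G.Adj] : Multiset ℕ :=
  Finset.univ.val.map fun v => G.degree v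

/-- A multiset of natural numbers is graphic if it is the degree sequence of a simple graph. -/
def Graphic (π : Multiset ℕ) : Prop :=
  ∃ (G : SimpleGraph (Fin (Multiset.card π))) (_ : DecidableRel G.Adj), degSeq G = π

noncomputable def dg {n : ℕ} (G : SimpleGraph (Fin n)) (v : Fin n) : ℕ :=
  (G.neighborSet v).ncard

lemma dg_add {n : ℕ} (G : SimpleGraph (Fin n)) (a b : Fin n) (hab : a ≠ b) (h : ¬ G.Adj a b) :
    ∃ G' : SimpleGraph (Fin n),
      (∀ x y, G'.Adj x y ↔ G.Adj x y ∨ (x = a ∧ y = b) ∨ (x = b ∧ y = a)) ∧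
      ∀ v, dg G' v = dg G v + (if v = a then 1 else 0) + (if v = b then 1 else 0) := by
  have h' : ¬ G.Adj b a := fun k => h k.symm
  let G' : SimpleGraph (Fin n) :=
    { Adj := fun x y => G.Adj x y ∨ (x = a ∧ y = b) ∨ (x = b ∧ y = a)
      symm := ⟨by
        rintro x y (k | k | k)
        · exact Or.inl k.symm
        · exact Or.inr (Or.inr ⟨k.2, k.1⟩)
        · exact Or.inr (Or.inl ⟨k.2, k.1⟩)⟩
      loopless := ⟨by
        rintro x (k | k | k)
        · exact G.loopless.irrefl x k
        · exact hab (k.1.symm.trans k.2)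
        · exact hab (k.2.symm.trans k.1)⟩ }
  refine ⟨G', fun x y => Iff.rfl, fun v => ?_⟩
  unfold dg
  by_cases hva : v = a
  · subst hva
    have : G'.neighborSet v = insert b (G.neighborSet v) := by
      ext y; simp only [SimpleGraph.mem_neighborSet, Set.mem_insert_iff, G']; grind
    rw [this, Set.ncard_insert_of_notMem (by simpa using h)]
    simp [hab]
  · by_cases hvb : v = b
    · subst hvb
      have : G'.neighborSet v = insert a (G.neighborSet v) := by
        ext y; simp only [SimpleGraph.mem_neighborSet, Set.mem_insert_iff, G']; grind
      rw [this, Set.ncard_insert_of_notMem (by simpa using h')]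
      simp [hva]
    · have : G'.neighborSet v = G.neighborSet v := by
        ext y; simp only [SimpleGraph.mem_neighborSet, G']; grind
      rw [this]; simp [hva, hvb]

lemma dg_del {n : ℕ} (G : SimpleGraph (Fin n)) (a b : Fin n) (h : G.Adj a b) :
    ∃ G' : SimpleGraph (Fin n),
      (∀ x y, G'.Adj x y ↔ G.Adj x y ∧ ¬ (x = a ∧ y = b) ∧ ¬ (x = b ∧ y = a)) ∧
      ∀ v, dg G' v + (if v = a then 1 else 0) + (if v = b then 1 else 0) = dg G v := by
  have hab : a ≠ b := h.ne
  let G' : SimpleGraph (Fin n) :=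
    { Adj := fun x y => G.Adj x y ∧ ¬ (x = a ∧ y = b) ∧ ¬ (x = b ∧ y = a)
      symm := ⟨fun x y k => ⟨k.1.symm, fun q => k.2.2 ⟨q.2, q.1⟩, fun q => k.2.1 ⟨q.2, q.1⟩⟩⟩
      loopless := ⟨fun x k => G.loopless.irrefl x k.1⟩ }
  obtain ⟨G'', hA, hd⟩ := dg_add G' a b hab (fun k => k.2.1 ⟨rfl, rfl⟩)
  have : G'' = G := by
    ext x y
    rw [hA]
    have := h.symm
    simp only [G']
    grind
  subst this
  exact ⟨G', fun x y => Iff.rfl, fun v => (hd v).symm⟩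

lemma dg_exists {n : ℕ} (G : SimpleGraph (Fin n)) (r i : Fin n) (h : dg G r < dg G i) :
    ∃ u, G.Adj i u ∧ u ≠ r ∧ ¬ G.Adj r u := by
  by_contra! hc
  have hri : r ≠ i := by rintro rfl; exact lt_irrefl _ h
  by_cases ha : G.Adj r i
  · have hs : G.neighborSet i \ {r} ⊆ G.neighborSet r \ {i} := by
      rintro u ⟨hu, hur⟩
      exact ⟨hc u hu hur, fun q => G.ne_of_adj hu q.symm⟩
    have := Set.ncard_le_ncard hs (Set.toFinite _)
    have h1 := Set.ncard_sdiff_singleton_add_one (s := G.neighborSet i) (a := r) ha.symm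
    have h2 := Set.ncard_sdiff_singleton_add_one (s := G.neighborSet r) (a := i) ha
    unfold dg at h
    omega
  · have hs : G.neighborSet i ⊆ G.neighborSet r := by
      intro u hu
      exact hc u hu (by rintro rfl; exact ha hu.symm)
    have := Set.ncard_le_ncard hs (Set.toFinite _)
    unfold dg at h
    omega

lemma dg_eq_degree {n : ℕ} (G : SimpleGraph (Fin n)) [DecidableRel G.Adj] (v : Fin n) :
    dg G v = G.degree v := by
  unfold dg
  rw [← SimpleGraph.card_neighborSet_eq_degree, Set.ncard_eq_toFinset_card', Set.toFinset_card]

lemma dg_sum_even {n : ℕ} (G : SimpleGraph (Fin n)) : Even (∑ v, dg G v) := by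
  classical
  simp_rw [dg_eq_degree]
  rw [SimpleGraph.sum_degrees_eq_twice_card_edges]
  exact even_two_mul _

lemma dg_eq_sum {n : ℕ} (G : SimpleGraph (Fin n)) [DecidableRel G.Adj] (v : Fin n) :
    dg G v = ∑ u, if G.Adj v u then 1 else 0 := by
  rw [dg_eq_degree, ← SimpleGraph.card_neighborFinset_eq_degree, Finset.sum_boole]
  simp only [Nat.cast_id]
  congr 1
  ext; simp

def SubReal {n : ℕ} (d : Fin n → ℕ) (r : ℕ) (G : SimpleGraph (Fin n)) : Prop :=
  (∀ i, dg G i ≤ d i) ∧ (∀ i : Fin n, i.val < r → dg G i = d i) ∧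
    ∀ i j : Fin n, r < i.val → r < j.val → ¬ G.Adj i j

/-- The extremal configuration contradicts the Erdos-Gallai inequality. -/
lemma final_count {n : ℕ} (d : Fin n → ℕ) (r : Fin n) (G : SimpleGraph (Fin n))
    (hS : SubReal d r G) (hlt : dg G r < d r)
    (hcl : ∀ i j : Fin n, i ≤ r → j ≤ r → i ≠ j → G.Adj i j)
    (hmin : ∀ k, r < k → min (r.val + 1) (d k) ≤ dg G k)
    (hEG : ∀ A : Finset (Fin n), ∑ i ∈ A, d i ≤ A.card * (A.card - 1) +
      ∑ i ∈ Aᶜ, min A.card (d i)) : False := by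
  classical
  have h1 := hEG (Finset.Iic r)
  have hc : (Finset.Iic r).card = r.val + 1 := by simp
  rw [hc] at h1
  have h2 : ∑ i ∈ Finset.Iic r, dg G i < ∑ i ∈ Finset.Iic r, d i :=
    Finset.sum_lt_sum (fun i _ => hS.1 i) ⟨r, by simp, hlt⟩
  have h3 : ∑ i ∈ (Finset.Iic r)ᶜ, min (r.val + 1) (d i) ≤ ∑ i ∈ (Finset.Iic r)ᶜ, dg G i :=
    Finset.sum_le_sum (fun i hi => hmin i (by simpa using hi))
  have h4 : ∑ i ∈ (Finset.Iic r)ᶜ, dg G i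
      = ∑ k ∈ (Finset.Iic r)ᶜ, ∑ i ∈ Finset.Iic r, if G.Adj i k then 1 else 0 := by
    refine Finset.sum_congr rfl fun k hk => ?_
    have hk' : r < k := by simpa using hk
    rw [dg_eq_sum, ← Finset.sum_add_sum_compl (Finset.Iic r)]
    have : ∑ i ∈ (Finset.Iic r)ᶜ, (if G.Adj k i then 1 else 0) = 0 := by
      refine Finset.sum_eq_zero fun i hi => ?_
      have hi' : r < i := by simpa using hi
      simp [hS.2.2 k i hk' hi']
    rw [this, add_zero]
    exact Finset.sum_congr rfl fun i _ => by simp [G.adj_comm]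
  have h5 : ∑ i ∈ Finset.Iic r, dg G i = (r.val + 1) * r.val +
      ∑ i ∈ Finset.Iic r, ∑ k ∈ (Finset.Iic r)ᶜ, if G.Adj i k then 1 else 0 := by
    have : ∀ i ∈ Finset.Iic r, dg G i = r.val + ∑ k ∈ (Finset.Iic r)ᶜ, if G.Adj i k then 1 else 0 := by
      intro i hi
      rw [dg_eq_sum, ← Finset.sum_add_sum_compl (Finset.Iic r)]
      congr 1
      rw [← Finset.add_sum_erase _ _ hi]
      have : ∀ k ∈ (Finset.Iic r).erase i, (if G.Adj i k then 1 else 0) = 1 := by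
        intro k hk
        simp only [Finset.mem_erase, Finset.mem_Iic] at hk hi
        simp [hcl i k hi hk.2 (Ne.symm hk.1)]
      rw [Finset.sum_congr rfl this]
      simp [Finset.card_erase_of_mem hi]
    rw [Finset.sum_congr rfl this, Finset.sum_add_distrib]
    simp
  rw [Finset.sum_comm] at h5
  simp only [Nat.add_sub_cancel] at h1
  omega

lemma improve {n : ℕ} (d : Fin n → ℕ) (hd : Antitone d) (he : Even (∑ i, d i))
    (hEG : ∀ A : Finset (Fin n), ∑ i ∈ A, d i ≤ A.card * (A.card - 1) +
      ∑ i ∈ Aᶜ, min A.card (d i))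
    (r : Fin n) (G : SimpleGraph (Fin n)) (hS : SubReal d r G) (hlt : dg G r < d r) :
    ∃ G', SubReal d r G' ∧ dg G r < dg G' r := by
  by_contra hno
  obtain ⟨hle, heq, hind⟩ := id hS
  have hbig : ∀ i : Fin n, i < r → dg G r < dg G i := fun i hi => by
    rw [heq i hi]; exact hlt.trans_le (hd hi.le)
  -- case 0
  have c0 : ∀ k, r < k → dg G k < d k → G.Adj r k := by
    intro k hk hdk
    by_contra hna
    obtain ⟨G', hA, hD⟩ := dg_add G r k hk.ne hna
    refine hno ⟨G', ⟨fun i => ?_, fun i hi => ?_, fun i j hi hj => ?_⟩, ?_⟩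
    · have := hle i
      rw [hD]; grind
    · rw [hD, heq i hi]; grind
    · rw [hA]; have := hind i j hi hj; grind
    · rw [hD]; grind
  -- case 1
  have c1 : ∀ i, i < r → G.Adj r i := by
    intro i hi
    by_contra hna
    obtain ⟨u, hu, hur, hru⟩ := dg_exists G r i (hbig i hi)
    have hui : u ≠ i := hu.ne'
    obtain ⟨G1, hA1, hD1⟩ := dg_del G i u hu
    obtain ⟨G2, hA2, hD2⟩ := dg_add G1 u r hur (by rw [hA1, G.adj_comm]; tauto)
    obtain ⟨G3, hA3, hD3⟩ := dg_add G2 i r hi.ne (by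
      rw [hA2, hA1, G.adj_comm]; grind)
    have hD : ∀ v, dg G3 v = dg G v + (if v = r then 2 else 0) := by
      intro v
      have := hD1 v
      rw [hD3, hD2]; grind
    have hI : ∀ x y : Fin n, r < x → r < y → ¬ G3.Adj x y := by
      intro x y hx hy
      rw [hA3, hA2, hA1]
      have := hind x y hx hy
      grind
    by_cases h2 : dg G r + 2 ≤ d r
    · refine hno ⟨G3, ⟨fun v => ?_, fun v hv => ?_, hI⟩, ?_⟩
      · have := hle v
        rw [hD]; grind
      · rw [hD, heq v hv]; grind
      · rw [hD]; grind
    · have hk : ∃ k, r < k ∧ dg G k < d k := by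
        by_contra! hk
        have : ∀ v, d v = dg G v + (if v = r then 1 else 0) := by
          intro v
          rcases lt_trichotomy v r with hv | hv | hv
          · rw [heq v hv]; simp [hv.ne]
          · subst hv; simp; omega
          · have := hle v
            have := hk v hv
            simp [hv.ne']; omega
        have hs : ∑ v, d v = ∑ v, dg G v + 1 := by
          rw [Finset.sum_congr rfl (fun v _ => this v), Finset.sum_add_distrib]
          simp
        have := dg_sum_even G
        rw [hs] at he
        grind
      obtain ⟨k, hk, hdk⟩ := hk
      have hrk := c0 k hk hdk
      obtain ⟨G4, hA4, hD4⟩ := dg_del G3 r k (by rw [hA3, hA2, hA1]; grind)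
      refine hno ⟨G4, ⟨fun v => ?_, fun v hv => ?_, fun x y hx hy => ?_⟩, ?_⟩
      · have := hle v
        have := hD4 v
        have := hD v
        grind
      · have := heq v hv
        have := hD4 v
        have := hD v
        have : v < r := hv
        grind
      · rw [hA4]; have := hI x y hx hy; tauto
      · have := hD4 r
        have := hD r
        grind
  -- case 2
  have c2 : ∀ k, r < k → min (r.val + 1) (d k) ≤ dg G k := by
    intro k hk
    by_contra! hk2
    have hrk : G.Adj r k := c0 k hk (lt_of_lt_of_le hk2 (min_le_right _ _))
    have hi : ∃ i, i < r ∧ ¬ G.Adj i k := by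
      by_contra! hall
      have hs : (↑(Finset.Iic r) : Set (Fin n)) ⊆ G.neighborSet k := by
        intro i hi
        simp only [Finset.coe_Iic, Set.mem_Iic] at hi
        rcases hi.lt_or_eq with h | h
        · exact (hall i h).symm
        · subst h; exact hrk.symm
      have := Set.ncard_le_ncard hs (Set.toFinite _)
      rw [Set.ncard_coe_finset] at this
      simp only [Fin.card_Iic] at this
      have h3 := lt_of_lt_of_le hk2 (min_le_left _ _)
      unfold dg at h3
      omega
    obtain ⟨i, hi, hik⟩ := hi
    obtain ⟨u, hu, hur, hru⟩ := dg_exists G r i (hbig i hi)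
    have hui : u ≠ i := hu.ne'
    have hdk := lt_of_lt_of_le hk2 (min_le_right _ _)
    obtain ⟨G1, hA1, hD1⟩ := dg_del G i u hu
    obtain ⟨G2, hA2, hD2⟩ := dg_add G1 u r hur (by rw [hA1, G.adj_comm]; tauto)
    obtain ⟨G3, hA3, hD3⟩ := dg_add G2 i k (hi.trans hk).ne (by
      rw [hA2, hA1]; grind)
    have hD : ∀ v, dg G3 v = dg G v + (if v = r then 1 else 0) + (if v = k then 1 else 0) := by
      intro v
      have := hD1 v
      rw [hD3, hD2]; grind
    refine hno ⟨G3, ⟨fun v => ?_, fun v hv => ?_, fun x y hx hy => ?_⟩, ?_⟩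
    · have := hle v
      rw [hD]; grind
    · have : v < r := hv
      rw [hD, heq v hv]; grind
    · rw [hA3, hA2, hA1]
      have := hind x y hx hy
      grind
    · rw [hD]; grind
  -- case 3
  have c3 : ∀ i j, i < r → j < r → i ≠ j → G.Adj i j := by
    intro i j hi hj hij
    by_contra hna
    have hna' : ¬ G.Adj j i := fun h => hna h.symm
    obtain ⟨u, hu, hur, hru⟩ := dg_exists G r i (hbig i hi)
    obtain ⟨w, hw, hwr, hrw⟩ := dg_exists G r j (hbig j hj)
    have hu' : r < u := by
      rcases lt_trichotomy u r with h | h | h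
      · exact absurd (c1 u h) hru
      · exact absurd h hur
      · exact h
    have hw' : r < w := by
      rcases lt_trichotomy w r with h | h | h
      · exact absurd (c1 w h) hrw
      · exact absurd h hwr
      · exact h
    obtain ⟨G1, hA1, hD1⟩ := dg_del G i u hu
    obtain ⟨G2, hA2, hD2⟩ := dg_del G1 j w (by rw [hA1]; grind)
    obtain ⟨G3, hA3, hD3⟩ := dg_add G2 i j hij (by rw [hA2, hA1]; tauto)
    obtain ⟨G4, hA4, hD4⟩ := dg_add G3 u r hur (by
      rw [hA3, hA2, hA1, G.adj_comm]; grind)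
    have hD : ∀ v, dg G4 v + (if v = w then 1 else 0) = dg G v + (if v = r then 1 else 0) := by
      intro v
      have := hD1 v
      have := hD2 v
      rw [hD4, hD3]; grind
    refine hno ⟨G4, ⟨fun v => ?_, fun v hv => ?_, fun x y hx hy => ?_⟩, ?_⟩
    · have := hle v
      have := hD v
      grind
    · have : v < r := hv
      have := heq v hv
      have := hD v
      grind
    · rw [hA4, hA3, hA2, hA1]
      have := hind x y hx hy
      grind
    · have := hD r; grind
  refine final_count d r G hS hlt (fun i j hi hj hij => ?_) c2 hEG
  rcases hi.lt_or_eq with hi | hi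
  · rcases hj.lt_or_eq with hj | hj
    · exact c3 i j hi hj hij
    · subst hj; exact (c1 i hi).symm
  · subst hi
    exact c1 j (lt_of_le_of_ne hj hij.symm)

lemma step {n : ℕ} (d : Fin n → ℕ) (hd : Antitone d) (he : Even (∑ i, d i))
    (hEG : ∀ A : Finset (Fin n), ∑ i ∈ A, d i ≤ A.card * (A.card - 1) +
      ∑ i ∈ Aᶜ, min A.card (d i)) (r : Fin n) :
    ∀ m (G : SimpleGraph (Fin n)), SubReal d r G → d r - dg G r = m →
      ∃ G', SubReal d r G' ∧ dg G' r = d r := by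
  intro m
  induction m using Nat.strong_induction_on with
  | _ m ih =>
    intro G hS hm
    by_cases h : dg G r = d r
    · exact ⟨G, hS, h⟩
    · have hlt := lt_of_le_of_ne (hS.1 r) h
      obtain ⟨G', hS', h'⟩ := improve d hd he hEG r G hS hlt
      exact ih (d r - dg G' r) (by omega) G' hS' rfl

lemma erdos_gallai {n : ℕ} (d : Fin n → ℕ) (hd : Antitone d) (he : Even (∑ i, d i))
    (hEG : ∀ A : Finset (Fin n), ∑ i ∈ A, d i ≤ A.card * (A.card - 1) +
      ∑ i ∈ Aᶜ, min A.card (d i)) : ∃ G : SimpleGraph (Fin n), ∀ v, dg G v = d v := by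
  have key : ∀ r, r ≤ n → ∃ G, SubReal d r G := by
    intro r
    induction r with
    | zero =>
      intro _
      refine ⟨⊥, fun i => ?_, fun i hi => absurd hi (by omega), fun i j _ _ => by simp⟩
      simp [dg]
    | succ r ih =>
      intro hr
      obtain ⟨G, hG⟩ := ih (by omega)
      obtain ⟨G', hG', hr'⟩ := step d hd he hEG ⟨r, hr⟩ _ G hG rfl
      refine ⟨G', hG'.1, fun i hi => ?_, fun i j hi hj => hG'.2.2 i j (by simp; omega) (by simp; omega)⟩
      rcases Nat.lt_succ_iff_lt_or_eq.1 hi with h | h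
      · exact hG'.2.1 i h
      · have : i = ⟨r, hr⟩ := Fin.ext h
        rw [this]; exact hr'
  obtain ⟨G, hG⟩ := key n le_rfl
  exact ⟨G, fun v => hG.2.1 v v.2⟩

/-- Distinct values at most `D`. -/
lemma sum_distinct_upper (D : ℕ) (S : Finset ℕ) (hS : ∀ v ∈ S, v ≤ D) :
    2 * ∑ v ∈ S, (v : ℤ) + S.card * ((S.card : ℤ) - 1) ≤ 2 * S.card * D := by
  induction D generalizing S with
  | zero =>
    have : S ⊆ {0} := fun v hv => by simpa using hS v hv
    rcases Finset.subset_singleton_iff.1 this with h | h <;> simp [h]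
  | succ D ih =>
    have h1 := ih (S.erase (D + 1)) (fun v hv => by
      have := hS v (Finset.mem_of_mem_erase hv)
      have := Finset.ne_of_mem_erase hv
      omega)
    by_cases hD : D + 1 ∈ S
    · have h2 := Finset.card_erase_add_one hD
      rw [← Finset.add_sum_erase _ _ hD, ← h2]
      push_cast
      nlinarith
    · rw [Finset.erase_eq_of_notMem hD] at h1
      push_cast
      nlinarith

lemma sum_distinct_lower (k : ℕ) (S : Finset ℕ) (hS : ∀ v ∈ S, 1 ≤ v) :
    2 * (k : ℤ) * S.card ≤ 2 * ∑ v ∈ S, ((min k v : ℕ) : ℤ) + k * ((k : ℤ) - 1) := by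
  induction k with
  | zero => simp
  | succ k ih =>
    have h1 : ∀ v ∈ S, min (k + 1) v = min k v + if k + 1 ≤ v then 1 else 0 := by
      intro v _; split_ifs <;> omega
    have h2 : ∑ v ∈ S, ((min (k + 1) v : ℕ) : ℤ)
        = ∑ v ∈ S, ((min k v : ℕ) : ℤ) + (S.filter (fun v => k + 1 ≤ v)).card := by
      rw [Finset.sum_congr rfl (fun v hv => by rw [h1 v hv])]
      push_cast
      rw [Finset.sum_add_distrib]
      simp
    have h3 := Finset.card_filter_add_card_filter_not (s := S) (fun v => k + 1 ≤ v)
    have h4 : (S.filter (fun v => ¬ k + 1 ≤ v)).card ≤ k := by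
      have : S.filter (fun v => ¬ k + 1 ≤ v) ⊆ Finset.Icc 1 k := by
        intro v hv
        simp only [Finset.mem_filter, Finset.mem_Icc] at hv ⊢
        have := hS v hv.1
        omega
      simpa using Finset.card_le_card this
    rw [h2]
    have h5 : (S.card : ℤ) ≤ (S.filter (fun v => k + 1 ≤ v)).card + k := by omega
    push_cast at ih ⊢
    nlinarith

lemma full_EG {n : ℕ} (d : Fin n → ℕ) (D : ℕ) (hpos : ∀ i, 0 < d i) (hmax : ∀ i, d i ≤ D)
    (hfull : ∀ v, 1 ≤ v → v ≤ D → ∃ i, d i = v) (hD : 2 * D ≤ n) (A : Finset (Fin n)) :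
    ∑ i ∈ A, d i ≤ A.card * (A.card - 1) + ∑ i ∈ Aᶜ, min A.card (d i) := by
  classical
  rcases Nat.lt_or_ge D A.card with hk | hk
  · have : ∑ i ∈ A, d i ≤ A.card * (A.card - 1) := by
      have := Finset.sum_le_card_nsmul A d (A.card - 1) (fun i _ => by have := hmax i; omega)
      simpa using this
    omega
  · rcases Nat.eq_zero_or_pos A.card with h0 | h0
    · have : A = ∅ := Finset.card_eq_zero.1 h0
      simp [this]
    have hex : ∀ v : ℕ, ∃ i : Fin n, v ∈ Finset.Icc 1 D → d i = v := by
      intro v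
      by_cases hv : v ∈ Finset.Icc 1 D
      · rw [Finset.mem_Icc] at hv
        obtain ⟨i, hi⟩ := hfull v hv.1 hv.2
        exact ⟨i, fun _ => hi⟩
      · have : 0 < n := by omega
        exact ⟨⟨0, this⟩, fun h => absurd h hv⟩
    choose f hf using hex
    set T := (Finset.Icc 1 D).image f with hT
    have hTinj : Set.InjOn d T := by
      intro x hx y hy hxy
      simp only [hT, Finset.coe_image, Set.mem_image, Finset.mem_coe] at hx hy
      obtain ⟨a, ha, rfl⟩ := hx
      obtain ⟨b, hb, rfl⟩ := hy
      rw [hf a ha, hf b hb] at hxy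
      rw [hxy]
    have hTcard : T.card = D := by
      rw [hT, Finset.card_image_of_injOn]
      · simp
      · intro a ha b hb hab
        rw [← hf a ha, ← hf b hb]
        exact congrArg d hab
    have u1 := sum_distinct_upper D ((A ∩ T).image d) (by
      intro v hv
      obtain ⟨i, _, rfl⟩ := Finset.mem_image.1 hv
      exact hmax i)
    have l1 := sum_distinct_lower A.card ((T \ A).image d) (by
      intro v hv
      obtain ⟨i, _, rfl⟩ := Finset.mem_image.1 hv
      exact hpos i)
    have i1 : Set.InjOn d (A ∩ T : Finset (Fin n)) :=
      hTinj.mono (by intro x; simp)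
    have i2 : Set.InjOn d (T \ A : Finset (Fin n)) :=
      hTinj.mono (by intro x; simp; tauto)
    rw [Finset.card_image_of_injOn i1, Finset.sum_image i1] at u1
    rw [Finset.card_image_of_injOn i2, Finset.sum_image i2] at l1
    have s1 : ∑ i ∈ A, (d i : ℤ) = ∑ i ∈ A ∩ T, (d i : ℤ) + ∑ i ∈ A \ T, (d i : ℤ) :=
      (Finset.sum_inter_add_sum_sdiff A T _).symm
    have s2 : ∑ i ∈ A \ T, (d i : ℤ) ≤ (A \ T).card * (D : ℤ) := by
      have := Finset.sum_le_card_nsmul (A \ T) (fun i => (d i : ℤ)) D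
        (fun i _ => by exact_mod_cast hmax i)
      simpa using this
    have s3 : ∑ i ∈ Aᶜ, ((min A.card (d i) : ℕ) : ℤ) = ∑ i ∈ Aᶜ ∩ T, ((min A.card (d i) : ℕ) : ℤ)
        + ∑ i ∈ Aᶜ \ T, ((min A.card (d i) : ℕ) : ℤ) :=
      (Finset.sum_inter_add_sum_sdiff _ T _).symm
    have e1 : Aᶜ ∩ T = T \ A := by ext x; simp; tauto
    have s4 : ((Aᶜ \ T).card : ℤ) ≤ ∑ i ∈ Aᶜ \ T, ((min A.card (d i) : ℕ) : ℤ) := by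
      have := Finset.card_nsmul_le_sum (Aᶜ \ T) (fun i => ((min A.card (d i) : ℕ) : ℤ)) 1
        (fun i _ => by have := hpos i; exact_mod_cast (by omega : 1 ≤ min A.card (d i)))
      simpa using this
    have k1 : (A ∩ T).card + (A \ T).card = A.card := Finset.card_inter_add_card_sdiff A T
    have k2 : (Aᶜ ∩ T).card + (Aᶜ \ T).card = Aᶜ.card := Finset.card_inter_add_card_sdiff _ T
    have k3 : (T ∩ A).card + (T \ A).card = T.card := Finset.card_inter_add_card_sdiff T A
    have k4 : Aᶜ.card + A.card = n := by
      have := Finset.card_compl_add_card A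
      simpa using this
    rw [Finset.inter_comm T A] at k3
    rw [e1] at k2 s3
    generalize (A ∩ T).card = t at *
    generalize (A \ T).card = e at *
    generalize (T \ A).card = s at *
    generalize (Aᶜ \ T).card = q at *
    have hq : (D : ℤ) - e ≤ q := by omega
    have hs : (s : ℤ) = D - t := by omega
    have hk1 : (A.card : ℤ) = t + e := by omega
    have hkD : (t : ℤ) + e ≤ D := by omega
    have goal : ∑ i ∈ A, (d i : ℤ) ≤ (A.card : ℤ) * ((A.card : ℤ) - 1) +
        ∑ i ∈ Aᶜ, ((min A.card (d i) : ℕ) : ℤ) := by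
      have he : (0 : ℤ) ≤ e * ((e : ℤ) - 1) := by
        rcases Nat.eq_zero_or_pos e with h | h
        · simp [h]
        · have : (1 : ℤ) ≤ e := by exact_mod_cast h
          nlinarith
      rw [s1, s3]
      rw [hs] at l1
      generalize ∑ i ∈ T \ A, ((min A.card (d i) : ℕ) : ℤ) = X at *
      generalize ∑ i ∈ Aᶜ \ T, ((min A.card (d i) : ℕ) : ℤ) = Y at *
      rw [hk1] at l1 ⊢
      nlinarith
    have : ((A.card * (A.card - 1) : ℕ) : ℤ) = (A.card : ℤ) * ((A.card : ℤ) - 1) := by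
      push_cast [Nat.cast_sub h0]; ring
    rw [← this] at goal
    exact_mod_cast goal

lemma exists_sorted (π : Multiset ℕ) : ∃ d : Fin (Multiset.card π) → ℕ,
    Antitone d ∧ Finset.univ.val.map d = π := by
  have hl : (π.sort (· ≥ ·)).length = Multiset.card π := Multiset.length_sort _
  rw [← hl]
  refine ⟨(π.sort (· ≥ ·)).get, ?_, ?_⟩
  · exact (Multiset.pairwise_sort π (· ≥ ·)).sortedGE.antitone_get
  · rw [Fin.univ_val_map, List.ofFn_get, Multiset.sort_eq]

/-- A full sequence (containing every degree `1 ≤ d ≤ D = d_max` at least once, with even sum)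
with `n` elements and `d_max ≤ n/2` is graphic. -/
theorem full_sequence_graphic (π : Multiset ℕ) (D : ℕ)
    (hpos : ∀ d ∈ π, 0 < d) (hmax : ∀ d ∈ π, d ≤ D)
    (hfull : ∀ d, 1 ≤ d → d ≤ D → d ∈ π)
    (heven : Even π.sum) (hD : D ≤ Multiset.card π / 2) :
    Graphic π := by
  classical
  obtain ⟨d, hd, hπ⟩ := exists_sorted π
  have hmem : ∀ i, d i ∈ π := fun i => by
    have : d i ∈ Finset.univ.val.map d := Multiset.mem_map_of_mem d (Finset.mem_univ i)
    rwa [hπ] at this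
  have hsum : ∑ i, d i = π.sum := by
    rw [Finset.sum_eq_multiset_sum, hπ]
  obtain ⟨G, hG⟩ := erdos_gallai d hd (by rw [hsum]; exact heven)
    (full_EG d D (fun i => hpos _ (hmem i)) (fun i => hmax _ (hmem i))
      (fun v h1 h2 => by
        have : v ∈ Finset.univ.val.map d := by rw [hπ]; exact hfull v h1 h2
        obtain ⟨i, _, hi⟩ := Multiset.mem_map.1 this
        exact ⟨i, hi⟩) (by omega))
  refine ⟨G, Classical.decRel _, ?_⟩
  unfold degSeq
  refine Eq.trans (Multiset.map_congr rfl fun v _ => ?_) hπ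
  rw [← hG v, dg_eq_degree]
end

section
/- Let π be a graphic sequence with n elements, maximum element d_max ≤ n/6, minimum element at least 2, and each occurring degree appearing more than once. Let c be the sum of the distinct integers between 1 and d_max that do not appear in π. Then π has a connected realization G such that λ₁(G) ≤ 2c/(|E(G)| − d_max/2). -/
open SimpleGraph Finset

namespace MDP

set_option linter.unusedSectionVars false

variable {V : Type*} [Fintype V] [DecidableEq V]

/-- row sum at `v` of a weight function on unordered pairs -/
noncomputable def rs (x : Sym2 V → ℝ) (v : V) : ℝ := ∑ u, x s(v, u)

/-- fractional realizations of the degree function `d` -/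
def Feas (d : V → ℕ) (x : Sym2 V → ℝ) : Prop :=
  (∀ e, 0 ≤ x e ∧ x e ≤ 1) ∧ (∀ v, x s(v, v) = 0) ∧ ∀ v, rs x v = d v

/-- the fractional pairs -/
noncomputable def Fr (x : Sym2 V → ℝ) : Finset (Sym2 V) :=
  univ.filter (fun e => 0 < x e ∧ x e < 1)

def Ext (d : V → ℕ) (x : Sym2 V → ℝ) : Prop :=
  Feas d x ∧ ∀ Δ : Sym2 V → ℝ, (∀ e, e ∉ Fr x → Δ e = 0) → (∀ v, rs Δ v = 0) → Δ = 0

lemma mem_Fr {x : Sym2 V → ℝ} {e : Sym2 V} : e ∈ Fr x ↔ 0 < x e ∧ x e < 1 := by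
  simp [Fr]

lemma rs_eq (x : Sym2 V → ℝ) (v : V) : rs x v = ∑ e ∈ univ.filter (fun e : Sym2 V => v ∈ e), x e := by
  unfold rs
  refine Finset.sum_bij (fun u _ => s(v, u)) ?_ ?_ ?_ ?_
  · intro u _; simp
  · intro a _ b _ h
    simp at h
    rcases h with h | ⟨h1, h2⟩
    · exact h
    · exact h2.trans h1
  · intro e he
    simp only [mem_filter, mem_univ, true_and] at he
    obtain ⟨u, rfl⟩ := Sym2.mem_iff_exists.1 he
    exact ⟨u, mem_univ _, rfl⟩
  · intro u _; rfl

lemma rs_add (x y : Sym2 V → ℝ) (v : V) : rs (x + y) v = rs x v + rs y v := by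
  simp [rs, Finset.sum_add_distrib]

lemma rs_smul (t : ℝ) (y : Sym2 V → ℝ) (v : V) : rs (t • y) v = t * rs y v := by
  simp [rs, Finset.mul_sum]

lemma push {d : V → ℕ} {x Δ : Sym2 V → ℝ} (hx : Feas d x) (hne : Δ ≠ 0)
    (hs : ∀ e, e ∉ Fr x → Δ e = 0) (h0 : ∀ v, rs Δ v = 0) :
    ∃ t : ℝ, 0 < t ∧ Feas d (x + t • Δ) ∧ (Fr (x + t • Δ)).card < (Fr x).card := by
  classical
  let S : Finset (Sym2 V) := univ.filter (fun e => Δ e ≠ 0)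
  have hS : S.Nonempty := by
    by_contra h
    apply hne
    funext e
    by_contra he
    exact h ⟨e, by simpa [S] using he⟩
  let ρ : Sym2 V → ℝ := fun e => if 0 < Δ e then (1 - x e) / Δ e else x e / (-Δ e)
  obtain ⟨e0, he0, hmin⟩ := S.exists_min_image ρ hS
  have hSF : ∀ e ∈ S, e ∈ Fr x := by
    intro e he
    by_contra h
    simp only [S, mem_filter, mem_univ, true_and] at he
    exact he (hs e h)
  have hρpos : ∀ e ∈ S, 0 < ρ e := by
    intro e he
    have h1 := mem_Fr.1 (hSF e he)
    simp only [S, mem_filter, mem_univ, true_and] at he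
    simp only [ρ]
    split_ifs with h
    · exact div_pos (by linarith [h1.2]) h
    · have : Δ e < 0 := lt_of_le_of_ne (not_lt.1 h) he
      exact div_pos h1.1 (by linarith)
  refine ⟨ρ e0, hρpos e0 he0, ⟨?_, ?_, ?_⟩, ?_⟩
  · intro e
    simp only [Pi.add_apply, Pi.smul_apply, smul_eq_mul]
    by_cases he : e ∈ S
    · have h1 := hmin e he
      have h2 := hρpos e0 he0
      have h3 := mem_Fr.1 (hSF e he)
      simp only [S, mem_filter, mem_univ, true_and] at he
      by_cases h : 0 < Δ e
      · have : ρ e = (1 - x e) / Δ e := by simp [ρ, h]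
        rw [this, le_div_iff₀ h] at h1
        constructor
        · have := mul_pos h2 h; linarith
        · linarith
      · have hn : Δ e < 0 := lt_of_le_of_ne (not_lt.1 h) he
        have : ρ e = x e / (-Δ e) := by simp [ρ, h]
        rw [this, le_div_iff₀ (by linarith)] at h1
        constructor
        · linarith
        · have := mul_pos h2 (neg_pos.2 hn); linarith
    · have : Δ e = 0 := by simpa [S] using he
      rw [this]; simpa using hx.1 e
  · intro v
    have : Δ s(v, v) = 0 := hs _ (by rw [mem_Fr, hx.2.1 v]; simp)
    simp [this, hx.2.1 v]
  · intro v
    rw [rs_add, rs_smul, h0 v, hx.2.2 v]; simp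
  · apply Finset.card_lt_card
    rw [Finset.ssubset_iff_of_subset]
    · refine ⟨e0, hSF e0 he0, ?_⟩
      rw [mem_Fr]
      simp only [Pi.add_apply, Pi.smul_apply, smul_eq_mul]
      simp only [S, mem_filter, mem_univ, true_and] at he0
      by_cases h : 0 < Δ e0
      · have : ρ e0 = (1 - x e0) / Δ e0 := by simp [ρ, h]
        rw [this, div_mul_cancel₀ _ he0]; simp
      · have : ρ e0 = - (x e0 / Δ e0) := by simp [ρ, h, div_neg]
        rw [this, neg_mul, div_mul_cancel₀ _ he0]; simp
    · intro e he
      by_contra h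
      rw [mem_Fr] at he
      have h2 := hs e h
      rw [mem_Fr] at h
      simp [h2] at he
      exact h he

lemma reduce {d : V → ℕ} (Q : (Sym2 V → ℝ) → Prop) (hQ : ∀ z, Q z → Feas d z)
    (hne : ∃ z, Q z)
    (hmove : ∀ z Δ, Q z → (∀ e, e ∉ Fr z → Δ e = 0) → (∀ v, rs Δ v = 0) →
      (∀ t : ℝ, 0 < t → Feas d (z + t • Δ) → Q (z + t • Δ)) ∨
      (∀ t : ℝ, 0 < t → Feas d (z + t • (-Δ)) → Q (z + t • (-Δ)))) :
    ∃ z, Q z ∧ Ext d z := by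
  classical
  obtain ⟨z, hz, hmin⟩ : ∃ z, Q z ∧ ∀ w, Q w → (Fr z).card ≤ (Fr w).card := by
    have h : ∃ k : ℕ, ∃ z, Q z ∧ (Fr z).card = k := by
      obtain ⟨z, hz⟩ := hne; exact ⟨_, z, hz, rfl⟩
    obtain ⟨z, hz, hk⟩ := Nat.find_spec h
    exact ⟨z, hz, fun w hw => by rw [hk]; exact Nat.find_min' h ⟨w, hw, rfl⟩⟩
  refine ⟨z, hz, hQ z hz, ?_⟩
  intro Δ hs h0
  by_contra hΔ
  rcases hmove z Δ hz hs h0 with h | h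
  · obtain ⟨t, ht, hf, hc⟩ := push (hQ z hz) hΔ hs h0
    exact absurd (hmin _ (h t ht hf)) (not_le.2 hc)
  · obtain ⟨t, ht, hf, hc⟩ := push (Δ := -Δ) (hQ z hz) (neg_ne_zero.2 hΔ)
      (fun e he => by simp [hs e he]) (fun v => by
        have := rs_smul (-1) Δ v
        rw [h0 v] at this; simpa using this)
    exact absurd (hmin _ (h t ht hf)) (not_le.2 hc)

end MDP


namespace MDP
set_option linter.unusedSectionVars false

variable {V : Type*} [Fintype V] [DecidableEq V]

lemma ker_exists (S : Finset (Sym2 V)) (T : Finset V) (hST : ∀ e ∈ S, ∀ v ∈ e, v ∈ T)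
    (hc : T.card < S.card) :
    ∃ Δ : Sym2 V → ℝ, Δ ≠ 0 ∧ (∀ e, e ∉ S → Δ e = 0) ∧ ∀ v, rs Δ v = 0 := by
  classical
  let ext : (S → ℝ) →ₗ[ℝ] (Sym2 V → ℝ) :=
    { toFun := fun f e => if h : e ∈ S then f ⟨e, h⟩ else 0
      map_add' := by intro f g; funext e; by_cases h : e ∈ S <;> simp [h]
      map_smul' := by intro f g; funext e; by_cases h : e ∈ S <;> simp [h] }
  let L : (S → ℝ) →ₗ[ℝ] (T → ℝ) :=
    { toFun := fun f v => rs (ext f) v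
      map_add' := by intro f g; funext v; simp [rs_add]
      map_smul' := by intro f g; funext v; simp [rs_smul] }
  have hk : LinearMap.ker L ≠ ⊥ := by
    apply LinearMap.ker_ne_bot_of_finrank_lt
    simpa using hc
  obtain ⟨f, hf, hne⟩ := Submodule.exists_mem_ne_zero_of_ne_bot hk
  refine ⟨ext f, ?_, ?_, ?_⟩
  · intro h
    apply hne
    funext e
    have := congrFun h e.1
    simpa [ext] using this
  · intro e he
    simp [ext, he]
  · intro v
    by_cases hv : v ∈ T
    · have := congrFun (LinearMap.mem_ker.1 hf) ⟨v, hv⟩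
      simpa [L] using this
    · rw [rs_eq]
      apply Finset.sum_eq_zero
      intro e he
      have : e ∉ S := fun h => hv (hST e h v (by simpa using he))
      simp [ext, this]

noncomputable def Vr (x : Sym2 V → ℝ) : Finset V := univ.filter (fun v => ∃ e ∈ Fr x, v ∈ e)

noncomputable def fdeg (x : Sym2 V → ℝ) (v : V) : ℕ := ((Fr x).filter (fun e => v ∈ e)).card

lemma mem_Vr {x : Sym2 V → ℝ} {v : V} : v ∈ Vr x ↔ ∃ e ∈ Fr x, v ∈ e := by simp [Vr]

lemma not_diag {d : V → ℕ} {x : Sym2 V → ℝ} (hx : Feas d x) {e : Sym2 V} (he : e ∈ Fr x) :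
    ¬ e.IsDiag := by
  induction e with
  | _ a b =>
    intro h
    have : a = b := by simpa using h
    subst this
    rw [mem_Fr, hx.2.1 a] at he
    simp at he

/-- the fractional row sum is an integer -/
lemma frac_sum_int {d : V → ℕ} {x : Sym2 V → ℝ} (hx : Feas d x) (v : V) :
    ∃ k : ℤ, ∑ e ∈ (Fr x).filter (fun e => v ∈ e), x e = k := by
  classical
  have h1 := hx.2.2 v
  rw [rs_eq] at h1
  have h2 : ∑ e ∈ univ.filter (fun e : Sym2 V => v ∈ e), x e =
      ∑ e ∈ (Fr x).filter (fun e => v ∈ e), x e +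
      ∑ e ∈ univ.filter (fun e : Sym2 V => v ∈ e ∧ e ∉ Fr x), x e := by
    rw [← Finset.sum_filter_add_sum_filter_not (univ.filter (fun e : Sym2 V => v ∈ e)) (· ∈ Fr x)]
    congr 1
    · apply Finset.sum_congr _ (fun _ _ => rfl)
      ext e; simp [and_comm]
    · apply Finset.sum_congr _ (fun _ _ => rfl)
      ext e; simp
  have h3 : ∑ e ∈ univ.filter (fun e : Sym2 V => v ∈ e ∧ e ∉ Fr x), x e =
      ((univ.filter (fun e : Sym2 V => (v ∈ e ∧ e ∉ Fr x) ∧ x e = 1)).card : ℝ) := by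
    have : ∀ e ∈ univ.filter (fun e : Sym2 V => v ∈ e ∧ e ∉ Fr x), x e = if x e = 1 then 1 else 0 := by
      intro e he
      simp only [mem_filter, mem_univ, true_and, mem_Fr, not_and, not_lt] at he
      have := hx.1 e
      split_ifs with h
      · exact h
      · by_contra h0
        have h5 : 0 < x e := lt_of_le_of_ne this.1 (Ne.symm h0)
        exact h (le_antisymm this.2 (he.2 h5))
    rw [Finset.sum_congr rfl this, Finset.sum_ite, Finset.filter_filter]
    simp
  refine ⟨(d v : ℤ) - ((univ.filter (fun e : Sym2 V => (v ∈ e ∧ e ∉ Fr x) ∧ x e = 1)).card : ℤ), ?_⟩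
  push_cast
  rw [← h3]
  linarith

lemma fdeg_ge {d : V → ℕ} {x : Sym2 V → ℝ} (hx : Feas d x) {v : V} (hv : v ∈ Vr x) :
    2 ≤ fdeg x v := by
  obtain ⟨e, he, hve⟩ := mem_Vr.1 hv
  have hpos : 0 < fdeg x v := Finset.card_pos.2 ⟨e, by simp [he, hve]⟩
  by_contra h
  have h1 : fdeg x v = 1 := by omega
  obtain ⟨e', he'⟩ := Finset.card_eq_one.1 h1
  obtain ⟨k, hk⟩ := frac_sum_int hx v
  rw [he', Finset.sum_singleton] at hk
  have : e' ∈ (Fr x).filter (fun e => v ∈ e) := by rw [he']; simp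
  have h2 := mem_Fr.1 (Finset.mem_filter.1 this).1
  rw [hk] at h2
  have h3 : (0 : ℤ) < k := by exact_mod_cast h2.1
  have h4 : k < 1 := by exact_mod_cast h2.2
  omega

/-- double counting -/
lemma sum_sum_mem {S : Finset (Sym2 V)} (hS : ∀ e ∈ S, ¬ e.IsDiag) (f : Sym2 V → ℝ) :
    ∑ v, ∑ e ∈ S.filter (fun e => v ∈ e), f e = 2 * ∑ e ∈ S, f e := by
  classical
  simp_rw [Finset.sum_filter]
  rw [Finset.sum_comm, Finset.mul_sum]
  apply Finset.sum_congr rfl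
  intro e he
  rw [← Finset.sum_filter]
  have : (univ.filter (fun v => v ∈ e)) = e.toFinset := by ext; simp
  rw [this, Finset.sum_const, Sym2.card_toFinset_of_not_isDiag e (hS e he)]
  simp

lemma handshake {d : V → ℕ} {x : Sym2 V → ℝ} (hx : Feas d x) :
    ∑ v, fdeg x v = 2 * (Fr x).card := by
  have := sum_sum_mem (S := Fr x) (fun e he => not_diag hx he) (fun _ => 1)
  simp only [Finset.sum_const, nsmul_eq_mul, mul_one] at this
  have h2 : ∀ v, fdeg x v = ((Fr x).filter (fun e => v ∈ e)).card := fun v => rfl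
  simp only [h2]
  exact_mod_cast this

lemma fdeg_zero {x : Sym2 V → ℝ} {v : V} (hv : v ∉ Vr x) : fdeg x v = 0 := by
  rw [fdeg, Finset.card_eq_zero, Finset.filter_eq_empty_iff]
  intro e he h
  exact hv (mem_Vr.2 ⟨e, he, h⟩)

lemma Ext_card {d : V → ℕ} {x : Sym2 V → ℝ} (hx : Ext d x) :
    (Fr x).card = (Vr x).card ∧ ∀ v ∈ Vr x, fdeg x v = 2 := by
  have h1 : (Fr x).card ≤ (Vr x).card := by
    by_contra h
    obtain ⟨Δ, hne, hs, h0⟩ := ker_exists (Fr x) (Vr x)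
      (fun e he v hv => mem_Vr.2 ⟨e, he, hv⟩) (not_le.1 h)
    exact hne (hx.2 Δ hs h0)
  have h2 := handshake hx.1
  have h3 : ∑ v, fdeg x v = ∑ v ∈ Vr x, fdeg x v := by
    symm
    apply Finset.sum_subset (Finset.subset_univ _)
    intro v _ hv
    exact fdeg_zero hv
  have h4 : ∑ v ∈ Vr x, 2 ≤ ∑ v ∈ Vr x, fdeg x v := Finset.sum_le_sum (fun v hv => fdeg_ge hx.1 hv)
  have h5 : ∑ v ∈ Vr x, 2 = 2 * (Vr x).card := by simp [mul_comm]
  refine ⟨by omega, ?_⟩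
  intro v hv
  have h6 := (Finset.sum_eq_sum_iff_of_le (fun v hv => fdeg_ge hx.1 hv)).1
    (show ∑ v ∈ Vr x, 2 = ∑ v ∈ Vr x, fdeg x v by omega) v hv
  exact h6.symm

lemma frac_sum_one {d : V → ℕ} {x : Sym2 V → ℝ} (hx : Ext d x) {v : V} (hv : v ∈ Vr x) :
    ∑ e ∈ (Fr x).filter (fun e => v ∈ e), x e = 1 := by
  obtain ⟨k, hk⟩ := frac_sum_int hx.1 v
  have h2 := (Ext_card hx).2 v hv
  have hne : ((Fr x).filter (fun e => v ∈ e)).Nonempty := by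
    rw [← Finset.card_pos]; change 0 < fdeg x v; omega
  have h3 : 0 < ∑ e ∈ (Fr x).filter (fun e => v ∈ e), x e :=
    Finset.sum_pos (fun e he => (mem_Fr.1 (Finset.mem_filter.1 he).1).1) hne
  have h4 : ∑ e ∈ (Fr x).filter (fun e => v ∈ e), x e <
      ∑ e ∈ (Fr x).filter (fun e => v ∈ e), (1 : ℝ) :=
    Finset.sum_lt_sum_of_nonempty hne (fun e he => (mem_Fr.1 (Finset.mem_filter.1 he).1).2)
  have h5 : ∑ e ∈ (Fr x).filter (fun e => v ∈ e), (1 : ℝ) = 2 := by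
    rw [Finset.sum_const]
    change (fdeg x v) • (1 : ℝ) = 2
    rw [h2]; norm_num
  rw [h5] at h4
  rw [hk] at h3 h4 ⊢
  have h6 : (0 : ℤ) < k := by exact_mod_cast h3
  have h7 : k < 2 := by exact_mod_cast h4
  have : k = 1 := by omega
  rw [this]; norm_num

/-- total weight -/
lemma sum_all {d : V → ℕ} {x : Sym2 V → ℝ} (hx : Feas d x) :
    ∑ v, (d v : ℝ) = 2 * ∑ e, x e := by
  classical
  have h := sum_sum_mem (S := univ.filter (fun e : Sym2 V => ¬ e.IsDiag)) (by simp) x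
  have h1 : ∑ e ∈ univ.filter (fun e : Sym2 V => ¬ e.IsDiag), x e = ∑ e, x e := by
    rw [Finset.sum_filter]
    apply Finset.sum_congr rfl
    intro e _
    split_ifs with h
    · induction e with
      | _ a b =>
        simp at h
        subst h
        exact (hx.2.1 a).symm
    · rfl
  rw [h1] at h
  rw [← h]
  apply Finset.sum_congr rfl
  intro v _
  rw [← hx.2.2 v, rs_eq, Finset.filter_filter]
  symm
  apply Finset.sum_subset
  · intro e; simp
  · intro e he he'
    simp only [mem_filter, mem_univ, true_and] at he he'
    have : e.IsDiag := by by_contra h; exact he' ⟨h, he⟩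
    induction e with
    | _ a b =>
      simp at this
      subst this
      exact hx.2.1 a

lemma Fr_even {d : V → ℕ} (hd : Even (∑ v, d v)) {x : Sym2 V → ℝ} (hx : Ext d x) :
    Even (Fr x).card := by
  classical
  have h1 := sum_all hx.1
  have h2 : ∑ e, x e = ∑ e ∈ Fr x, x e + ((univ.filter (fun e => x e = 1)).card : ℝ) := by
    have : ∀ e, x e = (if e ∈ Fr x then x e else 0) + (if x e = 1 then 1 else 0) := by
      intro e
      have := hx.1.1 e
      by_cases h1 : x e = 1
      · simp [mem_Fr, h1]
      · by_cases h0 : x e = 0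
        · simp [h0]
        · have : e ∈ Fr x := mem_Fr.2 ⟨lt_of_le_of_ne this.1 (Ne.symm h0), lt_of_le_of_ne this.2 h1⟩
          simp [this, h1]
    rw [Finset.sum_congr rfl (fun e _ => this e), Finset.sum_add_distrib]
    congr 1
    · rw [← Finset.sum_filter]; apply Finset.sum_congr _ (fun _ _ => rfl); ext; simp
    · simp
  have h3 := sum_sum_mem (S := Fr x) (fun e he => not_diag hx.1 he) x
  have h4 : ∑ v, ∑ e ∈ (Fr x).filter (fun e => v ∈ e), x e = (Vr x).card := by
    rw [← Finset.sum_subset (Finset.subset_univ (Vr x))]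
    · rw [Finset.sum_congr rfl (fun v hv => frac_sum_one hx hv)]; simp
    · intro v _ hv
      have := fdeg_zero hv
      rw [fdeg, Finset.card_eq_zero] at this
      rw [this]; simp
  have h5 := (Ext_card hx).1
  rw [← h5] at h4
  have h6 : (∑ v, d v : ℝ) = (Fr x).card + 2 * ((univ.filter (fun e => x e = 1)).card : ℝ) := by
    rw [h1, h2, mul_add, ← h3, h4]
  have h7 : ∑ v, d v = (Fr x).card + 2 * ((univ.filter (fun e => x e = 1)).card) := by
    exact_mod_cast h6
  rw [h7] at hd
  rw [Nat.even_add] at hd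
  exact hd.2 (even_two_mul _)

end MDP


namespace MDP
set_option linter.unusedSectionVars false

variable {V : Type*} [Fintype V] [DecidableEq V]

open Filter Topology in
lemma small_step {d : V → ℕ} {x Δ : Sym2 V → ℝ} (hx : Feas d x)
    (hp : ∀ e, 0 < Δ e → x e < 1) (hn : ∀ e, Δ e < 0 → 0 < x e)
    (hdiag : ∀ v, Δ s(v, v) = 0) (h0 : ∀ v, rs Δ v = 0) :
    ∃ t : ℝ, 0 < t ∧ Feas d (x + t • Δ) := by
  have key : ∀ᶠ t : ℝ in 𝓝[>] 0, ∀ e, 0 ≤ x e + t * Δ e ∧ x e + t * Δ e ≤ 1 := by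
    rw [Filter.eventually_all]
    intro e
    have hx1 := hx.1 e
    have hc : Tendsto (fun t : ℝ => x e + t * Δ e) (𝓝[>] 0) (𝓝 (x e)) := by
      have : Continuous (fun t : ℝ => x e + t * Δ e) := by fun_prop
      have h := this.tendsto 0
      simp only [zero_mul, add_zero] at h
      exact h.mono_left nhdsWithin_le_nhds
    have hpos : ∀ᶠ t : ℝ in 𝓝[>] 0, 0 < t := eventually_mem_nhdsWithin
    rcases lt_trichotomy (Δ e) 0 with h | h | h
    · filter_upwards [hc.eventually (lt_mem_nhds (hn e h)), hpos] with t h1 h2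
      have := mul_pos h2 (neg_pos.2 h)
      constructor <;> linarith
    · simp [h, hx1]
    · filter_upwards [hc.eventually (gt_mem_nhds (hp e h)), hpos] with t h1 h2
      have := mul_pos h2 h
      constructor <;> linarith
  obtain ⟨t, ht, htpos⟩ := (key.and (eventually_mem_nhdsWithin : ∀ᶠ t : ℝ in 𝓝[>] 0, t ∈ Set.Ioi (0:ℝ))).exists
  refine ⟨t, htpos, fun e => by simpa using ht e, fun v => by simp [hdiag v, hx.2.1 v], fun v => ?_⟩
  rw [rs_add, rs_smul, h0 v, hx.2.2 v]; simp

lemma not_Fr {d : V → ℕ} {x : Sym2 V → ℝ} (hx : Feas d x) {e : Sym2 V} (he : e ∉ Fr x) :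
    x e = 0 ∨ x e = 1 := by
  have := hx.1 e
  by_contra h
  push Not at h
  exact he (mem_Fr.2 ⟨lt_of_le_of_ne this.1 (Ne.symm h.1), lt_of_le_of_ne this.2 h.2⟩)

lemma rs_neg (Δ : Sym2 V → ℝ) (v : V) : rs (-Δ) v = - rs Δ v := by
  simp [rs]

/-- the first half of the rounding operation -/
lemma op_exists {d : V → ℕ} {x : Sym2 V → ℝ} (hx : Ext d x) {f : Sym2 V} (hfd : ¬ f.IsDiag)
    (hf : ∀ v ∈ f, v ∈ Vr x) (hfF : f ∉ Fr x) :
    ∃ z, Ext d z ∧ (∀ e, e ∉ Fr x → e ≠ f → z e = x e) ∧ z f ≠ x f := by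
  classical
  have hx01 := not_Fr hx.1 hfF
  -- sign
  obtain ⟨σ, hσ⟩ : ∃ σ : ℝ, (x f = 0 ∧ σ = 1) ∨ (x f = 1 ∧ σ = -1) := by
    rcases hx01 with h | h
    · exact ⟨1, Or.inl ⟨h, rfl⟩⟩
    · exact ⟨-1, Or.inr ⟨h, rfl⟩⟩
  obtain ⟨Δ, hne, hs, h0⟩ := ker_exists (insert f (Fr x)) (Vr x)
    (by
      intro e he v hv
      rcases Finset.mem_insert.1 he with rfl | he
      · exact hf v hv
      · exact mem_Vr.2 ⟨e, he, hv⟩)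
    (by rw [Finset.card_insert_of_notMem hfF, (Ext_card hx).1]; omega)
  have hΔf : Δ f ≠ 0 := by
    intro h
    apply hne
    apply hx.2 Δ _ h0
    intro e he
    by_cases hef : e = f
    · rw [hef]; exact h
    · exact hs e (by simp [hef, he])
  obtain ⟨Δ', hs', h0', hpos⟩ : ∃ Δ' : Sym2 V → ℝ, (∀ e, e ∉ insert f (Fr x) → Δ' e = 0) ∧
      (∀ v, rs Δ' v = 0) ∧ 0 < σ * Δ' f := by
    have hσ0 : σ ≠ 0 := by rcases hσ with h | h <;> rw [h.2] <;> norm_num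
    rcases lt_or_gt_of_ne (mul_ne_zero hσ0 hΔf) with h | h
    · refine ⟨-Δ, fun e he => by simp [hs e he], fun v => by rw [rs_neg, h0 v]; simp, ?_⟩
      simpa using h
    · exact ⟨Δ, hs, h0, h⟩
  have hdiagS : ∀ v, s(v, v) ∉ insert f (Fr x) := by
    intro v hv
    rcases Finset.mem_insert.1 hv with h | h
    · apply hfd; rw [← h]; simp
    · exact not_diag hx.1 h (by simp)
  have hsgn : ∀ e, e ≠ f → e ∈ insert f (Fr x) → 0 < x e ∧ x e < 1 := by
    intro e h1 h2
    rcases Finset.mem_insert.1 h2 with h | h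
    · exact absurd h h1
    · exact mem_Fr.1 h
  obtain ⟨t, ht, hft⟩ := small_step (Δ := Δ') hx.1
    (by
      intro e he
      by_cases hef : e = f
      · subst hef
        rcases hσ with ⟨h1, h2⟩ | ⟨h1, h2⟩
        · rw [h1]; norm_num
        · rw [h2] at hpos; linarith
      · by_cases hin : e ∈ insert f (Fr x)
        · exact (hsgn e hef hin).2
        · rw [hs' e hin] at he; exact absurd he (lt_irrefl _))
    (by
      intro e he
      by_cases hef : e = f
      · subst hef
        rcases hσ with ⟨h1, h2⟩ | ⟨h1, h2⟩
        · rw [h2] at hpos; linarith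
        · rw [h1]; norm_num
      · by_cases hin : e ∈ insert f (Fr x)
        · exact (hsgn e hef hin).1
        · rw [hs' e hin] at he; exact absurd he (lt_irrefl _))
    (fun v => hs' _ (hdiagS v)) h0'
  obtain ⟨z, hz, hzE⟩ := reduce (d := d)
    (fun z => Feas d z ∧ (∀ e, e ∉ Fr x → e ≠ f → z e = x e) ∧ 0 < σ * (z f - x f))
    (fun z hz => hz.1)
    ⟨x + t • Δ', hft, fun e he hef => by simp [hs' e (by simp [hef, he])], by
      simp only [Pi.add_apply, Pi.smul_apply, smul_eq_mul]
      have := mul_pos ht hpos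
      linarith⟩
    (by
      intro z Δ ⟨hz1, hz2, hz3⟩ hs h0
      have hoff : ∀ e, e ∉ Fr x → e ≠ f → Δ e = 0 := by
        intro e he hef
        apply hs
        rw [mem_Fr, hz2 e he hef, ← mem_Fr]; exact he
      rcases le_total 0 (σ * Δ f) with h | h
      · left
        intro t ht hF
        refine ⟨hF, fun e he hef => by simp [hoff e he hef, hz2 e he hef], ?_⟩
        simp only [Pi.add_apply, Pi.smul_apply, smul_eq_mul]
        have := mul_nonneg ht.le h
        linarith
      · right
        intro t ht hF
        refine ⟨hF, fun e he hef => by simp [hoff e he hef, hz2 e he hef], ?_⟩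
        simp only [Pi.add_apply, Pi.smul_apply, smul_eq_mul, Pi.neg_apply]
        have := mul_nonneg ht.le (neg_nonneg.2 h)
        linarith)
  refine ⟨z, hzE, hz.2.1, ?_⟩
  intro h
  have := hz.2.2
  rw [h] at this
  simp at this

lemma op_Fr {x z : Sym2 V → ℝ} {f : Sym2 V}
    (hoff : ∀ e, e ∉ Fr x → e ≠ f → z e = x e) : Fr z ⊆ insert f (Fr x) := by
  intro e he
  by_contra h
  rw [Finset.mem_insert, not_or] at h
  apply h.2
  rw [mem_Fr, ← hoff e h.2 h.1, ← mem_Fr]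
  exact he

lemma op_Vr {x z : Sym2 V → ℝ} {f : Sym2 V} (hf : ∀ v ∈ f, v ∈ Vr x)
    (hoff : ∀ e, e ∉ Fr x → e ≠ f → z e = x e) : Vr z ⊆ Vr x := by
  intro v hv
  obtain ⟨e, he, hve⟩ := mem_Vr.1 hv
  rcases Finset.mem_insert.1 (op_Fr hoff he) with h | h
  · subst h; exact hf v hve
  · exact mem_Vr.2 ⟨e, h, hve⟩

lemma op_flip {d : V → ℕ} {x z : Sym2 V → ℝ} (hx : Ext d x) (hz : Ext d z) {f : Sym2 V}
    (hf : ∀ v ∈ f, v ∈ Vr x) (hfF : f ∉ Fr x)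
    (hoff : ∀ e, e ∉ Fr x → e ≠ f → z e = x e) (hne : z f ≠ x f) (hfz : f ∉ Fr z) :
    ∀ v ∈ f, v ∉ Vr z := by
  classical
  intro v hv hvz
  -- row sums at v
  have h1 : rs x v = rs z v := by rw [hx.1.2.2 v, hz.1.2.2 v]
  have hdec : ∀ y : Sym2 V → ℝ, rs y v = ∑ e ∈ (Fr x).filter (fun e => v ∈ e), y e + y f +
      ∑ e ∈ univ.filter (fun e => v ∈ e ∧ e ∉ Fr x ∧ e ≠ f), y e := by
    intro y
    rw [rs_eq, ← Finset.sum_filter_add_sum_filter_not _ (· ∈ Fr x),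
      ← Finset.sum_filter_add_sum_filter_not (filter (fun e => ¬ e ∈ Fr x) _) (· = f)]
    rw [← add_assoc]
    congr 1
    · congr 1
      · apply Finset.sum_congr _ (fun _ _ => rfl); ext e; simp [and_comm]
      · have : filter (· = f) (filter (fun e => ¬ e ∈ Fr x) (filter (fun e => v ∈ e) univ)) = {f} := by
          ext e
          simp only [mem_filter, mem_univ, true_and, mem_singleton]
          constructor
          · exact fun h => h.2
          · rintro rfl; exact ⟨⟨hv, hfF⟩, rfl⟩
        rw [this, Finset.sum_singleton]
    · apply Finset.sum_congr _ (fun _ _ => rfl); ext e; simp [and_assoc]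
  rw [hdec x, hdec z] at h1
  have h2 : ∑ e ∈ univ.filter (fun e => v ∈ e ∧ e ∉ Fr x ∧ e ≠ f), x e =
      ∑ e ∈ univ.filter (fun e => v ∈ e ∧ e ∉ Fr x ∧ e ≠ f), z e := by
    apply Finset.sum_congr rfl
    intro e he
    simp only [mem_filter, mem_univ, true_and] at he
    exact (hoff e he.2.1 he.2.2).symm
  rw [frac_sum_one hx (hf v hv)] at h1
  have hc : ((Fr x).filter (fun e => v ∈ e)).card = 2 := (Ext_card hx).2 v (hf v hv)
  obtain ⟨a, b, hab, hS⟩ := Finset.card_eq_two.1 hc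
  rw [hS, Finset.sum_pair hab] at h1
  have ha := hz.1.1 a
  have hb := hz.1.1 b
  have : (z a = 0 ∧ z b = 0) ∨ (z a = 1 ∧ z b = 1) := by
    rcases not_Fr hx.1 hfF with h3 | h3 <;> rcases not_Fr hz.1 hfz with h4 | h4
    · exact absurd (h4.trans h3.symm) hne
    · left; constructor <;> linarith [ha.1, hb.1]
    · right; constructor <;> linarith [ha.2, hb.2]
    · exact absurd (h4.trans h3.symm) hne
  obtain ⟨e, he, hve⟩ := mem_Vr.1 hvz
  rcases Finset.mem_insert.1 (op_Fr hoff he) with h | h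
  · subst h; exact hfz he
  · have : e ∈ ({a, b} : Finset (Sym2 V)) := by rw [← hS]; simp [h, hve]
    have he' := mem_Fr.1 he
    simp only [mem_insert, mem_singleton] at this
    rcases this with rfl | rfl <;> rcases ‹_ ∨ _› with h5 | h5 <;> linarith [h5.1, h5.2, he'.1, he'.2]

lemma op_card {d : V → ℕ} {x z : Sym2 V → ℝ} (hx : Ext d x) (hz : Ext d z) {u v : V} (huv : u ≠ v)
    (hu : u ∈ Vr x) (hv : v ∈ Vr x) (hfF : s(u, v) ∉ Fr x)
    (hoff : ∀ e, e ∉ Fr x → e ≠ s(u, v) → z e = x e) (hne : z s(u, v) ≠ x s(u, v)) :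
    (Fr z).card < (Fr x).card := by
  classical
  have hf : ∀ w ∈ s(u, v), w ∈ Vr x := by
    intro w hw
    rcases Sym2.mem_iff.1 hw with rfl | rfl <;> assumption
  by_cases hfz : s(u, v) ∈ Fr z
  · -- each endpoint loses an edge
    have lose : ∀ w ∈ s(u, v), ∃ e ∈ Fr x, w ∈ e ∧ e ∉ Fr z := by
      intro w hw
      by_contra h
      push Not at h
      have h1 : insert s(u, v) ((Fr x).filter (fun e => w ∈ e)) ⊆ (Fr z).filter (fun e => w ∈ e) := by
        intro e he
        rcases Finset.mem_insert.1 he with rfl | he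
        · simp [hfz]; simpa using hw
        · obtain ⟨h2, h3⟩ := Finset.mem_filter.1 he
          exact Finset.mem_filter.2 ⟨h e h2 h3, h3⟩
      have h2 := Finset.card_le_card h1
      rw [Finset.card_insert_of_notMem (by simp [hfF])] at h2
      have h3 : ((Fr x).filter (fun e => w ∈ e)).card = 2 := (Ext_card hx).2 w (hf w hw)
      have h4 : ((Fr z).filter (fun e => w ∈ e)).card = 2 :=
        (Ext_card hz).2 w (mem_Vr.2 ⟨_, hfz, hw⟩)
      omega
    obtain ⟨e1, h11, h12, h13⟩ := lose u (by simp)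
    obtain ⟨e2, h21, h22, h23⟩ := lose v (by simp)
    have h12' : e1 ≠ e2 := by
      rintro rfl
      have : e1 = s(u, v) := (Sym2.mem_and_mem_iff huv).1 ⟨h12, h22⟩
      rw [this] at h11; exact hfF h11
    have hsub : Fr z ⊆ insert s(u, v) (((Fr x).erase e1).erase e2) := by
      intro e he
      rcases Finset.mem_insert.1 (op_Fr hoff he) with h | h
      · simp [h]
      · apply Finset.mem_insert_of_mem
        refine Finset.mem_erase.2 ⟨?_, Finset.mem_erase.2 ⟨?_, h⟩⟩
        · rintro rfl; exact h23 he
        · rintro rfl; exact h13 he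
    have h3 := Finset.card_le_card hsub
    have h4 := Finset.card_insert_le s(u, v) (((Fr x).erase e1).erase e2)
    rw [Finset.card_erase_of_mem (Finset.mem_erase.2 ⟨h12'.symm, h21⟩), Finset.card_erase_of_mem h11] at h4
    have h5 : 2 ≤ (Fr x).card := by
      have : ({e1, e2} : Finset (Sym2 V)) ⊆ Fr x := by
        intro e he; simp at he; rcases he with rfl | rfl <;> assumption
      have := Finset.card_le_card this
      rwa [Finset.card_pair h12'] at this
    omega
  · have h1 := op_flip hx hz hf hfF hoff hne hfz u (by simp)
    rw [(Ext_card hx).1, (Ext_card hz).1]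
    apply Finset.card_lt_card
    rw [Finset.ssubset_iff_of_subset (op_Vr hf hoff)]
    exact ⟨u, hu, h1⟩

end MDP


namespace MDP
set_option linter.unusedSectionVars false

variable {V : Type*} [Fintype V] [DecidableEq V]

/-- pairs joining the two sides -/
def Cross (s : V → Bool) (e : Sym2 V) : Prop := ¬ (Sym2.map s e).IsDiag

instance (s : V → Bool) : DecidablePred (Cross s) := fun e => by unfold Cross; infer_instance

@[simp] lemma cross_mk (s : V → Bool) (a b : V) : Cross s s(a, b) ↔ s a ≠ s b := by
  simp [Cross]

noncomputable def pot (s : V → Bool) (x : Sym2 V → ℝ) : ℕ :=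
  (univ.filter (fun e => Cross s e ∧ 0 < x e)).card

lemma nbr_card {d : V → ℕ} {x : Sym2 V → ℝ} (v : V) :
    (univ.filter (fun w => s(v, w) ∈ Fr x)).card = fdeg x v := by
  unfold fdeg
  apply Finset.card_bij (fun w _ => s(v, w))
  · intro w hw; simpa using hw
  · intro a _ b _ h
    simp at h
    rcases h with h | ⟨h1, h2⟩
    · exact h
    · exact h2.trans h1
  · intro e he
    obtain ⟨h1, h2⟩ := Finset.mem_filter.1 he
    obtain ⟨w, rfl⟩ := Sym2.mem_iff_exists.1 h2
    exact ⟨w, by simpa using h1, rfl⟩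

lemma fr_ne {d : V → ℕ} {x : Sym2 V → ℝ} (hx : Feas d x) {a b : V} (h : s(a, b) ∈ Fr x) : a ≠ b := by
  rintro rfl; exact not_diag hx h (by simp)

lemma nbrs {d : V → ℕ} {x : Sym2 V → ℝ} (hx : Ext d x) {v : V} (hv : v ∈ Vr x) :
    ∃ a b, a ≠ b ∧ a ≠ v ∧ b ≠ v ∧ s(v, a) ∈ Fr x ∧ s(v, b) ∈ Fr x ∧
      ∀ w, s(v, w) ∈ Fr x → w = a ∨ w = b := by
  have h := nbr_card (d := d) (x := x) v
  rw [(Ext_card hx).2 v hv] at h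
  obtain ⟨a, b, hab, hS⟩ := Finset.card_eq_two.1 h
  have ha : s(v, a) ∈ Fr x := by
    have : a ∈ univ.filter (fun w => s(v, w) ∈ Fr x) := by rw [hS]; simp
    simpa using this
  have hb : s(v, b) ∈ Fr x := by
    have : b ∈ univ.filter (fun w => s(v, w) ∈ Fr x) := by rw [hS]; simp
    simpa using this
  refine ⟨a, b, hab, (fr_ne hx.1 ha).symm, (fr_ne hx.1 hb).symm, ha, hb, ?_⟩
  intro w hw
  have : w ∈ univ.filter (fun w => s(v, w) ∈ Fr x) := by simpa using hw
  rw [hS] at this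
  simpa using this

lemma mem_Vr_left {x : Sym2 V → ℝ} {a b : V} (h : s(a, b) ∈ Fr x) : a ∈ Vr x :=
  mem_Vr.2 ⟨_, h, by simp⟩

lemma mem_Vr_right {x : Sym2 V → ℝ} {a b : V} (h : s(a, b) ∈ Fr x) : b ∈ Vr x :=
  mem_Vr.2 ⟨_, h, by simp⟩

/-- the rounding operation -/
lemma op {d : V → ℕ} (s : V → Bool) {x : Sym2 V → ℝ} (hx : Ext d x) {u v : V} (huv : u ≠ v)
    (hu : u ∈ Vr x) (hv : v ∈ Vr x) (hfF : s(u, v) ∉ Fr x) :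
    ∃ z, Ext d z ∧ (∀ e, e ∉ Fr x → e ≠ s(u, v) → z e = x e) ∧ z s(u, v) ≠ x s(u, v) ∧
      (Fr z).card < (Fr x).card ∧ pot s z ≤ pot s x + (if s u ≠ s v then 1 else 0) := by
  have hf : ∀ w ∈ s(u, v), w ∈ Vr x := by
    intro w hw
    rcases Sym2.mem_iff.1 hw with rfl | rfl <;> assumption
  obtain ⟨z, hz, hoff, hne⟩ := op_exists hx (f := s(u, v)) (by simpa using huv) hf hfF
  refine ⟨z, hz, hoff, hne, op_card hx hz huv hu hv hfF hoff hne, ?_⟩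
  have hsub : univ.filter (fun e => Cross s e ∧ 0 < z e) ⊆
      univ.filter (fun e => Cross s e ∧ 0 < x e) ∪ (if s u ≠ s v then {s(u, v)} else ∅) := by
    intro e he
    simp only [mem_filter, mem_univ, true_and] at he
    rw [Finset.mem_union]
    by_cases h : e = s(u, v)
    · right
      rw [h, cross_mk] at he
      rw [if_pos he.1, h]; simp
    · left
      simp only [mem_filter, mem_univ, true_and]
      refine ⟨he.1, ?_⟩
      by_cases h2 : e ∈ Fr x
      · exact (mem_Fr.1 h2).1
      · rw [← hoff e h2 h]; exact he.2
  have h1 := (Finset.card_le_card hsub).trans (Finset.card_union_le _ _)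
  unfold pot
  refine h1.trans ?_
  split_ifs <;> simp

lemma Fr_empty_of_Vr {x : Sym2 V → ℝ} (h : ¬ (Fr x).Nonempty) : Fr x = ∅ :=
  Finset.not_nonempty_iff_eq_empty.1 h

lemma crude {d : V → ℕ} (hd : Even (∑ v, d v)) (s : V → Bool) (j : ℕ) :
    ∀ {x : Sym2 V → ℝ}, Ext d x → (Fr x).card ≤ 2 * j + 2 →
    ∃ z, Ext d z ∧ Fr z = ∅ ∧ pot s z ≤ pot s x + j := by
  induction j with
  | zero =>
    intro x hx hc
    refine ⟨x, hx, ?_, by simp⟩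
    by_contra hne
    obtain ⟨e, he⟩ := Finset.nonempty_iff_ne_empty.2 hne
    induction e with
    | _ v w =>
      obtain ⟨a, b, hab, hav, hbv, ha, hb, -⟩ := nbrs hx (mem_Vr_left he)
      have : ({v, a, b} : Finset V) ⊆ Vr x := by
        intro p hp
        simp at hp
        rcases hp with rfl | rfl | rfl
        · exact mem_Vr_left he
        · exact mem_Vr_right ha
        · exact mem_Vr_right hb
      have h3 := Finset.card_le_card this
      rw [Finset.card_eq_three.2 ⟨v, a, b, hav.symm, hbv.symm, hab, rfl⟩, ← (Ext_card hx).1] at h3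
      omega
  | succ j ih =>
    intro x hx hc
    have heven := Fr_even hd hx
    by_cases hne : (Fr x).Nonempty
    · obtain ⟨e, he⟩ := hne
      induction e with
      | _ v w =>
        obtain ⟨a, b, hab, hav, hbv, ha, hb, hall⟩ := nbrs hx (mem_Vr_left he)
        have hsub : ({v, a, b} : Finset V) ⊆ Vr x := by
          intro p hp
          simp at hp
          rcases hp with rfl | rfl | rfl
          · exact mem_Vr_left he
          · exact mem_Vr_right ha
          · exact mem_Vr_right hb
        have h3 := Finset.card_le_card hsub
        have hcard : ({v, a, b} : Finset V).card = 3 :=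
          Finset.card_eq_three.2 ⟨v, a, b, hav.symm, hbv.symm, hab, rfl⟩
        rw [hcard, ← (Ext_card hx).1] at h3
        have h4 : 3 < (Fr x).card := by
          rcases Nat.lt_or_ge 3 (Fr x).card with h | h
          · exact h
          · have : (Fr x).card = 3 := by omega
            rw [this] at heven; exact absurd heven (by decide)
        rw [(Ext_card hx).1, ← hcard] at h4
        obtain ⟨p, hp, hp2⟩ := Finset.exists_mem_notMem_of_card_lt_card h4
        simp only [mem_insert, mem_singleton, not_or] at hp2
        have hnF : s(v, p) ∉ Fr x := by
          intro h
          rcases hall p h with h | h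
          · exact hp2.2.1 h
          · exact hp2.2.2 h
        obtain ⟨z, hz, -, -, hlt, hpot⟩ := op s hx (Ne.symm hp2.1) (mem_Vr_left he) hp hnF
        have hez := Fr_even hd hz
        obtain ⟨y, hy, hy0, hyp⟩ := ih hz (by
          obtain ⟨p, hp⟩ := heven
          obtain ⟨q, hq⟩ := hez
          omega)
        refine ⟨y, hy, hy0, ?_⟩
        split_ifs at hpot <;> omega
    · exact ⟨x, hx, Fr_empty_of_Vr hne, by omega⟩

lemma two_triangles {d : V → ℕ} (hd : Even (∑ v, d v)) (s : V → Bool)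
    {x : Sym2 V → ℝ} (hx : Ext d x) (hall : ∀ u ∈ Vr x, ∀ v ∈ Vr x, u ≠ v → s u = s v → s(u, v) ∈ Fr x)
    (hcr : ∀ e ∈ Fr x, ¬ Cross s e) :
    ∃ z, Ext d z ∧ Fr z = ∅ ∧ pot s z ≤ pot s x + 1 := by
  by_cases hne : (Fr x).Nonempty
  swap
  · exact ⟨x, hx, Fr_empty_of_Vr hne, by omega⟩
  have same : ∀ {y : Sym2 V → ℝ}, (∀ e ∈ Fr y, ¬ Cross s e) → ∀ {a b}, s(a, b) ∈ Fr y → s a = s b := by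
    intro y hy a b h
    have := hy _ h
    simpa using this
  -- each side of `Vr x` is a triangle
  have tri : ∀ v ∈ Vr x, ∃ a b, a ≠ b ∧ a ≠ v ∧ b ≠ v ∧ s(v, a) ∈ Fr x ∧ s(v, b) ∈ Fr x ∧ s(a, b) ∈ Fr x ∧
      ∀ w ∈ Vr x, s w = s v → w = v ∨ w = a ∨ w = b := by
    intro v hv
    obtain ⟨a, b, hab, hav, hbv, ha, hb, hal⟩ := nbrs hx hv
    refine ⟨a, b, hab, hav, hbv, ha, hb, ?_, ?_⟩
    · apply hall a (mem_Vr_right ha) b (mem_Vr_right hb) hab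
      rw [← same hcr ha, same hcr hb]
    · intro w hw hs
      by_cases h : w = v
      · exact Or.inl h
      · exact Or.inr (hal w (hall v hv w hw (Ne.symm h) hs.symm))
  obtain ⟨e, he⟩ := hne
  obtain ⟨v, hv⟩ : ∃ v, v ∈ Vr x := by
    induction e with
    | _ v w => exact ⟨v, mem_Vr_left he⟩
  obtain ⟨a, b, hab, hav, hbv, hva, hvb, hab', hside⟩ := tri v hv
  obtain ⟨w, hw, hsw⟩ : ∃ w ∈ Vr x, s w ≠ s v := by
    by_contra h
    push Not at h
    have : Vr x = {v, a, b} := by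
      ext w
      simp only [mem_insert, mem_singleton]
      constructor
      · intro hw; exact hside w hw (h w hw)
      · rintro (rfl | rfl | rfl)
        · exact hv
        · exact mem_Vr_right hva
        · exact mem_Vr_right hvb
    have h2 := Fr_even hd hx
    rw [(Ext_card hx).1, this, Finset.card_eq_three.2 ⟨v, a, b, hav.symm, hbv.symm, hab, rfl⟩] at h2
    exact absurd h2 (by decide)
  have hvw : v ≠ w := by rintro rfl; exact hsw rfl
  have hnF : s(v, w) ∉ Fr x := fun h => hsw (same hcr h).symm
  obtain ⟨z, hz, hoff, hnez, hlt, hpot⟩ := op s hx hvw hv hw hnF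
  have hf : ∀ p ∈ s(v, w), p ∈ Vr x := by
    intro p hp
    rcases Sym2.mem_iff.1 hp with rfl | rfl <;> assumption
  -- the new pair is not fractional
  have full : ∀ p ∈ Vr z, p ≠ v → p ≠ w → ∀ q, s(p, q) ∈ Fr x → s(p, q) ∈ Fr z := by
    intro p hp hpv hpw q hq
    have hsub : (Fr z).filter (fun e => p ∈ e) ⊆ (Fr x).filter (fun e => p ∈ e) := by
      intro e he
      obtain ⟨h1, h2⟩ := Finset.mem_filter.1 he
      refine Finset.mem_filter.2 ⟨?_, h2⟩
      rcases Finset.mem_insert.1 (op_Fr hoff h1) with h | h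
      · subst h
        rcases Sym2.mem_iff.1 h2 with h | h
        · exact absurd h hpv
        · exact absurd h hpw
      · exact h
    have h1 : ((Fr z).filter (fun e => p ∈ e)).card = 2 := (Ext_card hz).2 p hp
    have h2 : ((Fr x).filter (fun e => p ∈ e)).card = 2 := (Ext_card hx).2 p (mem_Vr_left hq)
    have h3 := Finset.eq_of_subset_of_card_le hsub (by omega)
    have : s(p, q) ∈ (Fr x).filter (fun e => p ∈ e) := by simp [hq]
    rw [← h3] at this
    exact (Finset.mem_filter.1 this).1
  have haw : a ≠ w := by
    rintro rfl; exact hsw (same hcr hva).symm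
  have hbw : b ≠ w := by
    rintro rfl; exact hsw (same hcr hvb).symm
  have hfz : s(v, w) ∉ Fr z := by
    intro hin
    obtain ⟨p, q, hpq, hpv, hqv, hp, hq, hpqall⟩ := nbrs hz (mem_Vr_left hin)
    -- one of a, b is in Vr z
    have hab_or : a ∈ Vr z ∨ b ∈ Vr z := by
      have : ∃ r, r ≠ w ∧ s(v, r) ∈ Fr z := by
        by_cases h : p = w
        · exact ⟨q, fun h2 => hpq (h.trans h2.symm), hq⟩
        · exact ⟨p, h, hp⟩
      obtain ⟨r, hrw, hr⟩ := this
      rcases Finset.mem_insert.1 (op_Fr hoff hr) with h | h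
      · simp at h
        rcases h with h | ⟨h1, h2⟩
        · exact absurd h hrw
        · exact absurd h1 hvw
      · rcases hside r (mem_Vr_right h) (same hcr h).symm with h2 | h2 | h2
        · exact absurd h2.symm (fr_ne hx.1 h)
        · left; rw [← h2]; exact mem_Vr_right hr
        · right; rw [← h2]; exact mem_Vr_right hr
    have hboth : a ∈ Vr z ∧ b ∈ Vr z := by
      rcases hab_or with h | h
      · exact ⟨h, mem_Vr_right (full a h hav haw b hab')⟩
      · exact ⟨mem_Vr_right (full b h hbv hbw a (by rw [Sym2.eq_swap]; exact hab')), h⟩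
    have h1 := full a hboth.1 hav haw v (by rw [Sym2.eq_swap]; exact hva)
    have h2 := full b hboth.2 hbv hbw v (by rw [Sym2.eq_swap]; exact hvb)
    rw [Sym2.eq_swap] at h1 h2
    have e1 := hpqall a h1
    have e2 := hpqall b h2
    have e3 := hpqall w hin
    grind
  have hvz := op_flip hx hz hf hnF hoff hnez hfz v (by simp)
  have hwz := op_flip hx hz hf hnF hoff hnez hfz w (by simp)
  have hFsub : Fr z ⊆ Fr x := by
    intro e he
    rcases Finset.mem_insert.1 (op_Fr hoff he) with h | h
    · subst h; exact absurd he hfz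
    · exact h
  refine ⟨z, hz, ?_, ?_⟩
  · by_contra hne
    obtain ⟨e, he⟩ := Finset.nonempty_iff_ne_empty.2 hne
    obtain ⟨p, hp⟩ : ∃ p, p ∈ Vr z := by
      induction e with
      | _ v w => exact ⟨v, mem_Vr_left he⟩
    have hpx := op_Vr hf hoff hp
    have hpv : p ≠ v := by rintro rfl; exact hvz hp
    have hpw : p ≠ w := by rintro rfl; exact hwz hp
    by_cases h : s p = s v
    · have := full p hp hpv hpw v (hall p hpx v hv hpv h)
      exact hvz (mem_Vr_right this)
    · have hpsw : s p = s w := by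
        revert h hsw; cases s p <;> cases s v <;> cases s w <;> simp
      have := full p hp hpv hpw w (hall p hpx w hw hpw hpsw)
      exact hwz (mem_Vr_right this)
  · rw [if_pos (Ne.symm hsw)] at hpot
    exact hpot

lemma side_card {d : V → ℕ} (s : V → Bool)
    {x : Sym2 V → ℝ} (hx : Ext d x) (hall : ∀ u ∈ Vr x, ∀ v ∈ Vr x, u ≠ v → s u = s v → s(u, v) ∈ Fr x)
    (c : Bool) : ((Vr x).filter (fun v => s v = c)).card ≤ 3 := by
  by_cases h : ((Vr x).filter (fun v => s v = c)).Nonempty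
  · obtain ⟨v, hv⟩ := h
    obtain ⟨hv, hc⟩ := Finset.mem_filter.1 hv
    obtain ⟨a, b, -, -, -, -, -, hal⟩ := nbrs hx hv
    have : (Vr x).filter (fun v => s v = c) ⊆ {v, a, b} := by
      intro w hw
      obtain ⟨hw, hcw⟩ := Finset.mem_filter.1 hw
      simp only [mem_insert, mem_singleton]
      by_cases h : w = v
      · exact Or.inl h
      · exact Or.inr (hal w (hall v hv w hw (Ne.symm h) (hc.trans hcw.symm)))
    exact (Finset.card_le_card this).trans Finset.card_le_three
  · rw [Finset.not_nonempty_iff_eq_empty.1 h]; simp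

theorem rounding {d : V → ℕ} (hd : Even (∑ v, d v)) (s : V → Bool) (N : ℕ) :
    ∀ {x : Sym2 V → ℝ}, Ext d x → (Fr x).card ≤ N →
    ∃ z, Ext d z ∧ Fr z = ∅ ∧ pot s z ≤ pot s x + 2 ∧
      ((∀ e ∈ Fr x, ¬ Cross s e) → pot s z ≤ pot s x + 1) := by
  induction N with
  | zero =>
    intro x hx hc
    refine ⟨x, hx, by simpa using hc, by omega, by omega⟩
  | succ N ih =>
    intro x hx hc
    by_cases h : ∃ u ∈ Vr x, ∃ v ∈ Vr x, u ≠ v ∧ s u = s v ∧ s(u, v) ∉ Fr x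
    · obtain ⟨u, hu, v, hv, huv, hs, hF⟩ := h
      obtain ⟨z, hz, hoff, hne, hlt, hpot⟩ := op s hx huv hu hv hF
      obtain ⟨y, hy, hy0, hy1, hy2⟩ := ih hz (by omega)
      rw [if_neg (by simp [hs])] at hpot
      refine ⟨y, hy, hy0, by omega, ?_⟩
      intro hcr
      have := hy2 (by
        intro e he
        rcases Finset.mem_insert.1 (op_Fr hoff he) with h | h
        · rw [h]; simp [hs]
        · exact hcr e h)
      omega
    · push Not at h
      by_cases hcr : ∀ e ∈ Fr x, ¬ Cross s e
      · obtain ⟨z, hz, h0, h1⟩ := two_triangles hd s hx h hcr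
        exact ⟨z, hz, h0, by omega, fun _ => h1⟩
      · have hc6 : (Fr x).card ≤ 2 * 2 + 2 := by
          rw [(Ext_card hx).1]
          have h1 := side_card s hx h true
          have h2 := side_card s hx h false
          have h3 := Finset.card_filter_add_card_filter_not (s := Vr x) (fun v => s v = true)
          have h4 : (Vr x).filter (fun v => ¬ s v = true) = (Vr x).filter (fun v => s v = false) := by
            ext; simp
          rw [h4] at h3
          omega
        obtain ⟨z, hz, h0, h1⟩ := crude hd s 2 hx hc6
        exact ⟨z, hz, h0, h1, fun h => absurd h hcr⟩

end MDP


namespace MDP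
set_option linter.unusedSectionVars false

/-- a 2-SAT lemma -/
lemma two_sat {L : Type*} [Fintype L] [DecidableEq L] (ng : L → L) (hng : ∀ a, ng (ng a) = a)
    (R : L → L → Prop) (hrefl : ∀ a, R a a) (htrans : ∀ a b c, R a b → R b c → R a c)
    (hcon : ∀ a b, R a b → R (ng b) (ng a)) (hno : ∀ a, R a (ng a) → R (ng a) a → False) :
    ∃ T : Finset L, (∀ a b, a ∈ T → R a b → b ∈ T) ∧ ∀ a, a ∈ T ↔ ng a ∉ T := by
  classical
  let good : Finset L → Prop := fun T => (∀ a b, a ∈ T → R a b → b ∈ T) ∧ ∀ a, a ∈ T → ng a ∉ T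
  obtain ⟨T, hT, hmax⟩ := Finset.exists_max_image (univ.filter good) Finset.card
    ⟨∅, by simp [good]⟩
  have hg : good T := by simpa using hT
  refine ⟨T, hg.1, fun a => ⟨hg.2 a, ?_⟩⟩
  have main : ∀ a, a ∉ T → ng a ∉ T → ¬ R a (ng a) → False := by
    intro a ha hna hR
    let T' := T ∪ univ.filter (fun b => R a b)
    have hT' : good T' := by
      constructor
      · intro b c hb hbc
        rcases Finset.mem_union.1 hb with h | h
        · exact Finset.mem_union_left _ (hg.1 b c h hbc)
        · exact Finset.mem_union_right _ (by
            simp only [mem_filter, mem_univ, true_and] at h ⊢; exact htrans _ _ _ h hbc)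
      · intro b hb hnb
        have key : ∀ b, R a (ng b) → R b (ng a) := fun b h => by
          have := hcon _ _ h; rwa [hng] at this
        rcases Finset.mem_union.1 hb with h | h <;> rcases Finset.mem_union.1 hnb with h' | h'
        · exact hg.2 b h h'
        · simp only [mem_filter, mem_univ, true_and] at h'
          exact hna (hg.1 _ _ h (key b h'))
        · simp only [mem_filter, mem_univ, true_and] at h
          exact hna (hg.1 _ _ h' (hcon _ _ h))
        · simp only [mem_filter, mem_univ, true_and] at h h'
          exact hR (htrans _ _ _ h (key b h'))
    have h1 := hmax T' (by simpa using hT')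
    have h2 : T.card < T'.card := by
      apply Finset.card_lt_card
      rw [Finset.ssubset_iff_of_subset Finset.subset_union_left]
      exact ⟨a, Finset.mem_union_right _ (by simp [hrefl]), ha⟩
    omega
  intro hna
  by_contra ha
  by_cases hR : R a (ng a)
  · apply main (ng a) hna (by rwa [hng])
    rw [hng]
    exact fun h => hno a hR h
  · exact main a ha hna hR

variable {V : Type*} [Fintype V] [DecidableEq V]

noncomputable def cut (s : V → Bool) (x : Sym2 V → ℝ) : ℝ :=
  ∑ e ∈ univ.filter (fun e => Cross s e), x e

lemma cut_add (s : V → Bool) (x y : Sym2 V → ℝ) : cut s (x + y) = cut s x + cut s y := by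
  simp [cut, Finset.sum_add_distrib]

lemma cut_smul (s : V → Bool) (t : ℝ) (y : Sym2 V → ℝ) : cut s (t • y) = t * cut s y := by
  simp [cut, Finset.mul_sum]

/-- indicator of a pair -/
def ind (f : Sym2 V) : Sym2 V → ℝ := fun e => if e = f then 1 else 0

lemma cut_ind (s : V → Bool) (f : Sym2 V) : cut s (ind f) = if Cross s f then 1 else 0 := by
  simp [cut, ind, Finset.sum_ite_eq']

lemma rs_ind {a b : V} (hab : a ≠ b) (v : V) :
    rs (ind s(a, b)) v = (if v = a then 1 else 0) + (if v = b then 1 else 0) := by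
  unfold rs ind
  by_cases h1 : v = a
  · subst h1
    rw [Finset.sum_eq_single b]
    · simp [hab]
    · intro c _ hc; simp [hc]; exact fun h => absurd h hab
    · simp
  · by_cases h2 : v = b
    · subst h2
      rw [Finset.sum_eq_single a]
      · simp [h1, Sym2.eq_swap]
      · intro c _ hc; simp [h1, hc]
      · simp
    · simp [h1, h2]

def sg (b : Bool) : ℝ := if b then 1 else -1
def hh (b : Bool) : ℝ := if b then 0 else 1

def FD (x Δ : Sym2 V → ℝ) : Prop :=
  (∀ e, 0 < Δ e → x e < 1) ∧ (∀ e, Δ e < 0 → 0 < x e) ∧ ∀ v, Δ s(v, v) = 0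

lemma FD_add {x Δ Δ' : Sym2 V → ℝ} (h : FD x Δ) (h' : FD x Δ') : FD x (Δ + Δ') := by
  refine ⟨fun e he => ?_, fun e he => ?_, fun v => by simp [h.2.2 v, h'.2.2 v]⟩
  · simp only [Pi.add_apply] at he
    rcases lt_or_ge 0 (Δ e) with h1 | h1
    · exact h.1 e h1
    · exact h'.1 e (by linarith)
  · simp only [Pi.add_apply] at he
    rcases lt_or_ge (Δ e) 0 with h1 | h1
    · exact h.2.1 e h1
    · exact h'.2.1 e (by linarith)

lemma FD_ind {x : Sym2 V → ℝ} {a b : V} (hab : a ≠ b) (hx : x s(a, b) < 1) : FD x (ind s(a, b)) := by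
  refine ⟨fun e he => ?_, fun e he => ?_, fun v => ?_⟩
  · unfold ind at he
    split_ifs at he with h
    · rw [h]; exact hx
    · exact absurd he (lt_irrefl _)
  · unfold ind at he
    split_ifs at he <;> linarith
  · simp only [ind]
    rw [if_neg]
    simp only [Sym2.eq_iff]
    rintro (⟨h1, h2⟩ | ⟨h1, h2⟩)
    · exact hab (h1.symm.trans h2)
    · exact hab (h2.symm.trans h1)

lemma FD_neg_ind {x : Sym2 V → ℝ} {a b : V} (hab : a ≠ b) (hx : 0 < x s(a, b)) :
    FD x (-ind s(a, b)) := by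
  refine ⟨fun e he => ?_, fun e he => ?_, fun v => ?_⟩
  · simp only [Pi.neg_apply, ind] at he
    split_ifs at he <;> linarith
  · simp only [Pi.neg_apply, ind] at he
    split_ifs at he with h
    · rw [h]; exact hx
    · simp at he
  · simp only [ind, Pi.neg_apply]
    rw [if_neg]
    · simp
    · simp only [Sym2.eq_iff]
      rintro (⟨h1, h2⟩ | ⟨h1, h2⟩)
      · exact hab (h1.symm.trans h2)
      · exact hab (h2.symm.trans h1)

/-- implications -/
inductive Step (s : V → Bool) (x : Sym2 V → ℝ) : V × Bool → V × Bool → Prop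
  | i1 (u v : V) (hs : s u ≠ s v) (h : 0 < x s(u, v)) : Step s x (u, false) (v, true)
  | i2 (u v : V) (hs : u ≠ v) (h : x s(u, v) < 1) : Step s x (u, true) (v, false)
  | i3 (u v w : V) (h1 : s u = s v) (h2 : s v = s w) (hne : u ≠ v) (h : x s(u, v) < 1)
      (h' : 0 < x s(v, w)) : Step s x (u, true) (w, true)
  | i4 (u v w : V) (h1 : s u = s v) (h2 : s v = s w) (hne : u ≠ v) (h : x s(u, v) < 1)
      (h' : 0 < x s(v, w)) : Step s x (w, false) (u, false)

def Conn (s : V → Bool) (x : Sym2 V → ℝ) (l l' : V × Bool) : Prop :=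
  ∃ Δ : Sym2 V → ℝ, FD x Δ ∧
    (∀ v, rs Δ v = (if v = l.1 then sg l.2 else 0) - (if v = l'.1 then sg l'.2 else 0)) ∧
    (cut s Δ ≤ hh l'.2 - hh l.2 - 1 ∨
      (cut s Δ ≤ hh l'.2 - hh l.2 ∧ xor (s l.1) l.2 = xor (s l'.1) l'.2))

lemma Conn_refl (s : V → Bool) (x : Sym2 V → ℝ) (l : V × Bool) : Conn s x l l := by
  refine ⟨0, ⟨by simp, by simp, by simp⟩, by simp [rs], Or.inr ⟨by simp [cut], rfl⟩⟩

lemma Conn_trans {s : V → Bool} {x : Sym2 V → ℝ} {l l' l'' : V × Bool} (h : Conn s x l l')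
    (h' : Conn s x l' l'') : Conn s x l l'' := by
  obtain ⟨Δ, h1, h2, h3⟩ := h
  obtain ⟨Δ', h1', h2', h3'⟩ := h'
  refine ⟨Δ + Δ', FD_add h1 h1', fun v => by rw [rs_add, h2, h2']; ring, ?_⟩
  rw [cut_add]
  rcases h3 with h3 | h3 <;> rcases h3' with h3' | h3'
  · left; linarith
  · left; linarith
  · left; linarith
  · right; exact ⟨by linarith, h3.2.trans h3'.2⟩

lemma Step_Conn {s : V → Bool} {x : Sym2 V → ℝ} (hx0 : ∀ v, x s(v, v) = 0) {l l' : V × Bool}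
    (h : Step s x l l') : Conn s x l l' := by
  cases h with
  | i1 u v hs h =>
    have huv : u ≠ v := by rintro rfl; exact hs rfl
    refine ⟨-ind s(u, v), FD_neg_ind huv h, fun w => ?_, Or.inr ⟨?_, ?_⟩⟩
    · rw [rs_neg, rs_ind huv]; simp only [sg]; split_ifs <;> norm_num at *
    · have := cut_smul s (-1) (ind s(u, v))
      rw [neg_one_smul] at this
      rw [this, cut_ind, if_pos (by simpa using hs)]; norm_num [hh]
    · revert hs; cases s u <;> cases s v <;> simp
  | i2 u v huv h =>
    refine ⟨ind s(u, v), FD_ind huv h, fun w => ?_, ?_⟩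
    · rw [rs_ind huv]; simp only [sg]; split_ifs <;> norm_num at *
    · by_cases hs : s u = s v
      · left; rw [cut_ind, if_neg (by simp [hs])]; norm_num [hh]
      · right
        refine ⟨by rw [cut_ind, if_pos (by simpa using hs)]; norm_num [hh], ?_⟩
        revert hs; cases s u <;> cases s v <;> simp
  | i3 u v w h1 h2 hne h h' =>
    have hvw : v ≠ w := by rintro rfl; rw [hx0] at h'; exact lt_irrefl _ h'
    refine ⟨ind s(u, v) + -ind s(v, w), FD_add (FD_ind hne h) (FD_neg_ind hvw h'), fun p => ?_,
      Or.inr ⟨?_, ?_⟩⟩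
    · rw [rs_add, rs_neg, rs_ind hne, rs_ind hvw]; simp only [sg]; simp; ring
    · have := cut_smul s (-1) (ind s(v, w))
      rw [neg_one_smul] at this
      rw [cut_add, this, cut_ind, cut_ind, if_neg (by simp [h1]), if_neg (by simp [h2])]; norm_num [hh]
    · simp [h1, h2]
  | i4 u v w h1 h2 hne h h' =>
    have hvw : v ≠ w := by rintro rfl; rw [hx0] at h'; exact lt_irrefl _ h'
    refine ⟨ind s(u, v) + -ind s(v, w), FD_add (FD_ind hne h) (FD_neg_ind hvw h'), fun p => ?_,
      Or.inr ⟨?_, ?_⟩⟩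
    · rw [rs_add, rs_neg, rs_ind hne, rs_ind hvw]; simp only [sg]; split_ifs <;> norm_num at *
    · have := cut_smul s (-1) (ind s(v, w))
      rw [neg_one_smul] at this
      rw [cut_add, this, cut_ind, cut_ind, if_neg (by simp [h1]), if_neg (by simp [h2])]; norm_num [hh]
    · simp [h1, h2]

theorem structure_K {d : V → ℕ} {s : V → Bool} {x : Sym2 V → ℝ} (hx : Feas d x)
    (hopt : ∀ y, Feas d y → cut s x ≤ cut s y) :
    ∃ K : Finset V, (∀ u v, u ∉ K → v ∉ K → s u ≠ s v → x s(u, v) = 0) ∧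
      (∀ u v, u ∈ K → v ∈ K → u ≠ v → x s(u, v) = 1) ∧
      (∀ u v w, u ∈ K → w ∉ K → s u = s v → s v = s w → u ≠ v → x s(u, v) < 1 → x s(v, w) = 0) := by
  classical
  have hconn : ∀ l l', Relation.ReflTransGen (Step s x) l l' → Conn s x l l' := by
    intro l l' h
    induction h with
    | refl => exact Conn_refl s x l
    | tail _ h ih => exact Conn_trans ih (Step_Conn hx.2.1 h)
  obtain ⟨T, hT, hT2⟩ := two_sat (L := V × Bool) (fun l => (l.1, !l.2)) (by simp)
    (Relation.ReflTransGen (Step s x)) (fun a => Relation.ReflTransGen.refl)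
    (fun a b c h h' => h.trans h')
    (by
      intro a b h
      induction h with
      | refl => exact Relation.ReflTransGen.refl
      | tail _ h ih =>
        refine Relation.ReflTransGen.head ?_ ih
        cases h with
        | i1 u v hs h => exact Step.i1 v u hs.symm (by rwa [Sym2.eq_swap])
        | i2 u v hs h => exact Step.i2 v u hs.symm (by rwa [Sym2.eq_swap])
        | i3 u v w h1 h2 hne h h' => exact Step.i4 u v w h1 h2 hne h h'
        | i4 u v w h1 h2 hne h h' => exact Step.i3 u v w h1 h2 hne h h')
    (by
      intro a h1 h2
      obtain ⟨Δ, f1, r1, c1⟩ := hconn _ _ h1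
      obtain ⟨Δ', f2, r2, c2⟩ := hconn _ _ h2
      have hc1 : cut s Δ ≤ hh (!a.2) - hh a.2 - 1 := by
        rcases c1 with h | h
        · exact h
        · exfalso; have := h.2; revert this; simp
      have hc2 : cut s Δ' ≤ hh a.2 - hh (!a.2) - 1 := by
        rcases c2 with h | h
        · exact h
        · exfalso; have := h.2; revert this; simp
      have hF := FD_add f1 f2
      obtain ⟨t, ht, hft⟩ := small_step (Δ := Δ + Δ') hx hF.1 hF.2.1 hF.2.2
        (fun v => by rw [rs_add, r1, r2]; ring)
      have := hopt _ hft
      rw [cut_add, cut_smul, cut_add] at this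
      nlinarith)
  refine ⟨univ.filter (fun v => (v, true) ∈ T), ?_, ?_, ?_⟩
  all_goals simp only [mem_filter, mem_univ, true_and]
  · intro u v hu hv hs
    by_contra h
    have h0 : 0 < x s(u, v) := lt_of_le_of_ne (hx.1 _).1 (Ne.symm h)
    have hu' : (u, false) ∈ T := by rw [hT2]; exact hu
    exact hv (hT _ _ hu' (Relation.ReflTransGen.single (Step.i1 u v hs h0)))
  · intro u v hu hv hs
    by_contra h
    have h0 : x s(u, v) < 1 := lt_of_le_of_ne (hx.1 _).2 h
    have := hT _ _ hu (Relation.ReflTransGen.single (Step.i2 u v hs h0))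
    rw [hT2] at this
    exact this hv
  · intro u v w hu hw h1 h2 hne h
    by_contra h3
    have h0 : 0 < x s(v, w) := lt_of_le_of_ne (hx.1 _).1 (Ne.symm h3)
    exact hw (hT _ _ hu (Relation.ReflTransGen.single (Step.i3 u v w h1 h2 hne h h0)))

/-- passing from the fractional cut to the number of cross pairs in the support -/
lemma pot_le {d : V → ℕ} {s : V → Bool} {x : Sym2 V → ℝ} (hx : Ext d x) (K : Finset V)
    (hK : ∀ e ∈ Fr x, Cross s e → ∃ w ∈ K, w ∈ e) : (pot s x : ℝ) ≤ cut s x + K.card := by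
  classical
  have h1 : (pot s x : ℝ) - cut s x = ∑ e ∈ univ.filter (fun e => Cross s e),
      ((if 0 < x e then 1 else 0) - x e) := by
    rw [Finset.sum_sub_distrib, ← Finset.sum_filter, Finset.filter_filter]
    simp [pot, cut]
  have h2 : ∀ e ∈ univ.filter (fun e => Cross s e),
      ((if 0 < x e then 1 else 0) - x e) ≤ ∑ w ∈ K, (if e ∈ Fr x ∧ w ∈ e then 1 - x e else 0) := by
    intro e he
    have hnn : ∀ w ∈ K, 0 ≤ (if e ∈ Fr x ∧ w ∈ e then 1 - x e else 0) := by
      intro w _; split_ifs with h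
      · linarith [(hx.1.1 e).2]
      · exact le_rfl
    by_cases hF : e ∈ Fr x
    · obtain ⟨w, hw, hwe⟩ := hK e hF (by simpa using he)
      have := Finset.single_le_sum hnn hw
      rw [if_pos ⟨hF, hwe⟩] at this
      rw [if_pos (mem_Fr.1 hF).1]
      exact this
    · refine le_trans ?_ (Finset.sum_nonneg hnn)
      rcases not_Fr hx.1 hF with h | h <;> simp [h]
  have h3 := Finset.sum_le_sum h2
  rw [← h1, Finset.sum_comm] at h3
  have h4 : ∀ w ∈ K, ∑ e ∈ univ.filter (fun e => Cross s e),
      (if e ∈ Fr x ∧ w ∈ e then 1 - x e else 0) ≤ 1 := by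
    intro w _
    calc _ ≤ ∑ e, (if e ∈ Fr x ∧ w ∈ e then 1 - x e else 0) := by
            apply Finset.sum_le_sum_of_subset_of_nonneg (Finset.subset_univ _)
            intro e _ _
            split_ifs with h
            · linarith [(hx.1.1 e).2]
            · exact le_rfl
      _ = ∑ e ∈ (Fr x).filter (fun e => w ∈ e), (1 - x e) := by
            rw [← Finset.sum_filter]
            apply Finset.sum_congr _ (fun _ _ => rfl)
            ext e; simp
      _ ≤ 1 := by
            rw [Finset.sum_sub_distrib]
            by_cases hw : w ∈ Vr x
            · rw [frac_sum_one hx hw, Finset.sum_const]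
              change (fdeg x w) • (1 : ℝ) - 1 ≤ 1
              rw [(Ext_card hx).2 w hw]; norm_num
            · have := fdeg_zero hw
              rw [fdeg, Finset.card_eq_zero] at this
              rw [this]; simp
  have h5 := Finset.sum_le_sum h4
  simp only [Finset.sum_const, nsmul_eq_mul, mul_one] at h5
  linarith

end MDP


namespace MDP
set_option linter.unusedSectionVars false

variable {V : Type*} [Fintype V] [DecidableEq V]

/-- cross weight at `v` -/
noncomputable def cw (s : V → Bool) (x : Sym2 V → ℝ) (v : V) : ℝ :=
  ∑ u ∈ univ.filter (fun u => s u ≠ s v), x s(v, u)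

/-- same-side weight at `v` -/
noncomputable def sw (s : V → Bool) (x : Sym2 V → ℝ) (v : V) : ℝ :=
  ∑ u ∈ univ.filter (fun u => s u = s v), x s(v, u)

lemma sw_add_cw (s : V → Bool) (x : Sym2 V → ℝ) (v : V) : sw s x v + cw s x v = rs x v := by
  unfold sw cw rs
  exact Finset.sum_filter_add_sum_filter_not _ _ _

lemma sum_mem_eq (f : Sym2 V → ℝ) (v : V) :
    ∑ e ∈ univ.filter (fun e : Sym2 V => v ∈ e), f e = ∑ u, f s(v, u) := (rs_eq f v).symm

lemma cut_split (s : V → Bool) (x : Sym2 V → ℝ) (v : V) :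
    cut s x = cw s x v + ∑ e ∈ univ.filter (fun e => v ∉ e), if Cross s e then x e else 0 := by
  unfold cut
  rw [Finset.sum_filter, ← Finset.sum_filter_add_sum_filter_not univ (fun e => v ∈ e)]
  congr 1
  rw [sum_mem_eq (fun e => if Cross s e then x e else 0) v]
  unfold cw
  rw [Finset.sum_filter]
  apply Finset.sum_congr rfl
  intro u _
  simp only [cross_mk]
  congr 1
  exact propext ne_comm

def flip (s : V → Bool) (v : V) : V → Bool := Function.update s v (!s v)

lemma flip_self (s : V → Bool) (v : V) : flip s v v = !s v := by simp [flip]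
lemma flip_ne (s : V → Bool) {v u : V} (h : u ≠ v) : flip s v u = s u := by simp [flip, h]

lemma cw_flip (s : V → Bool) {x : Sym2 V → ℝ} (hx0 : ∀ v, x s(v, v) = 0) (v : V) :
    cw (flip s v) x v = sw s x v := by
  unfold cw sw
  rw [Finset.sum_filter, Finset.sum_filter]
  apply Finset.sum_congr rfl
  intro u _
  by_cases h : u = v
  · subst h; simp [hx0]
  · rw [flip_self, flip_ne s h]
    cases s u <;> cases s v <;> simp

lemma cut_flip (s : V → Bool) {x : Sym2 V → ℝ} (hx0 : ∀ v, x s(v, v) = 0) (v : V) :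
    cut (flip s v) x = cut s x + sw s x v - cw s x v := by
  rw [cut_split (flip s v) x v, cut_split s x v, cw_flip s hx0]
  have : ∑ e ∈ univ.filter (fun e => v ∉ e), (if Cross (flip s v) e then x e else 0) =
      ∑ e ∈ univ.filter (fun e => v ∉ e), (if Cross s e then x e else 0) := by
    apply Finset.sum_congr rfl
    intro e he
    simp only [mem_filter, mem_univ, true_and] at he
    induction e with
    | _ a b =>
      simp only [Sym2.mem_iff, not_or] at he
      simp only [cross_mk]
      rw [flip_ne s (Ne.symm he.1), flip_ne s (Ne.symm he.2)]
  rw [this]; ring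

lemma swcw_flip (s : V → Bool) {x : Sym2 V → ℝ} {u v : V} (hs : s u ≠ s v) :
    sw (flip s v) x u = sw s x u + x s(u, v) ∧ cw (flip s v) x u = cw s x u - x s(u, v) := by
  have huv : u ≠ v := by rintro rfl; exact hs rfl
  have h1 : sw (flip s v) x u = sw s x u + x s(u, v) := by
    unfold sw
    have : univ.filter (fun w => flip s v w = flip s v u) = insert v (univ.filter (fun w => s w = s u)) := by
      ext w
      simp only [mem_filter, mem_univ, true_and, mem_insert]
      rw [flip_ne s huv]
      by_cases h : w = v
      · subst h
        simp [flip_self]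
        revert hs; cases s u <;> cases s w <;> simp
      · simp [flip_ne s h, h]
    rw [this, Finset.sum_insert (by simp; exact hs.symm)]
    ring
  refine ⟨h1, ?_⟩
  have h2 := sw_add_cw (flip s v) x u
  have h3 := sw_add_cw s x u
  linarith

lemma cut_flip2 (s : V → Bool) {x : Sym2 V → ℝ} (hx0 : ∀ v, x s(v, v) = 0) {u v : V} (hs : s u ≠ s v) :
    cut (flip (flip s v) u) x = cut s x + sw s x u + sw s x v - cw s x u - cw s x v + 2 * x s(u, v) := by
  rw [cut_flip _ hx0, cut_flip _ hx0, (swcw_flip s hs).1, (swcw_flip s hs).2]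
  ring

/-- the K-weight of a vertex -/
noncomputable def tw (s : V → Bool) (x : Sym2 V → ℝ) (K : Finset V) (v : V) : ℝ :=
  ∑ u ∈ K.filter (fun u => s u = s v), x s(v, u) + if v ∈ K then 1 else 0

def kk (s : V → Bool) (K : Finset V) (b : Bool) : ℕ := (K.filter (fun u => s u = b)).card

lemma kk_add (s : V → Bool) (K : Finset V) : kk s K true + kk s K false = K.card := by
  unfold kk
  have h := Finset.card_filter_add_card_filter_not (s := K) (fun v => s v = true)
  have : K.filter (fun v => ¬ s v = true) = K.filter (fun v => s v = false) := by ext; simp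
  rw [this] at h
  exact h

section
variable {d : V → ℕ} {s : V → Bool} {x : Sym2 V → ℝ} {K : Finset V}

lemma sum_tw : ∑ v, tw s x K v = ∑ v ∈ K, sw s x v + K.card := by
  unfold tw sw
  rw [Finset.sum_add_distrib]
  congr 1
  · simp_rw [Finset.sum_filter]
    rw [Finset.sum_comm]
    apply Finset.sum_congr rfl
    intro u _
    apply Finset.sum_congr rfl
    intro v _
    rw [Sym2.eq_swap]
    congr 1
    exact propext eq_comm
  · simp

/-- the cut is determined by the cross weights of `K` -/
lemma cut_eq (h1 : ∀ u v, u ∉ K → v ∉ K → s u ≠ s v → x s(u, v) = 0)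
    (h2 : ∀ u v, u ∈ K → v ∈ K → u ≠ v → x s(u, v) = 1) :
    cut s x = ∑ v ∈ K, cw s x v - kk s K true * kk s K false := by
  let g : V → V → ℝ := fun u v => if s v ≠ s u then x s(u, v) else 0
  have hg : ∀ v, cw s x v = ∑ u, g v u := by
    intro v; unfold cw; rw [Finset.sum_filter]
  have hgs : ∀ u v, g u v = g v u := by
    intro u v; simp only [g]; rw [Sym2.eq_swap]; congr 1; exact propext ne_comm
  have hdouble : 2 * cut s x = ∑ v, cw s x v := by
    have h := sum_sum_mem (S := univ.filter (fun e => Cross s e)) (by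
      intro e he
      induction e with
      | _ a b =>
        simp at he
        simp
        rintro rfl; exact he rfl) x
    unfold cut
    rw [← h]
    apply Finset.sum_congr rfl
    intro v _
    rw [hg v, Finset.filter_filter]
    have := sum_mem_eq (fun e => if Cross s e then x e else 0) v
    rw [Finset.sum_filter] at this
    rw [Finset.sum_filter]
    convert this using 1
    · apply Finset.sum_congr rfl
      intro e _
      by_cases h1 : Cross s e <;> by_cases h2 : v ∈ e <;> simp [h1, h2]
    · apply Finset.sum_congr rfl
      intro u _
      simp only [g, cross_mk]
      congr 1; exact propext ne_comm
  have hsplit : ∑ v, cw s x v = ∑ v ∈ K, cw s x v + ∑ v ∈ Kᶜ, cw s x v := by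
    rw [Finset.sum_add_sum_compl]
  have hout : ∑ v ∈ Kᶜ, cw s x v = ∑ v ∈ K, ∑ u ∈ Kᶜ, g v u := by
    rw [Finset.sum_comm]
    apply Finset.sum_congr rfl
    intro v hv
    rw [hg, ← Finset.sum_add_sum_compl K]
    have : ∑ u ∈ Kᶜ, g v u = 0 := by
      apply Finset.sum_eq_zero
      intro u hu
      simp only [g]
      split_ifs with h
      · exact h1 v u (by simpa using hv) (by simpa using hu) (Ne.symm h)
      · rfl
    rw [this, add_zero]
    apply Finset.sum_congr rfl
    intro u _
    exact hgs v u
  have hin : ∑ v ∈ K, cw s x v = ∑ v ∈ K, ∑ u ∈ K, g v u + ∑ v ∈ K, ∑ u ∈ Kᶜ, g v u := by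
    rw [← Finset.sum_add_distrib]
    apply Finset.sum_congr rfl
    intro v _
    rw [hg, Finset.sum_add_sum_compl]
  have hKK : ∑ v ∈ K, ∑ u ∈ K, g v u = 2 * ((kk s K true : ℝ) * kk s K false) := by
    have : ∀ v ∈ K, ∑ u ∈ K, g v u = if s v = true then (kk s K false : ℝ) else kk s K true := by
      intro v hv
      have : ∀ u ∈ K, g v u = if s u = !s v then 1 else 0 := by
        intro u hu
        simp only [g]
        by_cases h : s u = s v
        · simp [h]
        · have h' : s u = !s v := by revert h; cases s u <;> cases s v <;> simp
          rw [if_pos h, if_pos h']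
          exact h2 v u hv hu (by rintro rfl; exact h rfl)
      rw [Finset.sum_congr rfl this, ← Finset.sum_filter]
      simp only [Finset.sum_const, nsmul_eq_mul, mul_one, kk]
      cases s v <;> simp
    rw [Finset.sum_congr rfl this, Finset.sum_ite]
    have h4 : K.filter (fun v => ¬ s v = true) = K.filter (fun v => s v = false) := by ext; simp
    rw [h4]
    simp only [Finset.sum_const, nsmul_eq_mul, kk]
    ring
  linarith

lemma cut_formula (hx : Feas d x) (h1 : ∀ u v, u ∉ K → v ∉ K → s u ≠ s v → x s(u, v) = 0)
    (h2 : ∀ u v, u ∈ K → v ∈ K → u ≠ v → x s(u, v) = 1) :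
    cut s x = ∑ v ∈ K, (d v : ℝ) - ∑ v, tw s x K v + K.card - kk s K true * kk s K false := by
  rw [cut_eq h1 h2, sum_tw]
  have : ∑ v ∈ K, cw s x v = ∑ v ∈ K, (d v : ℝ) - ∑ v ∈ K, sw s x v := by
    rw [← Finset.sum_sub_distrib]
    apply Finset.sum_congr rfl
    intro v _
    have := sw_add_cw s x v
    rw [hx.2.2 v] at this
    linarith
  rw [this]; ring

lemma tw_dichotomy (hx : Feas d x) (h1 : ∀ u v, u ∉ K → v ∉ K → s u ≠ s v → x s(u, v) = 0)
    (h2 : ∀ u v, u ∈ K → v ∈ K → u ≠ v → x s(u, v) = 1)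
    (h3 : ∀ u v w, u ∈ K → w ∉ K → s u = s v → s v = s w → u ≠ v → x s(u, v) < 1 → x s(v, w) = 0)
    (v : V) : tw s x K v = kk s K (s v) ∨
      (v ∉ K ∧ tw s x K v = sw s x v ∧ cw s x v ≤ kk s K (!s v)) := by
  by_cases hv : v ∈ K
  · left
    unfold tw kk
    rw [if_pos hv]
    have hmem : v ∈ K.filter (fun u => s u = s v) := by simp [hv]
    rw [← Finset.sum_erase_add _ _ hmem, hx.2.1 v]
    have : ∀ u ∈ (K.filter (fun u => s u = s v)).erase v, x s(v, u) = 1 := by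
      intro u hu
      obtain ⟨hne, hu⟩ := Finset.mem_erase.1 hu
      exact h2 v u hv (Finset.mem_filter.1 hu).1 (Ne.symm hne)
    rw [Finset.sum_congr rfl this]
    simp only [Finset.sum_const, nsmul_eq_mul, mul_one, add_zero]
    have := Finset.card_erase_add_one hmem
    exact_mod_cast this
  · by_cases hall : ∀ u ∈ K, s u = s v → x s(v, u) = 1
    · left
      unfold tw kk
      rw [if_neg hv, Finset.sum_congr rfl (g := fun _ => 1) (by
        intro u hu
        obtain ⟨h, h'⟩ := Finset.mem_filter.1 hu
        exact hall u h h')]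
      simp
    · right
      push Not at hall
      obtain ⟨u, hu, hsu, hne⟩ := hall
      refine ⟨hv, ?_, ?_⟩
      · unfold tw sw
        rw [if_neg hv, add_zero]
        apply Finset.sum_subset
        · intro w hw; simp at hw ⊢; exact hw.2
        · intro w hw hw'
          simp only [mem_filter, mem_univ, true_and, not_and] at hw hw'
          have hwK : w ∉ K := fun h => hw' h hw
          refine h3 u v w hu hwK hsu hw.symm (by rintro rfl; exact hv hu) ?_
          rw [Sym2.eq_swap]
          exact lt_of_le_of_ne (hx.1 _).2 hne
      · unfold cw kk
        calc _ ≤ ∑ w ∈ univ.filter (fun w => s w ≠ s v), (if w ∈ K then (1:ℝ) else 0) := by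
              apply Finset.sum_le_sum
              intro w hw
              simp only [mem_filter, mem_univ, true_and] at hw
              split_ifs with h
              · exact (hx.1 _).2
              · exact (h1 v w hv h (Ne.symm hw)).le
          _ = _ := by
              rw [← Finset.sum_filter, Finset.filter_filter]
              simp only [Finset.sum_const, nsmul_eq_mul, mul_one]
              congr 2
              ext w
              simp only [mem_filter, mem_univ, true_and]
              cases s w <;> cases s v <;> simp

lemma tw_nonneg (hx : Feas d x) (v : V) : 0 ≤ tw s x K v := by
  unfold tw
  have := Finset.sum_nonneg (s := K.filter (fun u => s u = s v)) (f := fun u => x s(v, u)) (fun u _ => (hx.1 _).1)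
  split_ifs <;> linarith

/-- the pair bound -/
lemma tw_pair (hx : Feas d x) (h1 : ∀ u v, u ∉ K → v ∉ K → s u ≠ s v → x s(u, v) = 0)
    (h2 : ∀ u v, u ∈ K → v ∈ K → u ≠ v → x s(u, v) = 1)
    (h3 : ∀ u v w, u ∈ K → w ∉ K → s u = s v → s v = s w → u ≠ v → x s(u, v) < 1 → x s(v, w) = 0)
    {u v : V} (hs : s u ≠ s v) (hopt : cut s x ≤ cut (flip (flip s v) u) x) :
    min (min (d u : ℝ) (d v)) K.card ≤ tw s x K u + tw s x K v := by
  have hsu : s u = !s v := by revert hs; cases s u <;> cases s v <;> simp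
  have hsv : (!s u) = s v := by rw [hsu]; simp
  have hk : (K.card : ℝ) = kk s K (s u) + kk s K (s v) := by
    have := kk_add s K
    rw [← this, hsu]
    cases s v <;> push_cast <;> simp [add_comm]
  have hu := tw_dichotomy hx h1 h2 h3 u
  have hv := tw_dichotomy hx h1 h2 h3 v
  have ru := sw_add_cw s x u
  have rv := sw_add_cw s x v
  rw [hx.2.2] at ru rv
  rw [hsv] at hu
  rw [← hsu] at hv
  rcases hu with hu | ⟨hu1, hu2, hu3⟩ <;> rcases hv with hv | ⟨hv1, hv2, hv3⟩
  · rw [hu, hv, ← hk]; exact min_le_right _ _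
  · refine (min_le_left _ _).trans ((min_le_right _ _).trans ?_)
    linarith
  · refine (min_le_left _ _).trans ((min_le_left _ _).trans ?_)
    linarith
  · rw [cut_flip2 s hx.2.1 hs, h1 u v hu1 hv1 hs] at hopt
    refine (min_le_left _ _).trans ?_
    have : min (d u : ℝ) (d v) ≤ ((d u : ℝ) + d v) / 2 := by
      rcases le_total (d u : ℝ) (d v) with h | h
      · rw [min_eq_left h]; linarith
      · rw [min_eq_right h]; linarith
    linarith

end

end MDP


namespace MDP
set_option linter.unusedSectionVars false

lemma sum_max (D : ℕ) (y : ℤ) (h0 : 0 ≤ y) (h1 : y ≤ D + 1) :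
    ∑ p ∈ Icc 1 D, 2 * max ((p : ℤ) - y) 0 = (D - y) * (D - y + 1) := by
  induction D with
  | zero =>
    simp only [Nat.cast_zero] at h1 ⊢
    have : y = 0 ∨ y = 1 := by omega
    rcases this with rfl | rfl <;> simp
  | succ D ih =>
    by_cases h : y ≤ D + 1
    · rw [Finset.sum_Icc_succ_top (by omega), ih h]
      rw [max_eq_left (by push_cast; omega)]
      push_cast; ring
    · have hy : y = D + 2 := by push_cast at h1; omega
      rw [Finset.sum_eq_zero]
      · rw [hy]; push_cast; ring
      · intro p hp
        rw [Finset.mem_Icc] at hp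
        rw [max_eq_right (by push_cast at *; omega)]; simp

def phi (y1 y2 κ p : ℤ) : ℤ := max (p - y1) 0 + max (p - y2) 0 - min p κ

lemma sum_phi (D : ℕ) (y1 y2 κ : ℤ) (h1 : 0 ≤ y1) (h1' : y1 ≤ D + 1) (h2 : 0 ≤ y2) (h2' : y2 ≤ D + 1)
    (h3 : 0 ≤ κ) (h3' : κ ≤ D + 1) :
    2 * ∑ p ∈ Icc 1 D, phi y1 y2 κ p = (D - y1) * (D - y1 + 1) + (D - y2) * (D - y2 + 1)
      + (D - κ) * (D - κ + 1) - D * (D + 1) := by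
  have e1 := sum_max D y1 h1 h1'
  have e2 := sum_max D y2 h2 h2'
  have e3 := sum_max D κ h3 h3'
  have e4 := sum_max D 0 le_rfl (by omega)
  rw [← e1, ← e2, ← e3]
  have e5 : (D : ℤ) * (D + 1) = ∑ p ∈ Icc 1 D, 2 * max ((p : ℤ) - 0) 0 := by rw [e4]; ring
  rw [e5, Finset.mul_sum, ← Finset.sum_add_distrib, ← Finset.sum_add_distrib, ← Finset.sum_sub_distrib]
  apply Finset.sum_congr rfl
  intro p _
  unfold phi
  have : min (p : ℤ) κ = p - max ((p : ℤ) - κ) 0 := by omega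
  rw [this, max_eq_left (a := (p : ℤ) - 0) (by omega)]
  ring

lemma numeric (D k l : ℕ) (hD : 3 ≤ D) (hlk : l ≤ k) (hk1 : 1 ≤ k) (hkD : k ≤ D) (hkl : k + l ≤ D + 1) :
    ∃ y1 y2 : ℤ, 0 ≤ y1 ∧ 0 ≤ y2 ∧
      (k * y1 + l * y2 - k * l + ∑ p ∈ Icc 1 D, phi y1 y2 (k + l : ℕ) p ≤ if k + l = 1 then 0 else 1) ∧
      ∀ p : ℕ, 2 ≤ p → p ≤ D → phi y1 y2 (k + l : ℕ) p ≤ - min ((k + l : ℕ) : ℤ) 2 := by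
  by_cases h : k + l = 1
  · have hk : k = 1 := by omega
    have hl : l = 0 := by omega
    subst hk hl
    refine ⟨D, D, by omega, by omega, ?_, ?_⟩
    · have := sum_phi D D D ((1 + 0 : ℕ) : ℤ) (by omega) (by omega) (by omega) (by omega) (by simp) (by simp)
      rw [if_pos rfl]
      push_cast at this ⊢
      nlinarith
    · intro p h2 hp
      unfold phi; push_cast; omega
  · refine ⟨D - k + 2, D - l + 1, by omega, by omega, ?_, ?_⟩
    · have := sum_phi D (D - k + 2) (D - l + 1) ((k + l : ℕ) : ℤ) (by omega) (by omega) (by omega) (by omega) (by omega) (by omega)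
      rw [if_neg h]
      push_cast at this ⊢
      nlinarith
    · intro p h2 hp
      unfold phi; push_cast; omega

variable {V : Type*} [Fintype V] [DecidableEq V]

lemma sum_pairs (p : V → V) (hp : ∀ v, p (p v) = v) (s : V → Bool) (b : Bool)
    (hs : ∀ v, p v ≠ v → s (p v) ≠ s v) (g : V → ℝ) :
    ∑ v, g v = ∑ v ∈ univ.filter (fun v => p v ≠ v ∧ s v = b), (g v + g (p v)) +
      ∑ v ∈ univ.filter (fun v => p v = v), g v := by
  have h1 : ∑ v ∈ univ.filter (fun v => p v ≠ v ∧ s v = b), g (p v) =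
      ∑ v ∈ univ.filter (fun v => p v ≠ v ∧ s v ≠ b), g v := by
    apply Finset.sum_nbij' p p
    · intro v hv
      simp only [mem_filter, mem_univ, true_and] at hv ⊢
      refine ⟨by rw [hp]; exact hv.1.symm, ?_⟩
      have := hs v hv.1
      rw [hv.2] at this; exact this
    · intro v hv
      simp only [mem_filter, mem_univ, true_and] at hv ⊢
      refine ⟨by rw [hp]; exact hv.1.symm, ?_⟩
      have := hs v hv.1
      revert this; have := hv.2; revert this
      cases s v <;> cases s (p v) <;> cases b <;> simp
    · intro v _; exact hp v
    · intro v _; exact hp v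
    · intro v _; rfl
  rw [Finset.sum_add_distrib, h1]
  rw [← Finset.sum_filter_add_sum_filter_not univ (fun v => p v = v), add_comm]
  congr 1
  rw [← Finset.sum_filter_add_sum_filter_not _ (fun v => s v = b), Finset.filter_filter, Finset.filter_filter]

theorem main_ineq {d : V → ℕ} {s : V → Bool} {x : Sym2 V → ℝ} {K : Finset V} {D : ℕ} (hD : 3 ≤ D)
    (hd2 : ∀ v, 2 ≤ d v) (hdD : ∀ v, d v ≤ D) (hn : 6 * D ≤ Fintype.card V)
    (p : V → V) (hp : ∀ v, p (p v) = v) (hfix : ∀ u v, p u = u → p v = v → u = v)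
    (hmis : ∑ v, |(d v : ℝ) - d (p v)| + 2 * ∑ v ∈ univ.filter (fun v => p v = v), (d v : ℝ) ≤ 2 * D)
    (heq : ∀ v, ∃ w, d w = d v ∧ p w ≠ w ∧ d (p w) = d w)
    (hs : ∀ v, p v ≠ v → s (p v) ≠ s v)
    (hopt : ∀ v, p v ≠ v → cut s x ≤ cut (flip (flip s (p v)) v) x)
    (hx : Feas d x) (h1 : ∀ u v, u ∉ K → v ∉ K → s u ≠ s v → x s(u, v) = 0)
    (h2 : ∀ u v, u ∈ K → v ∈ K → u ≠ v → x s(u, v) = 1)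
    (h3 : ∀ u v w, u ∈ K → w ∉ K → s u = s v → s v = s w → u ≠ v → x s(u, v) < 1 → x s(v, w) = 0) :
    cut s x = 0 ∨ cut s x + K.card + 2 ≤
      ((∑ q ∈ (Icc 1 D).filter (fun q => ∀ v, d v ≠ q), q : ℕ) : ℝ) := by
  classical
  have hcut0 : 0 ≤ cut s x := Finset.sum_nonneg (fun e _ => (hx.1 e).1)
  by_cases hKe : K = ∅
  · left
    rw [cut_eq h1 h2, hKe]; simp [kk]
  obtain ⟨w0, hw0⟩ := Finset.nonempty_iff_ne_empty.2 hKe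
  obtain ⟨b, hb⟩ : ∃ b, kk s K (!b) ≤ kk s K b := by
    rcases le_total (kk s K true) (kk s K false) with h | h
    · exact ⟨false, by simpa using h⟩
    · exact ⟨true, by simpa using h⟩
  have hkl : kk s K b + kk s K (!b) = K.card := by
    have := kk_add s K
    cases b <;> simp <;> omega
  have hprod : (kk s K true : ℝ) * kk s K false = kk s K b * kk s K (!b) := by
    cases b <;> simp [mul_comm]
  -- same side clique weight
  have hsw : ∀ v ∈ K, (kk s K (s v) : ℝ) - 1 ≤ sw s x v := by
    intro v hv
    have hmem : v ∈ K.filter (fun u => s u = s v) := by simp [hv]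
    have : ∑ u ∈ (K.filter (fun u => s u = s v)).erase v, (1 : ℝ) ≤ sw s x v := by
      unfold sw
      calc _ = ∑ u ∈ (K.filter (fun u => s u = s v)).erase v, x s(v, u) := by
            apply Finset.sum_congr rfl
            intro u hu
            obtain ⟨hne, hu⟩ := Finset.mem_erase.1 hu
            exact (h2 v u hv (Finset.mem_filter.1 hu).1 (Ne.symm hne)).symm
        _ ≤ _ := by
            apply Finset.sum_le_sum_of_subset_of_nonneg
            · intro u hu
              simp at hu ⊢; exact hu.2.2
            · intro u _ _; exact (hx.1 _).1
    have h5 := Finset.card_erase_add_one hmem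
    simp only [Finset.sum_const, nsmul_eq_mul, mul_one] at this
    have h6 : (((K.filter (fun u => s u = s v)).erase v).card : ℝ) + 1 = kk s K (s v) := by
      unfold kk; exact_mod_cast h5
    linarith
  have hcwk : ∀ v ∈ K, (kk s K (!s v) : ℝ) ≤ cw s x v := by
    intro v hv
    unfold cw kk
    calc _ = ∑ u ∈ K.filter (fun u => s u = !s v), x s(v, u) := by
          rw [Finset.sum_congr rfl (g := fun _ => (1:ℝ))]
          · simp
          · intro u hu
            obtain ⟨h5, h6⟩ := Finset.mem_filter.1 hu
            exact h2 v u hv h5 (by rintro rfl; revert h6; cases s v <;> simp)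
      _ ≤ _ := by
          apply Finset.sum_le_sum_of_subset_of_nonneg
          · intro u hu
            simp at hu ⊢; rw [hu.2]; cases s v <;> simp
          · intro u _ _; exact (hx.1 _).1
  have hκD : K.card ≤ D + 1 := by
    have h5 := hsw w0 hw0
    have h6 := hcwk w0 hw0
    have h7 := sw_add_cw s x w0
    rw [hx.2.2] at h7
    have h8 : kk s K (s w0) + kk s K (!s w0) = K.card := by
      have := kk_add s K
      cases s w0 <;> simp <;> omega
    have h9 : (d w0 : ℝ) ≤ D := by exact_mod_cast hdD w0
    have : (K.card : ℝ) ≤ D + 1 := by rw [← h8]; push_cast; linarith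
    exact_mod_cast this
  by_cases hkD : kk s K b = D + 1
  · left
    have hl0 : kk s K (!b) = 0 := by omega
    have hKb : ∀ v ∈ K, s v = b := by
      intro v hv
      by_contra h
      have : v ∈ K.filter (fun u => s u = !b) := by
        simp [hv]; revert h; cases s v <;> cases b <;> simp
      have := Finset.card_pos.2 ⟨v, this⟩
      unfold kk at hl0; omega
    have : cut s x ≤ 0 := by
      rw [cut_eq h1 h2, hprod, hl0]
      simp only [Nat.cast_zero, mul_zero, sub_zero]
      apply Finset.sum_nonpos
      intro v hv
      have h5 := hsw v hv
      rw [hKb v hv, hkD] at h5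
      have h7 := sw_add_cw s x v
      rw [hx.2.2] at h7
      have h9 : (d v : ℝ) ≤ D := by exact_mod_cast hdD v
      push_cast at h5
      linarith
    linarith
  right
  have hKpos : 0 < K.card := Finset.card_pos.2 ⟨w0, hw0⟩
  set k := kk s K b with hkdef
  set l := kk s K (!b) with hldef
  obtain ⟨y1, y2, hy1, hy2, hsum, hphi⟩ := numeric D k l hD hb (by omega) (by omega) (by omega)
  rw [hkl] at hsum hphi
  set κ := K.card with hκ
  -- the y of a vertex
  let y : V → ℝ := fun v => if s v = b then (y1 : ℝ) else y2
  let g : V → ℝ := fun v => max ((d v : ℝ) - y v) 0 - tw s x K v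
  have hEK : ∑ v ∈ K, (d v : ℝ) ≤ k * y1 + l * y2 + ∑ v, max ((d v : ℝ) - y v) 0 := by
    have e1 : ∑ v ∈ K, y v = k * y1 + l * y2 := by
      simp only [y]
      rw [Finset.sum_ite]
      have h4 : K.filter (fun v => ¬ s v = b) = K.filter (fun v => s v = !b) := by
        ext v; simp; cases s v <;> cases b <;> simp
      rw [h4]
      simp only [Finset.sum_const, nsmul_eq_mul]
      rfl
    have e2 : ∑ v ∈ K, max ((d v : ℝ) - y v) 0 ≤ ∑ v, max ((d v : ℝ) - y v) 0 :=
      Finset.sum_le_sum_of_subset_of_nonneg (Finset.subset_univ _) (fun v _ _ => le_max_right _ _)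
    have e3 : ∑ v ∈ K, (d v : ℝ) ≤ ∑ v ∈ K, (y v + max ((d v : ℝ) - y v) 0) := by
      apply Finset.sum_le_sum
      intro v _
      have := le_max_left ((d v : ℝ) - y v) 0
      linarith
    rw [Finset.sum_add_distrib, e1] at e3
    linarith
  have hcut : cut s x ≤ k * y1 + l * y2 - k * l + κ + ∑ v, g v := by
    rw [cut_formula hx h1 h2, hprod]
    simp only [g]
    rw [Finset.sum_sub_distrib]
    linarith
  let A := univ.filter (fun v => p v ≠ v ∧ s v = b)
  have hsp := sum_pairs p hp s b hs g
  have hsp2 := sum_pairs p hp s b hs (fun v => |(d v : ℝ) - d (p v)|)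
  have hsp3 := sum_pairs p hp s b hs (fun v => 1)
  let m : V → ℕ := fun v => min (d v) (d (p v))
  -- pair terms
  have hpair : ∀ v ∈ A, g v + g (p v) ≤ (phi y1 y2 κ (m v) : ℤ) + |(d v : ℝ) - d (p v)| := by
    intro v hv
    simp only [A, mem_filter, mem_univ, true_and] at hv
    have hsne := hs v hv.1
    have ht := tw_pair hx h1 h2 h3 (Ne.symm hsne) (hopt v hv.1)
    have hyv : y v = y1 := by simp [y, hv.2]
    have hypv : y (p v) = y2 := by
      simp only [y]; rw [if_neg]; rw [← hv.2]; exact hsne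
    simp only [g, hyv, hypv, phi]
    push_cast
    have hm : ((m v : ℕ) : ℝ) = min (d v : ℝ) (d (p v)) := by simp [m]
    rw [hm]
    set a := (d v : ℝ)
    set c := (d (p v) : ℝ)
    have key : ∀ t u w : ℝ, w ≤ t → max (t - u) 0 ≤ max (w - u) 0 + (t - w) := by
      intro t u w hw
      apply max_le
      · have := le_max_left (w - u) 0; linarith
      · have := le_max_right (w - u) 0; linarith
    have k1 := key a y1 (min a c) (min_le_left _ _)
    have k2 := key c y2 (min a c) (min_le_right _ _)
    have k3 : a - min a c + (c - min a c) = |a - c| := by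
      rcases le_total a c with h | h
      · rw [min_eq_left h, abs_of_nonpos (by linarith)]; ring
      · rw [min_eq_right h, abs_of_nonneg (by linarith)]; ring
    linarith
  have hfixg : ∀ v ∈ univ.filter (fun v => p v = v), g v ≤ d v := by
    intro v _
    simp only [g]
    have h5 := tw_nonneg (s := s) (K := K) hx v
    have : max ((d v : ℝ) - y v) 0 ≤ d v := by
      apply max_le
      · have : 0 ≤ y v := by
          simp only [y]; split_ifs
          · exact_mod_cast hy1
          · exact_mod_cast hy2
        linarith
      · positivity
    linarith
  have hg : ∑ v, g v ≤ ((∑ v ∈ A, phi y1 y2 κ (m v) : ℤ) : ℝ) + D := by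
    rw [hsp]
    have e1 := Finset.sum_le_sum hpair
    have e2 := Finset.sum_le_sum hfixg
    have e3 : ∑ v ∈ univ.filter (fun v => p v = v), |(d v : ℝ) - d (p v)| = 0 := by
      apply Finset.sum_eq_zero
      intro v hv
      have : p v = v := by simpa using hv
      rw [this]; simp
    have e4 : ∑ v ∈ A, (|(d v : ℝ) - d (p v)| + |(d (p v) : ℝ) - d (p (p v))|) =
        2 * ∑ v ∈ A, |(d v : ℝ) - d (p v)| := by
      rw [Finset.mul_sum]
      apply Finset.sum_congr rfl
      intro v _
      rw [hp, abs_sub_comm (d (p v) : ℝ)]; ring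
    rw [e3, add_zero] at hsp2
    have e5 := hsp2.trans e4
    rw [e5] at hmis
    have e6 : ∑ v ∈ A, (((phi y1 y2 κ (m v) : ℤ) : ℝ) + |(d v : ℝ) - d (p v)|) =
        ∑ v ∈ A, ((phi y1 y2 κ (m v) : ℤ) : ℝ) + ∑ v ∈ A, |(d v : ℝ) - d (p v)| :=
      Finset.sum_add_distrib
    rw [e6] at e1
    push_cast
    change ∑ v ∈ A, (g v + g (p v)) + _ ≤ _
    linarith
  -- designated pairs
  let P := (Icc 1 D).filter (fun q => ¬ ∀ v, d v ≠ q)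
  have hdes : ∀ q ∈ P, ∃ w ∈ A, d w = q ∧ d (p w) = q := by
    intro q hq
    simp only [P, mem_filter] at hq
    obtain ⟨_, hq⟩ := hq
    push Not at hq
    obtain ⟨v, hv⟩ := hq
    obtain ⟨w, hw1, hw2, hw3⟩ := heq v
    by_cases h : s w = b
    · exact ⟨w, by simp [A, hw2, h], by omega, by omega⟩
    · refine ⟨p w, ?_, by omega, by rw [hp]; omega⟩
      simp only [A, mem_filter, mem_univ, true_and]
      refine ⟨by rw [hp]; exact hw2.symm, ?_⟩
      have := hs w hw2
      revert this h
      cases s w <;> cases s (p w) <;> cases b <;> simp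
  have : Nonempty V := Fintype.card_pos_iff.1 (by omega)
  choose! W hW1 hW2 hW3 using hdes
  have hinj : Set.InjOn W (↑P : Set ℕ) := by
    intro q hq q' hq' h
    rw [← hW2 q hq, h, hW2 q' hq']
  have hsub : P.image W ⊆ A := by
    intro v hv
    obtain ⟨q, hq, rfl⟩ := Finset.mem_image.1 hv
    exact hW1 q hq
  have hPcard : P.card ≤ D - 1 := by
    have : P ⊆ Icc 2 D := by
      intro q hq
      simp only [P, mem_filter, mem_Icc] at hq
      obtain ⟨⟨_, hq1⟩, hq⟩ := hq
      push Not at hq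
      obtain ⟨v, hv⟩ := hq
      rw [mem_Icc]
      exact ⟨by rw [← hv]; exact hd2 v, hq1⟩
    have := Finset.card_le_card this
    simpa using this
  have hAcard : 3 * D ≤ A.card := by
    simp only [Finset.sum_const, Finset.card_univ, nsmul_eq_mul, mul_one] at hsp3
    have e1 : (univ.filter (fun v => p v = v)).card ≤ 1 := by
      rw [Finset.card_le_one]
      intro u hu v hv
      exact hfix u v (by simpa using hu) (by simpa using hv)
    have e2 : Fintype.card V = A.card * (1 + 1) + (univ.filter (fun v => p v = v)).card := by
      exact_mod_cast hsp3
    omega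
  have hA : ∑ v ∈ A, phi y1 y2 κ (m v) ≤ ∑ q ∈ P, phi y1 y2 κ q - (2 * D + 1) * min (κ : ℤ) 2 := by
    rw [← Finset.sum_sdiff hsub]
    have e1 : ∑ v ∈ P.image W, phi y1 y2 κ (m v) = ∑ q ∈ P, phi y1 y2 κ q := by
      rw [Finset.sum_image hinj]
      apply Finset.sum_congr rfl
      intro q hq
      simp only [m]
      rw [hW2 q hq, hW3 q hq]; simp
    have e2 : ∑ v ∈ A \ P.image W, phi y1 y2 κ (m v) ≤ ∑ v ∈ A \ P.image W, (- min (κ : ℤ) 2) := by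
      apply Finset.sum_le_sum
      intro v _
      apply hphi
      · simp only [m]; exact le_min (hd2 _) (hd2 _)
      · simp only [m]; exact (min_le_left _ _).trans (hdD _)
    have e3 : 2 * D + 1 ≤ (A \ P.image W).card := by
      rw [Finset.card_sdiff_of_subset hsub, Finset.card_image_of_injOn hinj]; omega
    rw [Finset.sum_const, nsmul_eq_mul] at e2
    have e4 : ((2 * D + 1 : ℕ) : ℤ) ≤ ((A \ P.image W).card : ℤ) := by exact_mod_cast e3
    push_cast at e4
    have e5 : (0 : ℤ) ≤ min (κ : ℤ) 2 := by omega
    nlinarith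
  have hPM : ∑ q ∈ P, phi y1 y2 κ q ≤ ∑ q ∈ Icc 1 D, phi y1 y2 κ q +
      ((∑ q ∈ (Icc 1 D).filter (fun q => ∀ v, d v ≠ q), q : ℕ) : ℤ) := by
    rw [← Finset.sum_filter_add_sum_filter_not (Icc 1 D) (fun q => ∀ v, d v ≠ q) (fun q : ℕ => phi y1 y2 κ q)]
    push_cast
    have : ∑ q ∈ (Icc 1 D).filter (fun q => ∀ v, d v ≠ q), (0 : ℤ) ≤
        ∑ q ∈ (Icc 1 D).filter (fun q => ∀ v, d v ≠ q), (phi y1 y2 κ q + (q : ℤ)) := by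
      apply Finset.sum_le_sum
      intro q _
      unfold phi; omega
    rw [Finset.sum_add_distrib] at this
    simp only [Finset.sum_const_zero] at this
    change _ ≤ _ + ∑ q ∈ P, _ + _
    linarith
  set c := (∑ q ∈ (Icc 1 D).filter (fun q => ∀ v, d v ≠ q), q : ℕ)
  have hfinal : (k * y1 + l * y2 - k * l + κ + (∑ v ∈ A, phi y1 y2 κ (m v)) + D : ℤ) + κ + 2 ≤ c := by
    by_cases h : κ = 1
    · rw [if_pos h] at hsum
      rw [h] at hA hPM hsum ⊢
      norm_num at hA hPM hsum ⊢
      omega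
    · rw [if_neg h] at hsum
      have : min (κ : ℤ) 2 = 2 := by omega
      rw [this] at hA
      omega
  have hfinal' : (k * y1 + l * y2 - k * l + κ + ((∑ v ∈ A, phi y1 y2 κ (m v) : ℤ) : ℝ) + D : ℝ) + κ + 2 ≤ c := by
    exact_mod_cast hfinal
  linarith

end MDP


namespace MDP

set_option linter.unusedSectionVars false

variable {V : Type*} [Fintype V] [DecidableEq V]

noncomputable def mism (d : V → ℕ) (v w : V) : ℝ := |(d v : ℝ) - d w| + if w = v then 2 * (d v : ℝ) else 0

lemma mism_eq {d : V → ℕ} {v w : V} (h : w ≠ v) (hd : d v = d w) : mism d v w = 0 := by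
  simp [mism, h, hd]

lemma pair_sorted (d : V → ℕ) : ∀ (n : ℕ) (R : Finset V), R.card = n → ∀ M : ℕ, (∀ v ∈ R, d v ≤ M) →
    ∃ p : V → V, (∀ v, p (p v) = v) ∧ (∀ v, v ∉ R → p v = v) ∧
      (∀ u ∈ R, ∀ v ∈ R, p u = u → p v = v → u = v) ∧
      ∑ v ∈ R, mism d v (p v) ≤ 2 * M := by
  intro n
  induction n using Nat.strong_induction_on with
  | _ n ih =>
  intro R hR M hM
  rcases R.eq_empty_or_nonempty with rfl | hne
  · exact ⟨id, by simp, by simp, by simp, by simp⟩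
  obtain ⟨a, ha, hamax⟩ := R.exists_max_image d hne
  rcases (R.erase a).eq_empty_or_nonempty with h0 | hne2
  · have hRa : R = {a} := by
      rw [Finset.erase_eq_empty_iff] at h0
      rcases h0 with h0 | h0
      · exact absurd h0 hne.ne_empty
      · exact h0
    subst hRa
    refine ⟨id, by simp, by simp, by simp, ?_⟩
    have : d a ≤ M := hM a ha
    simp [mism]; omega
  obtain ⟨b, hb, hbmax⟩ := (R.erase a).exists_max_image d hne2
  have hba : b ≠ a := (Finset.mem_erase.1 hb).1
  have hbR : b ∈ R := (Finset.mem_erase.1 hb).2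
  set R' := (R.erase a).erase b with hR'
  have hcard : R'.card < n := by
    rw [← hR, hR', Finset.card_erase_of_mem hb, Finset.card_erase_of_mem ha]
    have : 0 < R.card := Finset.card_pos.2 hne
    omega
  obtain ⟨p, hp1, hp2, hp3, hp4⟩ := ih _ hcard R' rfl (d b) (fun v hv => hbmax v (Finset.mem_of_mem_erase hv))
  have haR' : a ∉ R' := by simp [hR']
  have hbR' : b ∉ R' := by simp [hR']
  have hpa := hp2 a haR'
  have hpb := hp2 b hbR'
  let q : V → V := fun v => if v = a then b else if v = b then a else p v
  have hqa : q a = b := by simp [q]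
  have hqb : q b = a := by simp [q, hba]
  have hq : ∀ v, v ≠ a → v ≠ b → q v = p v := by
    intro v h1 h2; simp [q, h1, h2]
  have hpne : ∀ v, v ≠ a → v ≠ b → p v ≠ a ∧ p v ≠ b := by
    intro v h1 h2
    constructor
    · intro h; apply h1; rw [← hp1 v, h, hpa]
    · intro h; apply h2; rw [← hp1 v, h, hpb]
  have hmemR' : ∀ v, v ≠ a → v ≠ b → (v ∈ R' ↔ v ∈ R) := by
    intro v h1 h2; simp [hR', h1, h2]
  refine ⟨q, ?_, ?_, ?_, ?_⟩
  · intro v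
    by_cases h1 : v = a
    · rw [h1, hqa, hqb]
    by_cases h2 : v = b
    · rw [h2, hqb, hqa]
    obtain ⟨h3, h4⟩ := hpne v h1 h2
    rw [hq v h1 h2, hq _ h3 h4, hp1]
  · intro v hv
    have h1 : v ≠ a := by rintro rfl; exact hv ha
    have h2 : v ≠ b := by rintro rfl; exact hv hbR
    rw [hq v h1 h2]
    apply hp2
    rw [hmemR' v h1 h2]; exact hv
  · intro u hu v hv h h'
    have hx : ∀ w, q w = w → w ≠ a ∧ w ≠ b := by
      intro w hw
      constructor
      · rintro rfl; rw [hqa] at hw; exact hba hw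
      · rintro rfl; rw [hqb] at hw; exact hba hw.symm
    obtain ⟨h1, h2⟩ := hx u h
    obtain ⟨h3, h4⟩ := hx v h'
    rw [hq u h1 h2] at h
    rw [hq v h3 h4] at h'
    exact hp3 u ((hmemR' u h1 h2).2 hu) v ((hmemR' v h3 h4).2 hv) h h'
  · rw [← Finset.add_sum_erase R _ ha, ← Finset.add_sum_erase (R.erase a) _ hb, hqa, hqb]
    have e : ∑ v ∈ (R.erase a).erase b, mism d v (q v) = ∑ v ∈ R', mism d v (p v) := by
      apply Finset.sum_congr rfl
      intro v hv
      rw [hq v]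
      · rintro rfl; exact haR' hv
      · rintro rfl; exact hbR' hv
    rw [e]
    have h1 : (d b : ℝ) ≤ d a := by exact_mod_cast hamax b hbR
    have h2 : (d a : ℝ) ≤ M := by exact_mod_cast hM a ha
    have h3 : mism d a b = d a - d b := by
      simp only [mism, hba, if_false]
      rw [abs_of_nonneg (by linarith)]; ring
    have h4 : mism d b a = d a - d b := by
      simp only [mism, hba.symm, if_false]
      rw [abs_of_nonpos (by linarith)]; ring
    linarith

theorem pairing (d : V → ℕ) (D : ℕ) (hD : ∀ v, d v ≤ D) (hm : ∀ v, ∃ w, w ≠ v ∧ d w = d v) :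
    ∃ p : V → V, (∀ v, p (p v) = v) ∧ (∀ u v, p u = u → p v = v → u = v) ∧
    (∑ v, |(d v : ℝ) - d (p v)| + 2 * ∑ v ∈ univ.filter (fun v => p v = v), (d v : ℝ) ≤ 2 * D) ∧
    (∀ v, ∃ w, d w = d v ∧ p w ≠ w ∧ d (p w) = d w) := by
  classical
  rcases isEmpty_or_nonempty V with hV | hV
  · exact ⟨id, by simp, fun u => hV.elim u, by simp, fun u => hV.elim u⟩
  have h1 : ∀ q : ℕ, ∃ ab : V × V, (∃ v, d v = q) → d ab.1 = q ∧ d ab.2 = q ∧ ab.2 ≠ ab.1 := by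
    intro q
    by_cases h : ∃ v, d v = q
    · obtain ⟨v, hv⟩ := h
      obtain ⟨w, hw, hw2⟩ := hm v
      exact ⟨(v, w), fun _ => ⟨hv, by simp; omega, hw⟩⟩
    · obtain ⟨v⟩ := hV
      exact ⟨(v, v), fun h' => absurd h' h⟩
  choose ab hab using h1
  let α : V → V := fun v => (ab (d v)).1
  let β : V → V := fun v => (ab (d v)).2
  have hα : ∀ v, d (α v) = d v := fun v => (hab (d v) ⟨v, rfl⟩).1
  have hβ : ∀ v, d (β v) = d v := fun v => (hab (d v) ⟨v, rfl⟩).2.1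
  have hne : ∀ v, β v ≠ α v := fun v => (hab (d v) ⟨v, rfl⟩).2.2
  have hcα : ∀ v w, d v = d w → α v = α w := by intro v w h; simp [α, h]
  have hcβ : ∀ v w, d v = d w → β v = β w := by intro v w h; simp [β, h]
  let R := univ.filter (fun v => v ≠ α v ∧ v ≠ β v)
  have hR : ∀ v, v ∈ R ↔ v ≠ α v ∧ v ≠ β v := by intro v; simp [R]
  obtain ⟨p, hp1, hp2, hp3, hp4⟩ := pair_sorted d _ R rfl D (fun v _ => hD v)
  have hpR : ∀ v ∈ R, p v ∈ R := by
    intro v hv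
    by_contra h
    have := hp2 _ h
    rw [hp1] at this
    rw [← this] at h
    exact h hv
  let q : V → V := fun v => if v = α v then β v else if v = β v then α v else p v
  have hq1 : ∀ v, v = α v → q v = β v := by
    intro v h; simp only [q]; rw [if_pos h]
  have hq2 : ∀ v, v = β v → q v = α v := by
    intro v h; simp only [q]; rw [if_neg, if_pos h]
    intro h'; exact hne v (h.symm.trans h')
  have hq3 : ∀ v ∈ R, q v = p v := by
    intro v h; rw [hR] at h; simp only [q]; rw [if_neg h.1, if_neg h.2]
  have hcase : ∀ v, v = α v ∨ v = β v ∨ v ∈ R := by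
    intro v
    by_cases h1 : v = α v
    · exact Or.inl h1
    by_cases h2 : v = β v
    · exact Or.inr (Or.inl h2)
    exact Or.inr (Or.inr ((hR v).2 ⟨h1, h2⟩))
  have hq4 : ∀ v, v ∉ R → q v ≠ v ∧ d v = d (q v) := by
    intro v hv
    rcases hcase v with h | h | h
    · rw [hq1 v h, hβ]
      refine ⟨?_, rfl⟩
      intro h'; exact hne v (h'.trans h)
    · rw [hq2 v h, hα]
      refine ⟨?_, rfl⟩
      intro h'; exact hne v (h.symm.trans h'.symm)
    · exact absurd h hv
  refine ⟨q, ?_, ?_, ?_, ?_⟩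
  · intro v
    rcases hcase v with h | h | h
    · rw [hq1 v h, hq2 _ (hcβ _ _ (hβ v).symm), hcα _ _ (hβ v)]; exact h.symm
    · rw [hq2 v h, hq1 _ (hcα _ _ (hα v).symm), hcβ _ _ (hα v)]; exact h.symm
    · rw [hq3 v h, hq3 _ (hpR v h), hp1]
  · intro u v h h'
    have hu : u ∈ R := by by_contra hh; exact (hq4 u hh).1 h
    have hv : v ∈ R := by by_contra hh; exact (hq4 v hh).1 h'
    rw [hq3 u hu] at h
    rw [hq3 v hv] at h'
    exact hp3 u hu v hv h h'
  · rw [Finset.mul_sum, Finset.sum_filter, ← Finset.sum_add_distrib]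
    have e : ∑ v, mism d v (q v) = ∑ v ∈ R, mism d v (p v) := by
      rw [← Finset.sum_subset (Finset.subset_univ R)]
      · apply Finset.sum_congr rfl
        intro v hv; rw [hq3 v hv]
      · intro v _ hv
        exact mism_eq (hq4 v hv).1 (hq4 v hv).2
    rw [← e] at hp4
    exact hp4
  · intro v
    refine ⟨α v, hα v, ?_⟩
    have : α v ∉ R := by
      rw [hR]
      rintro ⟨h, _⟩
      exact h (hcα _ _ (hα v).symm)
    exact ⟨(hq4 _ this).1, (hq4 _ this).2.symm⟩

end MDP


namespace MDP

set_option linter.unusedSectionVars false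

variable {V : Type*} [Fintype V] [DecidableEq V]

def sgn (b : Bool) : ℝ := if b then 1 else -1

lemma sgn_not (b : Bool) : sgn (!b) = - sgn b := by cases b <;> simp [sgn]

lemma abs_sgn (b : Bool) : |sgn b| = 1 := by cases b <;> simp [sgn]

lemma imbalance (d : V → ℕ) (D : ℕ) (p : V → V) (hp : ∀ v, p (p v) = v)
    (hmis : ∑ v, |(d v : ℝ) - d (p v)| + 2 * ∑ v ∈ univ.filter (fun v => p v = v), (d v : ℝ) ≤ 2 * D)
    (s : V → Bool) (hs : ∀ v, p v ≠ v → s (p v) ≠ s v) : |∑ v, sgn (s v) * d v| ≤ D := by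
  have e1 : ∑ v, sgn (s (p v)) * (d (p v) : ℝ) = ∑ v, sgn (s v) * d v :=
    Equiv.sum_comp (⟨p, p, hp, hp⟩ : V ≃ V) (fun v => sgn (s v) * (d v : ℝ))
  have e2 : 2 * ∑ v, sgn (s v) * (d v : ℝ) = ∑ v, (sgn (s v) * (d v : ℝ) + sgn (s (p v)) * d (p v)) := by
    rw [Finset.sum_add_distrib, e1]; ring
  have e3 : |2 * ∑ v, sgn (s v) * (d v : ℝ)| ≤ 2 * D := by
    rw [e2]
    refine (Finset.abs_sum_le_sum_abs _ _).trans (le_trans ?_ hmis)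
    rw [Finset.mul_sum, Finset.sum_filter, ← Finset.sum_add_distrib]
    apply Finset.sum_le_sum
    intro v _
    by_cases h : p v = v
    · rw [h, if_pos rfl, ← two_mul, abs_mul, abs_mul, abs_sgn]; simp
    · have : s (p v) = !s v := by
        have := hs v h
        revert this; cases s v <;> cases s (p v) <;> simp
      rw [if_neg h, this, sgn_not]
      have : sgn (s v) * (d v : ℝ) + -sgn (s v) * d (p v) = sgn (s v) * (d v - d (p v)) := by ring
      rw [this, abs_mul, abs_sgn]; simp
  rw [abs_mul] at e3
  norm_num at e3
  linarith

lemma compact_feas (d : V → ℕ) : IsCompact {x : Sym2 V → ℝ | Feas d x} := by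
  have hc : IsCompact (Set.pi Set.univ (fun _ : Sym2 V => Set.Icc (0:ℝ) 1)) :=
    isCompact_univ_pi (fun _ => isCompact_Icc)
  refine hc.of_isClosed_subset ?_ ?_
  · have : {x : Sym2 V → ℝ | Feas d x} =
        (⋂ e, {x | 0 ≤ x e ∧ x e ≤ 1}) ∩ ((⋂ v, {x | x s(v, v) = 0}) ∩ ⋂ v, {x | rs x v = d v}) := by
      ext x; simp [Feas]
    rw [this]
    refine IsClosed.inter (isClosed_iInter fun e => ?_) (IsClosed.inter (isClosed_iInter fun v => ?_)
      (isClosed_iInter fun v => ?_))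
    · exact (isClosed_le continuous_const (continuous_apply e)).inter
        (isClosed_le (continuous_apply e) continuous_const)
    · exact isClosed_eq (continuous_apply _) continuous_const
    · refine isClosed_eq ?_ continuous_const
      unfold rs
      exact continuous_finsetSum _ (fun u _ => continuous_apply _)
  · intro x hx e _
    exact hx.1 e

lemma exists_opt (d : V → ℕ) (hne : ∃ z, Feas d z) (s : V → Bool) :
    ∃ x, Feas d x ∧ ∀ y, Feas d y → cut s x ≤ cut s y := by
  obtain ⟨x, hx, hmin⟩ := (compact_feas d).exists_isMinOn hne (f := cut s)
    (Continuous.continuousOn (by unfold cut; exact continuous_finsetSum _ (fun u _ => continuous_apply _)))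
  exact ⟨x, hx, fun y hy => hmin hy⟩

theorem good_split {d : V → ℕ} {D : ℕ} (hD : 3 ≤ D)
    (hd2 : ∀ v, 2 ≤ d v) (hdD : ∀ v, d v ≤ D) (hn : 6 * D ≤ Fintype.card V)
    (hm : ∀ v, ∃ w, w ≠ v ∧ d w = d v) (hev : Even (∑ v, d v)) (hne : ∃ z, Feas d z) :
    ∃ s z, Feas d z ∧ Fr z = ∅ ∧ pot s z ≤ ∑ q ∈ (Icc 1 D).filter (fun q => ∀ v, d v ≠ q), q ∧
      |∑ v, sgn (s v) * d v| ≤ D ∧ ∀ v b, ∃ w, d w = d v ∧ s w = b := by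
  classical
  obtain ⟨p, hp, hfix, hmis, heq⟩ := pairing d D hdD hm
  let S := univ.filter (fun s : V → Bool => ∀ v, p v ≠ v → s (p v) ≠ s v)
  have hSne : S.Nonempty := by
    let e := Fintype.equivFin V
    refine ⟨fun v => decide (e v < e (p v)), ?_⟩
    simp only [S, mem_filter, mem_univ, true_and]
    intro v hv
    rw [hp]
    have : e (p v) ≠ e v := fun h => hv (e.injective h)
    rcases lt_or_gt_of_ne this with h | h
    · simp [h, h.le]
    · simp [h, h.le]
  choose X hX1 hX2 using exists_opt d hne
  obtain ⟨s, hsS, hsmin⟩ := S.exists_min_image (fun s => cut s (X s)) hSne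
  have hs : ∀ v, p v ≠ v → s (p v) ≠ s v := by simpa [S] using hsS
  have hoptS : ∀ s' ∈ S, ∀ y, Feas d y → cut s (X s) ≤ cut s' y := by
    intro s' hs' y hy
    exact (hsmin s' hs').trans (hX2 s' y hy)
  obtain ⟨x, ⟨hx, hcx⟩, hext⟩ := reduce (d := d) (fun z => Feas d z ∧ cut s z ≤ cut s (X s)) (fun z h => h.1)
    ⟨X s, hX1 s, le_rfl⟩ (by
      intro z Δ hz _ _
      rcases le_total (cut s Δ) 0 with h | h
      · left
        intro t ht hf
        refine ⟨hf, ?_⟩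
        rw [cut_add, cut_smul]
        nlinarith [hz.2]
      · right
        intro t ht hf
        refine ⟨hf, ?_⟩
        have : z + t • (-Δ) = z + (-t) • Δ := by simp
        rw [this, cut_add, cut_smul]
        nlinarith [hz.2])
  have hopt : ∀ s' ∈ S, ∀ y, Feas d y → cut s x ≤ cut s' y := fun s' hs' y hy => hcx.trans (hoptS s' hs' y hy)
  obtain ⟨K, h1, h2, h3⟩ := structure_K hx (fun y hy => hopt s hsS y hy)
  have hflip : ∀ v, p v ≠ v → cut s x ≤ cut (flip (flip s (p v)) v) x := by
    intro v hv
    refine hopt _ ?_ x hx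
    simp only [S, mem_filter, mem_univ, true_and]
    intro w hw
    by_cases hwv : w = v
    · subst hwv
      rw [flip_ne _ hw, flip_self, flip_self, flip_ne _ hw.symm]
      have := hs _ hw
      revert this; cases s w <;> cases s (p w) <;> simp
    by_cases hwp : w = p v
    · subst hwp
      rw [hp, flip_self, flip_ne _ hv, flip_self, flip_ne _ hv.symm]
      have := hs _ hv
      revert this; cases s v <;> cases s (p v) <;> simp
    have g1 : p w ≠ v := by rintro rfl; exact hwp (hp w).symm
    have g2 : p w ≠ p v := by
      intro h; apply hwv; rw [← hp w, h, hp]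
    rw [flip_ne _ g1, flip_ne _ g2, flip_ne _ hwv, flip_ne _ hwp]
    exact hs w hw
  have hmain := main_ineq hD hd2 hdD hn p hp hfix hmis heq hs hflip hx h1 h2 h3
  obtain ⟨z, hz1, hz2, hz3, hz4⟩ := rounding hev s _ hext le_rfl
  refine ⟨s, z, hz1.1, hz2, ?_, imbalance d D p hp hmis s hs, ?_⟩
  · have hc1 : 1 ≤ ∑ q ∈ (Icc 1 D).filter (fun q => ∀ v, d v ≠ q), q := by
      apply Finset.single_le_sum (f := fun q => q) (fun q _ => Nat.zero_le q) (a := 1)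
      simp only [mem_filter, mem_Icc]
      refine ⟨by omega, fun v => ?_⟩
      have := hd2 v; omega
    rcases hmain with h0 | h
    · have h00 : ∀ e, Cross s e → x e = 0 := by
        intro e he
        have := (Finset.sum_eq_zero_iff_of_nonneg (fun e _ => (hx.1 e).1)).1 h0
        exact this e (by simpa using he)
      have hp0 : pot s x = 0 := by
        unfold pot
        rw [Finset.card_eq_zero, Finset.filter_eq_empty_iff]
        rintro e _ ⟨h, h'⟩
        rw [h00 e h] at h'; exact lt_irrefl _ h'
      have := hz4 (fun e he hc => by
        rw [mem_Fr, h00 e hc] at he; exact lt_irrefl _ he.1)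
      omega
    · have hpl := pot_le (s := s) hext K (by
        intro e he hc
        induction e with | _ a b =>
        by_contra hcon
        push Not at hcon
        have ha : a ∉ K := fun h => hcon a h (by simp)
        have hb : b ∉ K := fun h => hcon b h (by simp)
        rw [cross_mk] at hc
        rw [mem_Fr, h1 a b ha hb hc] at he
        exact lt_irrefl _ he.1)
      have hz3' : (pot s z : ℝ) ≤ pot s x + 2 := by exact_mod_cast hz3
      have : (pot s z : ℝ) ≤ ((∑ q ∈ (Icc 1 D).filter (fun q => ∀ v, d v ≠ q), q : ℕ) : ℝ) := by
        linarith
      exact_mod_cast this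
  · intro v b
    obtain ⟨w, hw1, hw2, hw3⟩ := heq v
    by_cases h : s w = b
    · exact ⟨w, hw1, h⟩
    · refine ⟨p w, hw3.trans hw1, ?_⟩
      have := hs w hw2
      revert this h
      cases s w <;> cases s (p w) <;> cases b <;> simp

end MDP


namespace MDP

set_option linter.unusedSectionVars false
set_option linter.unusedSimpArgs false

variable {V : Type*} [Fintype V] [DecidableEq V]

open Classical in
/-- 0/1 edge indicator of a graph -/
noncomputable def ig (G : SimpleGraph V) : Sym2 V → ℝ := fun e => if e ∈ G.edgeSet then 1 else 0

lemma exists_graph {d : V → ℕ} {z : Sym2 V → ℝ} (hz : Feas d z) (hfr : Fr z = ∅) :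
    ∃ G : SimpleGraph V, ig G = z := by
  refine ⟨SimpleGraph.fromEdgeSet {e | z e = 1}, ?_⟩
  funext e
  have h01 : z e = 0 ∨ z e = 1 := not_Fr hz (by rw [hfr]; simp)
  unfold ig
  induction e with | _ a b =>
  simp only [SimpleGraph.mem_edgeSet, SimpleGraph.fromEdgeSet_adj, Set.mem_ofPred_eq]
  rcases h01 with h | h
  · rw [h]; simp
  · rw [if_pos, h]
    refine ⟨h, ?_⟩
    rintro rfl
    rw [hz.2.1] at h; norm_num at h

lemma rs_ig (G : SimpleGraph V) [DecidableRel G.Adj] (v : V) : rs (ig G) v = G.degree v := by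
  unfold rs ig
  simp only [SimpleGraph.mem_edgeSet]
  rw [← SimpleGraph.card_neighborFinset_eq_degree, SimpleGraph.neighborFinset_eq_filter]
  rw [Finset.sum_boole]

lemma feas_ig (G : SimpleGraph V) {d : V → ℕ} (h : ∀ v, rs (ig G) v = d v) : Feas d (ig G) := by
  refine ⟨?_, ?_, h⟩
  · intro e; unfold ig; split_ifs <;> norm_num
  · intro v; simp [ig]

lemma cut_le_pot {d : V → ℕ} {z : Sym2 V → ℝ} (hz : Feas d z) (s : V → Bool) : cut s z ≤ pot s z := by
  unfold cut pot
  rw [← Finset.filter_filter, Finset.card_eq_sum_ones, Finset.sum_filter (fun e => 0 < z e)]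
  push_cast
  apply Finset.sum_le_sum
  intro e _
  split_ifs with h
  · simpa using (hz.1 e).2
  · simpa using h

lemma cut_ig_nonneg (G : SimpleGraph V) (s : V → Bool) : 0 ≤ cut s (ig G) := by
  apply Finset.sum_nonneg
  intro e _; unfold ig; split_ifs <;> norm_num

/-- the 2-switch -/
def switch (G : SimpleGraph V) (a b c d : V) : SimpleGraph V :=
  G.deleteEdges {s(a, b), s(c, d)} ⊔ SimpleGraph.fromEdgeSet {s(a, c), s(b, d)}

lemma ig_pos {G : SimpleGraph V} {e : Sym2 V} (h : e ∈ G.edgeSet) : ig G e = 1 := if_pos h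

lemma ig_neg {G : SimpleGraph V} {e : Sym2 V} (h : e ∉ G.edgeSet) : ig G e = 0 := if_neg h

lemma ig_switch {G : SimpleGraph V} {a b c d : V} (hab : G.Adj a b) (hcd : G.Adj c d)
    (hac : ¬ G.Adj a c) (hbd : ¬ G.Adj b d) (n1 : a ≠ c) (n2 : a ≠ d) (n3 : b ≠ c) (n4 : b ≠ d) :
    ig (switch G a b c d) = ig G + ((ind s(a, c) + ind s(b, d)) + (-1 : ℝ) • (ind s(a, b) + ind s(c, d))) := by
  have hab' := hab.ne
  have hcd' := hcd.ne
  have hmem : ∀ e, e ∈ (switch G a b c d).edgeSet ↔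
      (e ∈ G.edgeSet ∧ e ≠ s(a, b) ∧ e ≠ s(c, d)) ∨ e = s(a, c) ∨ e = s(b, d) := by
    intro e
    unfold switch
    rw [SimpleGraph.edgeSet_sup, SimpleGraph.edgeSet_deleteEdges, SimpleGraph.edgeSet_fromEdgeSet]
    simp only [Set.mem_union, Set.mem_sdiff, Set.mem_insert_iff, Set.mem_singleton_iff, ne_eq, not_or]
    have : e = s(a, c) ∨ e = s(b, d) → e ∉ Sym2.diagSet := by
      rintro (rfl | rfl) <;> simp [n1, n4]
    tauto
  funext e
  simp only [Pi.add_apply, Pi.smul_apply, ind, smul_eq_mul]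
  by_cases e1 : e = s(a, b)
  · subst e1
    rw [ig_neg, ig_pos]
    · simp [hab', n1, n2, n3, n4, n1.symm, n2.symm, n3.symm, n4.symm, hab'.symm, hcd'.symm]
    · exact hab
    · rw [hmem]
      simp [hab', n1, n2, n3, n4, n1.symm, n2.symm, n3.symm, n4.symm, hab'.symm, hcd'.symm]
  by_cases e2 : e = s(c, d)
  · subst e2
    rw [ig_neg, ig_pos]
    · simp [hab', n1, n2, n3, n4, n1.symm, n2.symm, n3.symm, n4.symm, hab'.symm, hcd'.symm]
    · exact hcd
    · rw [hmem]
      simp [hab', n1, n2, n3, n4, n1.symm, n2.symm, n3.symm, n4.symm, hab'.symm, hcd'.symm]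
  by_cases e3 : e = s(a, c)
  · subst e3
    rw [ig_pos, ig_neg]
    · simp [hab', n1, n2, n3, n4, n1.symm, n2.symm, n3.symm, n4.symm, hab'.symm, hcd'.symm]
    · exact hac
    · rw [hmem]; simp
  by_cases e4 : e = s(b, d)
  · subst e4
    rw [ig_pos, ig_neg]
    · simp [hab', n1, n2, n3, n4, n1.symm, n2.symm, n3.symm, n4.symm, hab'.symm, hcd'.symm]
    · exact hbd
    · rw [hmem]; simp
  simp only [e1, e2, e3, e4, if_false]
  have hm : e ∈ (switch G a b c d).edgeSet ↔ e ∈ G.edgeSet := by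
    rw [hmem e]; tauto
  by_cases h : e ∈ G.edgeSet
  · rw [ig_pos h, ig_pos (hm.2 h)]; norm_num
  · rw [ig_neg h, ig_neg (fun h' => h (hm.1 h'))]; norm_num

/-- sub-walk argument: a relation closed under steps -/
lemma reach_ind {G : SimpleGraph V} {u : V} (P : V → Prop) (h0 : P u)
    (hstep : ∀ x y, G.Reachable u x → P x → G.Adj x y → P y) : ∀ w, G.Reachable u w → P w := by
  intro w hw
  rw [SimpleGraph.reachable_iff_reflTransGen] at hw
  induction hw with
  | refl => exact h0
  | tail h1 h2 ih => exact hstep _ _ ((SimpleGraph.reachable_iff_reflTransGen _ _).2 h1) ih h2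

lemma reach_of_adj {G H : SimpleGraph V} (h : ∀ x y, G.Adj x y → H.Reachable x y) {u v : V}
    (huv : G.Reachable u v) : H.Reachable u v :=
  reach_ind (fun w => H.Reachable u w) (SimpleGraph.Reachable.refl _)
    (fun x y _ hx hxy => hx.trans (h x y hxy)) v huv

/-- edge `ab` is not a bridge -/
def NB (G : SimpleGraph V) (a b : V) : Prop := G.Adj a b ∧ (G.deleteEdges {s(a, b)}).Reachable a b

lemma NB.symm {G : SimpleGraph V} {a b : V} (h : NB G a b) : NB G b a := by
  refine ⟨h.1.symm, ?_⟩
  rw [Sym2.eq_swap]; exact h.2.symm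

lemma switch_reach {G : SimpleGraph V} {a b c d : V} (hab : NB G a b) (hcd : G.Adj c d)
    (hac : ¬ G.Reachable a c) :
    (∀ u v, G.Reachable u v → (switch G a b c d).Reachable u v) ∧ (switch G a b c d).Reachable a c := by
  have n1 : a ≠ c := by rintro rfl; exact hac (SimpleGraph.Reachable.refl _)
  have n4 : b ≠ d := by
    rintro rfl; exact hac (hab.1.reachable.trans hcd.reachable.symm)
  have hsac : (switch G a b c d).Adj a c := by
    simp [switch, n1]
  have hsbd : (switch G a b c d).Adj b d := by
    simp [switch, n4]
  have hkeep : ∀ x y, G.Adj x y → s(x,y) ≠ s(a,b) → s(x,y) ≠ s(c,d) → (switch G a b c d).Adj x y := by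
    intro x y h h1 h2
    simp only [switch, SimpleGraph.sup_adj, SimpleGraph.deleteEdges_adj]
    left
    exact ⟨h, by simp only [Set.mem_insert_iff, Set.mem_singleton_iff]; tauto⟩
  have hreach_ab : (switch G a b c d).Reachable a b := by
    refine (reach_ind (G := G.deleteEdges {s(a,b)}) (u := a)
      (fun w => (switch G a b c d).Reachable a w) (SimpleGraph.Reachable.refl _) ?_) b hab.2
    intro x y hx hx2 hxy
    refine hx2.trans (SimpleGraph.Adj.reachable ?_)
    rw [SimpleGraph.deleteEdges_adj] at hxy
    refine hkeep x y hxy.1 (by simpa using hxy.2) ?_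
    intro h
    have hx' : G.Reachable a x := hx.mono (SimpleGraph.deleteEdges_le _)
    rw [Sym2.eq_iff] at h
    rcases h with ⟨h, _⟩ | ⟨h, _⟩
    · exact hac (h ▸ hx')
    · exact hac ((h ▸ hx').trans hcd.symm.reachable)
  refine ⟨fun u v huv => reach_of_adj ?_ huv, hsac.reachable⟩
  intro x y hxy
  by_cases h1 : s(x,y) = s(a,b)
  · rw [Sym2.eq_iff] at h1
    rcases h1 with ⟨rfl, rfl⟩ | ⟨rfl, rfl⟩
    · exact hreach_ab
    · exact hreach_ab.symm
  by_cases h2 : s(x,y) = s(c,d)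
  · have := (hsac.symm.reachable.trans hreach_ab).trans hsbd.reachable
    rw [Sym2.eq_iff] at h2
    rcases h2 with ⟨rfl, rfl⟩ | ⟨rfl, rfl⟩
    · exact this
    · exact this.symm
  exact (hkeep x y hxy h1 h2).reachable

/-- every component with all degrees at least two contains a non-bridge edge -/
lemma exists_NB {G : SimpleGraph V} (h2 : ∀ v u, ∃ w, G.Adj v w ∧ w ≠ u) (v : V) :
    ∃ a b, G.Reachable v a ∧ NB G a b := by
  classical
  let S : V × V → Finset V := fun e => univ.filter (fun w => (G.deleteEdges {s(e.1, e.2)}).Reachable e.2 w)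
  let T : Finset (V × V) := univ.filter (fun e => G.Adj e.1 e.2 ∧ G.Reachable v e.1)
  have hT : T.Nonempty := by
    obtain ⟨w, hw, _⟩ := h2 v v
    exact ⟨(v, w), by simp [T, hw]⟩
  obtain ⟨⟨a, b⟩, hab, hmin⟩ := T.exists_min_image (fun e => (S e).card) hT
  simp only [T, mem_filter, mem_univ, true_and] at hab
  obtain ⟨b', hb', hb'a⟩ := h2 b a
  by_contra hcon
  push Not at hcon
  have hvb : G.Reachable v b := hab.2.trans hab.1.reachable
  have hnb := hcon b b' hvb
  have hbr : ¬ (G.deleteEdges {s(b, b')}).Reachable b b' := fun h => hnb ⟨hb', h⟩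
  have hm := hmin (b, b') (by simp [T, hb', hvb])
  have hlt : (S (b, b')).card < (S (a, b)).card := by
    apply Finset.card_lt_card
    rw [Finset.ssubset_iff_of_subset]
    · refine ⟨b, by simp [S], ?_⟩
      simp only [S, mem_filter, mem_univ, true_and]
      exact fun h => hbr h.symm
    · intro w hw
      simp only [S, mem_filter, mem_univ, true_and] at hw ⊢
      refine reach_ind (fun w => (G.deleteEdges {s(a, b)}).Reachable b w) ?_ ?_ w hw
      · apply SimpleGraph.Adj.reachable
        rw [SimpleGraph.deleteEdges_adj]
        refine ⟨hb', ?_⟩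
        simp only [Set.mem_singleton_iff, Sym2.eq_iff]
        rintro (⟨h, h'⟩ | ⟨_, h⟩)
        · exact hb'.ne h'.symm
        · exact hb'a h
      · intro x y hx hx2 hxy
        refine hx2.trans (SimpleGraph.Adj.reachable ?_)
        have hxb : x ≠ b := by rintro rfl; exact hbr hx.symm
        have hyb : y ≠ b := by rintro rfl; exact hbr (hx.trans hxy.reachable).symm
        rw [SimpleGraph.deleteEdges_adj] at hxy ⊢
        refine ⟨hxy.1, ?_⟩
        simp only [Set.mem_singleton_iff, Sym2.eq_iff]
        rintro (⟨_, h⟩ | ⟨h, _⟩)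
        · exact hyb h
        · exact hxb h
  omega

end MDP


namespace MDP

set_option linter.unusedSectionVars false
set_option linter.unusedSimpArgs false

variable {V : Type*} [Fintype V] [DecidableEq V]

open Classical in
noncomputable def nreach (G : SimpleGraph V) : ℕ := (univ.filter (fun e : V × V => G.Reachable e.1 e.2)).card

lemma nreach_lt {G H : SimpleGraph V} (h : ∀ u v, G.Reachable u v → H.Reachable u v) {a c : V}
    (h1 : H.Reachable a c) (h2 : ¬ G.Reachable a c) : nreach G < nreach H := by
  classical
  unfold nreach
  apply Finset.card_lt_card
  rw [Finset.ssubset_iff_of_subset]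
  · exact ⟨(a, c), by simpa using h1, by simpa using h2⟩
  · intro e he
    simp only [mem_filter, mem_univ, true_and] at he ⊢
    exact h _ _ he

/-- a realization with small cut maximizing reachability -/
structure Best (d : V → ℕ) (s : V → Bool) (c : ℕ) (G : SimpleGraph V) : Prop where
  deg : ∀ v, rs (ig G) v = d v
  cutle : cut s (ig G) ≤ c
  best : ∀ H : SimpleGraph V, (∀ v, rs (ig H) v = d v) → cut s (ig H) ≤ c → nreach H ≤ nreach G

lemma exists_best {d : V → ℕ} {s : V → Bool} {c : ℕ} {G : SimpleGraph V} (h1 : ∀ v, rs (ig G) v = d v)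
    (h2 : cut s (ig G) ≤ c) : ∃ G, Best d s c G := by
  classical
  obtain ⟨H, hH, hmax⟩ := (univ.filter (fun H : SimpleGraph V => (∀ v, rs (ig H) v = d v) ∧
    cut s (ig H) ≤ c)).exists_max_image nreach ⟨G, by simp [h1, h2]⟩
  simp only [mem_filter, mem_univ, true_and] at hH hmax
  exact ⟨H, hH.1, hH.2, fun H' h h' => hmax H' ⟨h, h'⟩⟩

lemma other_nbr {d : V → ℕ} {G : SimpleGraph V} (h1 : ∀ v, rs (ig G) v = d v) (v u : V) (hd : 2 ≤ d v) :
    ∃ w, G.Adj v w ∧ w ≠ u := by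
  classical
  have := h1 v
  rw [rs_ig] at this
  have h : G.degree v = d v := by exact_mod_cast this
  rw [← h, ← SimpleGraph.card_neighborFinset_eq_degree] at hd
  obtain ⟨w, hw, hwu⟩ := Finset.exists_mem_ne (show 1 < (G.neighborFinset v).card by omega) u
  exact ⟨w, by simpa using hw, hwu⟩

lemma Best.no_switch {d : V → ℕ} {s : V → Bool} {k : ℕ} {G : SimpleGraph V} (hG : Best d s k G)
    {a b c e : V} (hab : NB G a b) (hce : G.Adj c e) (hac : ¬ G.Reachable a c) :
    (k : ℝ) < cut s (ig G) + ((if s a ≠ s c then 1 else 0) + (if s b ≠ s e then 1 else 0)) -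
      ((if s a ≠ s b then 1 else 0) + (if s c ≠ s e then 1 else 0)) := by
  by_contra hcon
  push Not at hcon
  have n1 : a ≠ c := by rintro rfl; exact hac (SimpleGraph.Reachable.refl _)
  have n2 : a ≠ e := by rintro rfl; exact hac hce.symm.reachable
  have n3 : b ≠ c := by rintro rfl; exact hac hab.1.reachable
  have n4 : b ≠ e := by
    rintro rfl; exact hac (hab.1.reachable.trans hce.reachable.symm)
  have hac' : ¬ G.Adj a c := fun h => hac h.reachable
  have hbe' : ¬ G.Adj b e := fun h => hac ((hab.1.reachable.trans h.reachable).trans hce.symm.reachable)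
  have hig := ig_switch hab.1 hce hac' hbe' n1 n2 n3 n4
  obtain ⟨hr1, hr2⟩ := switch_reach hab hce hac
  have := nreach_lt hr1 hr2 hac
  have hb := hG.best (switch G a b c e) (by
    intro v
    rw [hig, rs_add, rs_add, rs_add, rs_smul, rs_add, rs_ind n1, rs_ind n4, rs_ind hab.1.ne, rs_ind hce.ne, hG.deg]
    ring) (by
    rw [hig, cut_add, cut_add, cut_add, cut_smul, cut_add, cut_ind, cut_ind, cut_ind, cut_ind]
    simp only [cross_mk]
    linarith)
  omega

lemma Best.sides {d : V → ℕ} {s : V → Bool} {k : ℕ} {G : SimpleGraph V} (hG : Best d s k G)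
    (hd : ∀ v, 2 ≤ d v) {w w' : V} (h : ¬ G.Reachable w w') : s w ≠ s w' := by
  have hother := fun v u => other_nbr hG.deg v u (hd v)
  have key : ∀ a b c, NB G a b → ¬ G.Reachable a c → s a ≠ s c := by
    intro a b c hab hac hs
    obtain ⟨e, hce, _⟩ := hother c c
    have h1 := hG.no_switch hab hce hac
    have h2 := hG.cutle
    rw [hs] at h1
    revert h1
    cases s b <;> cases s c <;> cases s e <;> simp <;> linarith
  obtain ⟨a, b, hwa, hab⟩ := exists_NB hother w
  obtain ⟨a', b', hwa', hab'⟩ := exists_NB hother w'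
  have k1 := key a b w' hab (fun h' => h (hwa.trans h'))
  have k2 := key a b a' hab (fun h' => h ((hwa.trans h').trans hwa'.symm))
  have k3 := key a' b' w hab' (fun h' => h (hwa'.trans h').symm)
  revert k1 k2 k3
  cases s a <;> cases s a' <;> cases s w <;> cases s w' <;> simp

lemma Best.iff {d : V → ℕ} {s : V → Bool} {k : ℕ} {G : SimpleGraph V} (hG : Best d s k G)
    (hd : ∀ v, 2 ≤ d v) {u v : V} (huv : ¬ G.Reachable u v) (w w' : V) : G.Reachable w w' ↔ s w = s w' := by
  constructor
  · intro h
    by_cases h1 : G.Reachable w u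
    · have h2 : ¬ G.Reachable w v := fun h2 => huv (h1.symm.trans h2)
      have k1 := hG.sides hd h2
      have k2 := hG.sides hd (fun h3 : G.Reachable w' v => h2 (h.trans h3))
      revert k1 k2
      cases s w <;> cases s w' <;> cases s v <;> simp
    · have k1 := hG.sides hd h1
      have k2 := hG.sides hd (fun h3 : G.Reachable w' u => h1 (h.trans h3))
      revert k1 k2
      cases s w <;> cases s w' <;> cases s u <;> simp
  · intro h
    by_contra h'
    exact hG.sides hd h' h

lemma Best.cut_zero {d : V → ℕ} {s : V → Bool} {k : ℕ} {G : SimpleGraph V} (hG : Best d s k G)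
    (hd : ∀ v, 2 ≤ d v) {u v : V} (huv : ¬ G.Reachable u v) : cut s (ig G) = 0 := by
  unfold cut
  apply Finset.sum_eq_zero
  intro e he
  induction e with | _ x y =>
  simp only [mem_filter, mem_univ, true_and, cross_mk] at he
  unfold ig
  rw [if_neg]
  intro h
  exact he ((hG.iff hd huv x y).1 (SimpleGraph.Adj.reachable h))

lemma Best.connected_of_two {d : V → ℕ} {s : V → Bool} {k : ℕ} {G : SimpleGraph V} (hG : Best d s k G)
    (hd : ∀ v, 2 ≤ d v) (hk : 2 ≤ k) (u v : V) : G.Reachable u v := by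
  by_contra huv
  have h0 := hG.cut_zero hd huv
  have hother := fun v u => other_nbr hG.deg v u (hd v)
  obtain ⟨a, b, hua, hab⟩ := exists_NB hother u
  obtain ⟨e, hve, _⟩ := hother v v
  have := hG.no_switch hab hve (fun h => huv (hua.trans h))
  rw [h0] at this
  have hk' : (2 : ℝ) ≤ k := by exact_mod_cast hk
  split_ifs at this <;> linarith

/-- if `ab` is not a bridge and `a` has degree two then the other edge at `a` is not a bridge -/
lemma NB_other {d : V → ℕ} {G : SimpleGraph V} (hdeg : ∀ v, rs (ig G) v = d v) {a b b' : V} (hab : NB G a b)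
    (ha : d a ≤ 2) (hb' : G.Adj a b') : NB G a b' := by
  classical
  by_cases hbb : b' = b
  · rw [hbb]; exact hab
  have hdega : G.degree a ≤ 2 := by
    have := hdeg a
    rw [rs_ig] at this
    have : G.degree a = d a := by exact_mod_cast this
    omega
  have hnb : ∀ y, G.Adj a y → y = b ∨ y = b' := by
    intro y hy
    by_contra hcon
    push Not at hcon
    have : ({y, b, b'} : Finset V) ⊆ G.neighborFinset a := by
      intro z hz
      simp only [mem_insert, mem_singleton] at hz
      rw [SimpleGraph.mem_neighborFinset]
      rcases hz with rfl | rfl | rfl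
      · exact hy
      · exact hab.1
      · exact hb'
    have h3 := Finset.card_le_card this
    rw [SimpleGraph.card_neighborFinset_eq_degree, Finset.card_eq_three.2 ⟨y, b, b', hcon.1, hcon.2, Ne.symm hbb, rfl⟩] at h3
    omega
  refine ⟨hb', ?_⟩
  -- in G - ab', `a ~ b`; walk from b
  obtain ⟨p, hp⟩ := hab.2.exists_isPath
  cases p with
  | nil => exact absurd hab.1 (SimpleGraph.irrefl _)
  | cons h q =>
    rename_i y
    rw [SimpleGraph.Walk.cons_isPath_iff] at hp
    rw [SimpleGraph.deleteEdges_adj] at h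
    have hy : y = b' := by
      rcases hnb y h.1 with rfl | h'
      · exact absurd rfl h.2
      · exact h'
    subst hy
    have hq : (G.deleteEdges {s(a, y)}).Reachable y b := by
      refine ⟨q.transfer _ ?_⟩
      intro e he
      have he' := SimpleGraph.Walk.edges_subset_edgeSet q he
      rw [SimpleGraph.edgeSet_deleteEdges] at he' ⊢
      refine ⟨he'.1, ?_⟩
      intro hea
      rw [Set.mem_singleton_iff] at hea
      rw [hea] at he
      exact hp.2 (SimpleGraph.Walk.fst_mem_support_of_mem_edges _ he)
    have hab2 : (G.deleteEdges {s(a, y)}).Adj a b := by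
      rw [SimpleGraph.deleteEdges_adj]
      refine ⟨hab.1, ?_⟩
      simp only [Set.mem_singleton_iff, Sym2.eq_iff]
      rintro (⟨_, h⟩ | ⟨h, _⟩)
      · exact hbb h.symm
      · exact hb'.ne h
    exact hab2.reachable.trans hq.symm

lemma exists_NB_three {d : V → ℕ} {G : SimpleGraph V} (hdeg : ∀ v, rs (ig G) v = d v) (hd : ∀ v, 2 ≤ d v)
    {v : V} (hv : 3 ≤ d v) : ∃ a b, G.Reachable v a ∧ NB G a b ∧ 3 ≤ d a := by
  by_contra hcon
  push Not at hcon
  obtain ⟨a, b, hva, hab⟩ := exists_NB (fun v u => other_nbr hdeg v u (hd v)) v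
  have : ∀ w, G.Reachable a w → ∃ y, NB G w y := by
    refine reach_ind (G := G) (u := a) (fun w => ∃ y, NB G w y) ⟨b, hab⟩ ?_
    rintro x y hx ⟨z, hz⟩ hxy
    have := hcon x z (hva.trans hx) hz
    exact ⟨x, (NB_other hdeg hz (by omega) hxy).symm⟩
  obtain ⟨y, hy⟩ := this v hva.symm
  have := hcon v y (SimpleGraph.Reachable.refl _) hy
  omega

end MDP


namespace MDP

set_option linter.unusedSectionVars false
set_option linter.unusedSimpArgs false

variable {V : Type*} [Fintype V] [DecidableEq V]

/-- replace the edge `ab` by `ub` -/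
def shift (G : SimpleGraph V) (a b u : V) : SimpleGraph V :=
  G.deleteEdges {s(a, b)} ⊔ SimpleGraph.fromEdgeSet {s(u, b)}

lemma ig_shift {G : SimpleGraph V} {a b u : V} (hab : G.Adj a b) (hub : ¬ G.Adj u b) (n1 : u ≠ b) :
    ig (shift G a b u) = ig G + (ind s(u, b) + (-1 : ℝ) • ind s(a, b)) := by
  have hmem : ∀ e, e ∈ (shift G a b u).edgeSet ↔ (e ∈ G.edgeSet ∧ e ≠ s(a, b)) ∨ e = s(u, b) := by
    intro e
    unfold shift
    rw [SimpleGraph.edgeSet_sup, SimpleGraph.edgeSet_deleteEdges, SimpleGraph.edgeSet_fromEdgeSet]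
    simp only [Set.mem_union, Set.mem_sdiff, Set.mem_singleton_iff, ne_eq]
    have : e = s(u, b) → e ∉ Sym2.diagSet := by
      rintro rfl; simp [n1]
    tauto
  have hne : s(a, b) ≠ s(u, b) := by
    intro h
    have h1 : s(a, b) ∈ G.edgeSet := hab
    rw [h] at h1
    exact hub h1
  funext e
  simp only [Pi.add_apply, Pi.smul_apply, ind, smul_eq_mul]
  by_cases e1 : e = s(a, b)
  · subst e1
    rw [ig_neg, ig_pos, if_neg hne]
    · simp
    · exact hab
    · rw [hmem]
      simp only [ne_eq, not_true_eq_false, and_false, false_or]; exact hne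
  by_cases e2 : e = s(u, b)
  · subst e2
    rw [ig_pos, ig_neg, if_neg hne.symm]
    · simp
    · exact hub
    · rw [hmem]; simp
  simp only [e1, e2, if_false]
  have hm : e ∈ (shift G a b u).edgeSet ↔ e ∈ G.edgeSet := by
    rw [hmem e]; tauto
  by_cases h : e ∈ G.edgeSet
  · rw [ig_pos h, ig_pos (hm.2 h)]; norm_num
  · rw [ig_neg h, ig_neg (fun h' => h (hm.1 h'))]; norm_num

theorem comb {d : V → ℕ} {D : ℕ} (hD : 3 ≤ D)
    (hd2 : ∀ v, 2 ≤ d v) (hdD : ∀ v, d v ≤ D) (hn : 6 * D ≤ Fintype.card V)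
    (hm : ∀ v, ∃ w, w ≠ v ∧ d w = d v) (hocc : ∃ v, d v = D)
    (hev : Even (∑ v, d v)) (hne : ∃ z, Feas d z) :
    ∃ (G : SimpleGraph V) (σ : Equiv.Perm V) (s : V → Bool), (∀ u v, G.Reachable u v) ∧
      (∀ v, rs (ig G) v = d (σ v)) ∧
      cut s (ig G) ≤ ((∑ q ∈ (Icc 1 D).filter (fun q => ∀ v, d v ≠ q), q : ℕ) : ℝ) ∧
      |∑ v, sgn (s v) * d (σ v)| ≤ D + 2 := by
  obtain ⟨s, z, hz, hfr, hpot, himb, hbal⟩ := good_split hD hd2 hdD hn hm hev hne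
  set c := ∑ q ∈ (Icc 1 D).filter (fun q => ∀ v, d v ≠ q), q with hc
  have hcge : ∀ q, 1 ≤ q → q ≤ D → (∀ v, d v ≠ q) → q ≤ c := by
    intro q h1 h2 h3
    apply Finset.single_le_sum (f := fun q => q) (fun q _ => Nat.zero_le q) (a := q)
    simp only [mem_filter, mem_Icc]
    exact ⟨⟨h1, h2⟩, h3⟩
  have hc1 : 1 ≤ c := hcge 1 le_rfl (by omega) (fun v => by have := hd2 v; omega)
  obtain ⟨G0, hG0⟩ := exists_graph hz hfr
  obtain ⟨G, hG⟩ := exists_best (d := d) (s := s) (c := c) (G := G0) (by rw [hG0]; exact hz.2.2) (by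
    rw [hG0]; refine (cut_le_pot hz s).trans ?_; exact_mod_cast hpot)
  by_cases hconn : ∀ u v, G.Reachable u v
  · refine ⟨G, 1, s, hconn, by simpa using hG.deg, hG.cutle, ?_⟩
    simp only [Equiv.Perm.coe_one, id_eq]
    linarith
  have hc2 : c = 1 := by
    by_contra h
    exact hconn (hG.connected_of_two hd2 (by omega))
  push Not at hconn
  obtain ⟨u0, v0, huv⟩ := hconn
  have hiff := hG.iff hd2 huv
  have hcut0 := hG.cut_zero hd2 huv
  obtain ⟨t, ht⟩ := hocc
  obtain ⟨a, b, _, hab, ha3⟩ := exists_NB_three hG.deg hd2 (v := t) (by omega)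
  have hq : ∃ v, d v = d a - 1 := by
    by_contra h
    push Not at h
    have := hcge (d a - 1) (by omega) (by have := hdD a; omega) h
    omega
  obtain ⟨v, hv⟩ := hq
  obtain ⟨u, hu1, hu2⟩ := hbal v (!s a)
  have hdu : d u + 1 = d a := by omega
  have hsua : s u ≠ s a := by rw [hu2]; simp
  have hsab : s a = s b := (hiff a b).1 hab.1.reachable
  have hub : ¬ G.Adj u b := fun h => hsua (((hiff u b).1 h.reachable).trans hsab.symm)
  have hnub : u ≠ b := by rintro rfl; exact hsua hsab.symm
  have hua : u ≠ a := by rintro rfl; exact hsua rfl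
  have hig := ig_shift hab.1 hub hnub
  have hσ : ∀ v, ((d (Equiv.swap a u v) : ℕ) : ℝ) = d v + ((if v = u then 1 else 0) - (if v = a then 1 else 0)) := by
    intro v
    have hdu' : (d u : ℝ) + 1 = d a := by exact_mod_cast hdu
    by_cases h1 : v = a
    · subst h1
      rw [Equiv.swap_apply_left, if_neg hua.symm, if_pos rfl]; linarith
    by_cases h2 : v = u
    · subst h2
      rw [Equiv.swap_apply_right, if_pos rfl, if_neg hua]; linarith
    rw [Equiv.swap_apply_of_ne_of_ne h1 h2, if_neg h1, if_neg h2]; ring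
  refine ⟨shift G a b u, Equiv.swap a u, s, ?_, ?_, ?_, ?_⟩
  · have hkeep : ∀ x y, G.Reachable x y → (shift G a b u).Reachable x y := by
      intro x y h
      refine reach_of_adj ?_ h
      intro x y hxy
      have hle : G.deleteEdges {s(a, b)} ≤ shift G a b u := le_sup_left
      by_cases h1 : s(x,y) = s(a,b)
      · have := hab.2.mono hle
        rw [Sym2.eq_iff] at h1
        rcases h1 with ⟨rfl, rfl⟩ | ⟨rfl, rfl⟩
        · exact this
        · exact this.symm
      · apply SimpleGraph.Adj.reachable
        apply hle
        rw [SimpleGraph.deleteEdges_adj]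
        exact ⟨hxy, by simpa using h1⟩
    have hsub : (shift G a b u).Adj u b := by simp [shift, hnub]
    have hall : ∀ x, (shift G a b u).Reachable b x := by
      intro x
      by_cases h : s b = s x
      · exact hkeep _ _ ((hiff _ _).2 h)
      · refine hsub.symm.reachable.trans (hkeep _ _ ((hiff _ _).2 ?_))
        rw [hsab] at hsua
        revert h hsua
        cases s b <;> cases s u <;> cases s x <;> simp
    intro x y
    exact (hall x).symm.trans (hall y)
  · intro v
    rw [hig, rs_add, rs_add, rs_smul, rs_ind hnub, rs_ind hab.1.ne, hG.deg, hσ]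
    ring
  · rw [hig, cut_add, cut_add, cut_smul, cut_ind, cut_ind, hcut0, hc2]
    simp only [cross_mk]
    rw [if_neg (not_not.2 hsab)]
    split_ifs <;> norm_num
  · have e1 : ∑ v, sgn (s v) * (d (Equiv.swap a u v) : ℝ) = ∑ v, sgn (s v) * d v + (sgn (s u) - sgn (s a)) := by
      simp only [hσ, mul_add, mul_sub, Finset.sum_add_distrib, Finset.sum_sub_distrib]
      simp
    rw [e1]
    have h1 := abs_sgn (s u)
    have h2 := abs_sgn (s a)
    have h3 := abs_add_le (∑ v, sgn (s v) * (d v : ℝ)) (sgn (s u) - sgn (s a))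
    have h4 := abs_sub (sgn (s u)) (sgn (s a))
    linarith

end MDP


namespace MDP

set_option linter.unusedSectionVars false
set_option linter.unusedSimpArgs false

section
variable {V : Type*} [Fintype V] [DecidableEq V]

lemma two_cut (s : V → Bool) (x : Sym2 V → ℝ) : 2 * cut s x = ∑ v, ∑ u, if s u ≠ s v then x s(v, u) else 0 := by
  have h := sum_sum_mem (S := univ.filter (fun e => Cross s e)) (by
    intro e he
    induction e with
    | _ a b =>
      simp at he
      simp
      rintro rfl; exact he rfl) x
  unfold cut
  rw [← h]
  apply Finset.sum_congr rfl
  intro v _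
  rw [Finset.filter_filter]
  have := sum_mem_eq (fun e => if Cross s e then x e else 0) v
  rw [Finset.sum_filter] at this
  rw [Finset.sum_filter]
  simp only [cross_mk] at this
  rw [show (∑ u, if s u ≠ s v then x s(v, u) else 0) = ∑ u, if s v ≠ s u then x s(v, u) else 0 from
    Finset.sum_congr rfl (fun u _ => by simp only [ne_comm]), ← this]
  apply Finset.sum_congr rfl
  intro e _
  by_cases h1 : v ∈ e <;> by_cases h2 : Cross s e <;> simp [h1, h2]
end

variable {n : ℕ} (G : SimpleGraph (Fin n)) [DecidableRel G.Adj]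

noncomputable def en (g : Fin n → ℝ) : ℝ := (∑ v, ∑ u, if G.Adj v u then (g v - g u) ^ 2 else 0) / 2

lemma en_nonneg (g : Fin n → ℝ) : 0 ≤ en G g := by
  unfold en
  apply div_nonneg _ (by norm_num)
  apply Finset.sum_nonneg; intro v _
  apply Finset.sum_nonneg; intro u _
  split_ifs
  · positivity
  · exact le_rfl

lemma en_eq (g : Fin n → ℝ) : en G g = ∑ v, (G.degree v : ℝ) * g v ^ 2 -
    ∑ v, ∑ u, if G.Adj v u then g v * g u else 0 := by
  have h1 : ∀ v, ∑ u, (if G.Adj v u then g v ^ 2 else 0) = (G.degree v : ℝ) * g v ^ 2 := by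
    intro v
    rw [← Finset.sum_filter, Finset.sum_const, nsmul_eq_mul, ← SimpleGraph.card_neighborFinset_eq_degree,
      SimpleGraph.neighborFinset_eq_filter]
  have h2 : ∑ v, ∑ u, (if G.Adj v u then g u ^ 2 else 0) = ∑ v, (G.degree v : ℝ) * g v ^ 2 := by
    rw [Finset.sum_comm]
    apply Finset.sum_congr rfl
    intro v _
    rw [← h1 v]
    apply Finset.sum_congr rfl
    intro u _
    simp only [G.adj_comm]
  have h3 : ∑ v, ∑ u, (if G.Adj v u then (g v - g u) ^ 2 else 0) =
      ∑ v, ∑ u, (if G.Adj v u then g v ^ 2 else 0) + ∑ v, ∑ u, (if G.Adj v u then g u ^ 2 else 0)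
      - 2 * ∑ v, ∑ u, if G.Adj v u then g v * g u else 0 := by
    simp only [Finset.mul_sum]
    rw [← Finset.sum_add_distrib, ← Finset.sum_sub_distrib]
    apply Finset.sum_congr rfl
    intro v _
    rw [← Finset.sum_add_distrib, ← Finset.sum_sub_distrib]
    apply Finset.sum_congr rfl
    intro u _
    split_ifs <;> ring
  unfold en
  rw [h3, h2, Finset.sum_congr rfl (fun v _ => h1 v)]
  ring

lemma quad (hpos : ∀ v, 0 < G.degree v) (g : Fin n → ℝ) :
    (fun v => Real.sqrt (G.degree v) * g v) ⬝ᵥ (normLap G).mulVec (fun v => Real.sqrt (G.degree v) * g v) = en G g := by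
  rw [en_eq]
  simp only [dotProduct, Matrix.mulVec, Finset.mul_sum]
  rw [← Finset.sum_sub_distrib]
  apply Finset.sum_congr rfl
  intro v _
  have h1 : (G.degree v : ℝ) * g v ^ 2 = ∑ u, if v = u then (G.degree v : ℝ) * g v ^ 2 else 0 := by simp
  rw [h1, ← Finset.sum_sub_distrib]
  apply Finset.sum_congr rfl
  intro u _
  have hv : 0 < Real.sqrt (G.degree v) := Real.sqrt_pos.2 (by exact_mod_cast hpos v)
  have hu : 0 < Real.sqrt (G.degree u) := Real.sqrt_pos.2 (by exact_mod_cast hpos u)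
  have hvv : Real.sqrt (G.degree v) * Real.sqrt (G.degree v) = G.degree v := Real.mul_self_sqrt (by positivity)
  simp only [normLap, Matrix.of_apply]
  by_cases h : v = u
  · subst h
    rw [if_pos rfl, if_pos rfl, if_neg (hpos v).ne', if_neg (SimpleGraph.irrefl _)]
    linear_combination (g v)^2 * hvv
  · rw [if_neg h, if_neg h]
    by_cases ha : G.Adj v u
    · rw [if_pos ha, if_pos ha]
      field_simp
      ring
    · rw [if_neg ha, if_neg ha]; ring

lemma normLap_herm : (normLap G).IsHermitian := by
  ext v u
  simp only [Matrix.conjTranspose_apply, normLap, Matrix.of_apply, star_trivial]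
  by_cases h : u = v
  · subst h; rfl
  · rw [if_neg h, if_neg (Ne.symm h)]
    simp only [G.adj_comm u v, mul_comm]

lemma quad' (hpos : ∀ v, 0 < G.degree v) (f : Fin n → ℝ) :
    f ⬝ᵥ (normLap G).mulVec f = en G (fun v => f v / Real.sqrt (G.degree v)) := by
  rw [← quad G hpos]
  have : (fun v => Real.sqrt (G.degree v) * (f v / Real.sqrt (G.degree v))) = f := by
    funext v
    have hv : 0 < Real.sqrt (G.degree v) := Real.sqrt_pos.2 (by exact_mod_cast hpos v)
    field_simp
  rw [this]

noncomputable def evec (i : Fin n) : Fin n → ℝ := ⇑((normLap_herm G).eigenvectorBasis i)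

lemma evec_mul (i : Fin n) : (normLap G).mulVec (evec G i) = (normLap_herm G).eigenvalues i • evec G i :=
  (normLap_herm G).mulVec_eigenvectorBasis i

lemma evec_sum (x y : Fin n → ℝ) : ∑ i, (x ⬝ᵥ evec G i) * (evec G i ⬝ᵥ y) = x ⬝ᵥ y := by
  have := (normLap_herm G).eigenvectorBasis.sum_inner_mul_inner (WithLp.toLp 2 x) (WithLp.toLp 2 y)
  simp only [EuclideanSpace.inner_eq_star_dotProduct, star_trivial] at this
  rw [dotProduct_comm x y, ← this]
  apply Finset.sum_congr rfl
  intro i _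
  rw [dotProduct_comm x, dotProduct_comm _ y]
  rfl

lemma evec_norm (i : Fin n) : evec G i ⬝ᵥ evec G i = 1 := by
  have := (normLap_herm G).eigenvectorBasis.orthonormal.1 i
  have h2 : inner ℝ ((normLap_herm G).eigenvectorBasis i) ((normLap_herm G).eigenvectorBasis i) = (1:ℝ) := by
    rw [real_inner_self_eq_norm_sq, this]; norm_num
  rw [EuclideanSpace.inner_eq_star_dotProduct, star_trivial] at h2
  exact h2

lemma ev_eq (hpos : ∀ v, 0 < G.degree v) (i : Fin n) : (normLap_herm G).eigenvalues i =
    en G (fun v => evec G i v / Real.sqrt (G.degree v)) := by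
  rw [← quad' G hpos, evec_mul, dotProduct_smul, evec_norm]; simp

lemma spec_nonneg (hpos : ∀ v, 0 < G.degree v) (μ : ℝ) (h : μ ∈ spectrum ℝ (normLap G)) : 0 ≤ μ := by
  rw [(normLap_herm G).spectrum_real_eq_range_eigenvalues] at h
  obtain ⟨i, rfl⟩ := h
  rw [ev_eq G hpos]
  exact en_nonneg _ _

lemma lambda1_le (hpos : ∀ v, 0 < G.degree v) (μ : ℝ) (h0 : μ ≠ 0) (h : μ ∈ spectrum ℝ (normLap G)) :
    lambda1 G ≤ μ := by
  apply csInf_le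
  · exact ⟨0, fun ν hν => spec_nonneg G hpos ν hν.2⟩
  · exact ⟨h0, h⟩

lemma lambda1_nonneg (hpos : ∀ v, 0 < G.degree v) : 0 ≤ lambda1 G :=
  Real.sInf_nonneg (fun ν hν => spec_nonneg G hpos ν hν.2)

lemma rayleigh (hpos : ∀ v, 0 < G.degree v) (hconn : ∀ u v, G.Reachable u v) (g : Fin n → ℝ)
    (hg : ∑ v, (G.degree v : ℝ) * g v = 0) :
    lambda1 G * ∑ v, (G.degree v : ℝ) * g v ^ 2 ≤ en G g := by
  set f : Fin n → ℝ := fun v => Real.sqrt (G.degree v) * g v with hf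
  have hsq : ∀ v, Real.sqrt (G.degree v) * Real.sqrt (G.degree v) = (G.degree v : ℝ) :=
    fun v => Real.mul_self_sqrt (by positivity)
  have hff : ∑ v, (G.degree v : ℝ) * g v ^ 2 = f ⬝ᵥ f := by
    simp only [dotProduct, hf]
    apply Finset.sum_congr rfl
    intro v _
    linear_combination -(g v)^2 * hsq v
  rw [hff, ← quad G hpos, ← evec_sum G f f, ← evec_sum G f ((normLap G).mulVec f), Finset.mul_sum]
  apply Finset.sum_le_sum
  intro i _
  have h1 : evec G i ⬝ᵥ (normLap G).mulVec f = (normLap_herm G).eigenvalues i * (evec G i ⬝ᵥ f) := by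
    rw [Matrix.dotProduct_mulVec, ← Matrix.mulVec_transpose]
    have ht : (normLap G).transpose = normLap G := by
      have := normLap_herm G
      rw [Matrix.IsHermitian, Matrix.conjTranspose_eq_transpose_of_trivial] at this
      exact this
    rw [ht, evec_mul, smul_dotProduct, smul_eq_mul]
  rw [h1, dotProduct_comm f]
  by_cases h0 : (normLap_herm G).eigenvalues i = 0
  · -- kernel
    have he := ev_eq G hpos i
    rw [h0] at he
    set k : Fin n → ℝ := fun v => evec G i v / Real.sqrt (G.degree v) with hk
    have hadj : ∀ v u, G.Adj v u → k v = k u := by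
      intro v u hvu
      unfold en at he
      have he' : ∑ v, ∑ u, (if G.Adj v u then (k v - k u) ^ 2 else 0) = 0 := by linarith
      have hnn : ∀ v u, 0 ≤ (if G.Adj v u then (k v - k u) ^ 2 else 0) := by
        intro v u; split_ifs
        · positivity
        · exact le_rfl
      have a1 := (Finset.sum_eq_zero_iff_of_nonneg (fun v _ => Finset.sum_nonneg (fun u _ => hnn v u))).1 he' v (mem_univ _)
      have a2 := (Finset.sum_eq_zero_iff_of_nonneg (fun u _ => hnn v u)).1 a1 u (mem_univ _)
      rw [if_pos hvu] at a2
      have := pow_eq_zero_iff (two_ne_zero) |>.1 a2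
      linarith
    have hconst : ∀ u v, k u = k v := by
      intro u v
      exact reach_ind (fun w => k u = k w) rfl (fun x y _ hx hxy => hx.trans (hadj x y hxy)) v (hconn u v)
    have hz : evec G i ⬝ᵥ f = 0 := by
      have hev : ∀ v, evec G i v = k i * Real.sqrt (G.degree v) := by
        intro v
        rw [hconst i v, hk]
        have hv : 0 < Real.sqrt (G.degree v) := Real.sqrt_pos.2 (by exact_mod_cast hpos v)
        field_simp
      simp only [dotProduct, hf]
      have : ∑ v, evec G i v * (Real.sqrt (G.degree v) * g v) = k i * ∑ v, (G.degree v : ℝ) * g v := by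
        rw [Finset.mul_sum]
        apply Finset.sum_congr rfl
        intro v _
        rw [hev v]; linear_combination (k i * g v) * hsq v
      rw [this, hg, mul_zero]
    rw [hz]; simp
  · have := lambda1_le G hpos _ h0 ((normLap_herm G).eigenvalues_mem_spectrum_real i)
    nlinarith [mul_self_nonneg (evec G i ⬝ᵥ f)]

theorem spectral_bound (hpos : ∀ v, 0 < G.degree v) (hconn : ∀ u v, G.Reachable u v) (s : Fin n → Bool)
    {c D : ℕ} (hD : 1 ≤ D) (hm : 6 * D ≤ G.edgeFinset.card) (hcut : cut s (ig G) ≤ c)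
    (himb : |∑ v, sgn (s v) * G.degree v| ≤ D + 2) :
    lambda1 G ≤ 2 * (c : ℝ) / ((G.edgeFinset.card : ℝ) - (D : ℝ) / 2) := by
  set m := G.edgeFinset.card with hmdef
  have hT : ∑ v, (G.degree v : ℝ) = 2 * m := by
    have := G.sum_degrees_eq_twice_card_edges
    exact_mod_cast this
  set Y := ∑ v, sgn (s v) * (G.degree v : ℝ) with hY
  have hDr : (1 : ℝ) ≤ D := by exact_mod_cast hD
  have hmr : 6 * (D : ℝ) ≤ m := by exact_mod_cast hm
  have hm0 : (0 : ℝ) < m := by linarith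
  set r := Y / (2 * m) with hr
  have hrm : r * (2 * m) = Y := by rw [hr]; field_simp
  let g : Fin n → ℝ := fun v => sgn (s v) - r
  have hg0 : ∑ v, (G.degree v : ℝ) * g v = 0 := by
    simp only [g, mul_sub, Finset.sum_sub_distrib]
    rw [← Finset.sum_mul, hT, mul_comm _ r, hrm, hY]
    rw [sub_eq_zero]
    apply Finset.sum_congr rfl
    intro v _; ring
  have hg2 : ∑ v, (G.degree v : ℝ) * g v ^ 2 = 2 * m - r * Y := by
    have : ∀ v, (G.degree v : ℝ) * g v ^ 2 = G.degree v - 2 * r * (sgn (s v) * G.degree v) + r ^ 2 * G.degree v := by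
      intro v
      have : sgn (s v) ^ 2 = 1 := by cases s v <;> simp [sgn]
      simp only [g]
      linear_combination (G.degree v : ℝ) * this
    simp only [this, Finset.sum_add_distrib, Finset.sum_sub_distrib, ← Finset.mul_sum]
    rw [hT, ← hY]
    linear_combination r * hrm
  have hen : en G g = 4 * cut s (ig G) := by
    have h2 := two_cut s (ig G)
    have : ∑ v, ∑ u, (if G.Adj v u then (g v - g u) ^ 2 else 0) =
        4 * ∑ v, ∑ u, if s u ≠ s v then ig G s(v, u) else 0 := by
      simp only [Finset.mul_sum]
      apply Finset.sum_congr rfl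
      intro v _
      apply Finset.sum_congr rfl
      intro u _
      by_cases ha : G.Adj v u
      · rw [if_pos ha, ig_pos ha]
        simp only [g]
        cases s u <;> cases s v <;> simp [sgn] <;> norm_num
      · rw [if_neg ha, ig_neg ha]; simp
    unfold en
    rw [this, ← h2]; ring
  have hray := rayleigh G hpos hconn g hg0
  rw [hg2, hen] at hray
  have hl := lambda1_nonneg G hpos
  have hrY : r * Y ≤ D := by
    rw [hr, div_mul_eq_mul_div, div_le_iff₀ (by linarith)]
    have h1 : Y * Y ≤ (D + 2) * (D + 2) := by
      rw [← abs_mul_abs_self Y]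
      exact mul_self_le_mul_self (abs_nonneg _) himb
    nlinarith
  rw [le_div_iff₀ (by linarith)]
  nlinarith

end MDP


namespace MDP

lemma cos_mod (n k : ℕ) (hn : 0 < n) : Real.cos (2 * Real.pi * ((k % n : ℕ) : ℝ) / n) = Real.cos (2 * Real.pi * k / n) := by
  have h : (k : ℝ) = ((k % n : ℕ) : ℝ) + n * ((k / n : ℕ) : ℝ) := by
    exact_mod_cast (Nat.mod_add_div k n).symm
  have hn0 : (n : ℝ) ≠ 0 := by exact_mod_cast hn.ne'
  rw [← Real.cos_add_nat_mul_two_pi _ (k / n)]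
  congr 1
  rw [h]
  field_simp

lemma cyc_bound (m : ℕ) (hm : 9 ≤ m) : lambda1 (cycleGraph (m + 3)) ≤ 2 / (((m + 3 : ℕ) : ℝ) - 1) := by
  set n : ℕ := m + 3 with hn
  have hn0 : (12 : ℝ) ≤ n := by rw [hn]; push_cast; have : (9:ℝ) ≤ m := by exact_mod_cast hm
                                linarith
  set θ : ℝ := 2 * Real.pi / n with hθ
  have hdeg : ∀ v : Fin (m + 3), (cycleGraph (m + 3)).degree v = 2 := fun v => cycleGraph_degree_three_le
  let f : Fin (m + 3) → ℝ := fun v => Real.cos (θ * (v.val : ℝ))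
  have hcm : ∀ k : ℕ, Real.cos (θ * ((k % (m + 3) : ℕ) : ℝ)) = Real.cos (θ * k) := by
    intro k
    have := cos_mod (m + 3) k (by omega)
    rw [hθ, hn]
    rw [div_mul_eq_mul_div, div_mul_eq_mul_div]
    exact this
  have hθn : θ * n = 2 * Real.pi := by rw [hθ]; field_simp
  have hp1 : ∀ v : Fin (m + 3), f (v + 1) = Real.cos (θ * v.val + θ) := by
    intro v
    have h1 : (v + 1).val = (v.val + 1) % (m + 3) := by
      rw [Fin.val_add]; simp
    simp only [f]
    rw [h1, hcm]; push_cast; congr 1; ring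
  have hm1 : ∀ v : Fin (m + 3), f (v - 1) = Real.cos (θ * v.val - θ) := by
    intro v
    have h1 : (v - 1).val = (m + 2 + v.val) % (m + 3) := by
      rw [Fin.sub_def]; simp
    simp only [f]
    rw [h1, hcm, ← Real.cos_add_two_pi (θ * v.val - θ), ← hθn, hn]; push_cast; congr 1; ring
  have hmul : (normLap (cycleGraph (m + 3))).mulVec f = (1 - Real.cos θ) • f := by
    funext v
    have hrow : ∀ u, normLap (cycleGraph (m + 3)) v u * f u =
        (if v = u then f u else 0) - (if (cycleGraph (m + 3)).Adj v u then f u / 2 else 0) := by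
      intro u
      simp only [normLap, Matrix.of_apply, hdeg]
      by_cases h : v = u
      · subst h; simp
      · by_cases ha : (cycleGraph (m + 3)).Adj v u
        · simp only [if_neg h, if_pos ha]
          have : Real.sqrt ((2 : ℕ) : ℝ) * Real.sqrt ((2 : ℕ) : ℝ) = 2 := by
            rw [Real.mul_self_sqrt (by positivity)]; norm_num
          rw [this]; ring
        · simp only [if_neg h, if_neg ha]; ring
    have hnb : ∑ u, (if (cycleGraph (m + 3)).Adj v u then f u / 2 else 0) = f (v - 1) / 2 + f (v + 1) / 2 := by
      rw [← Finset.sum_filter, ← SimpleGraph.neighborFinset_eq_filter, cycleGraph_neighborFinset,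
        Finset.sum_pair]
      intro h
      have hc := congrArg Finset.card (cycleGraph_neighborFinset (n := m + 1) (v := v))
      rw [h] at hc
      rw [SimpleGraph.card_neighborFinset_eq_degree, hdeg] at hc
      simp at hc
    simp only [Matrix.mulVec, dotProduct, hrow, Finset.sum_sub_distrib]
    rw [hnb, hp1, hm1]
    simp only [Finset.sum_ite_eq, Finset.mem_univ, if_true, Pi.smul_apply, smul_eq_mul]
    simp only [f]
    rw [Real.cos_add, Real.cos_sub]
    ring
  have hpi := Real.pi_pos
  have hpi2 := Real.pi_lt_d2
  have hf0 : f ≠ 0 := by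
    intro h
    have := congrFun h 0
    simp [f] at this
  have hspec : (1 - Real.cos θ) ∈ spectrum ℝ (normLap (cycleGraph (m + 3))) := by
    rw [← Matrix.spectrum_toLin']
    apply Module.End.HasEigenvalue.mem_spectrum
    apply Module.End.hasEigenvalue_of_hasEigenvector (x := f)
    refine ⟨?_, hf0⟩
    rw [Module.End.mem_eigenspace_iff, Matrix.toLin'_apply, hmul]
  have hθ0 : 0 < θ := by rw [hθ]; positivity
  have hθ1 : θ < 2 * Real.pi := by nlinarith
  have hne : 1 - Real.cos θ ≠ 0 := by
    intro h
    have h1 : Real.cos θ = 1 := by linarith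
    have := (Real.cos_eq_one_iff_of_lt_of_lt (by linarith) hθ1).1 h1
    linarith
  refine (lambda1_le _ (fun v => by rw [hdeg]; norm_num) _ hne hspec).trans ?_
  have h1 := Real.one_sub_sq_div_two_le_cos (x := θ)
  have h2 : 1 - Real.cos θ ≤ θ ^ 2 / 2 := by linarith
  refine h2.trans ?_
  have h3 : θ ^ 2 / 2 = 2 * Real.pi ^ 2 / n ^ 2 := by rw [hθ]; field_simp
  rw [h3, div_le_div_iff₀ (by positivity) (by linarith)]
  have h4 : Real.pi ^ 2 ≤ 10 := by nlinarith
  nlinarith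

end MDP

/-- A graphic sequence with `n` elements, maximal element `D = d_max ≤ n/6`, minimal element
at least `2`, each occurring degree appearing more than once, has a connected realization `G`
with `λ₁(G) ≤ 2c/(|E(G)| - d_max/2)`, where `c` is the sum of the distinct integers between
`1` and `d_max` missing from `π`. -/

theorem missing_degrees_poor_sync (π : Multiset ℕ) (D : ℕ) (hDmem : D ∈ π)
    (hmax : ∀ d ∈ π, d ≤ D) (hmin : ∀ d ∈ π, 2 ≤ d)
    (hmult : ∀ d ∈ π, 1 < π.count d)
    (hD : D ≤ Multiset.card π / 6) (hg : Graphic π)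
    (c : ℕ) (hc : c = ∑ d ∈ (Finset.Icc 1 D).filter (fun d => d ∉ π), d) :
    ∃ (G : SimpleGraph (Fin (Multiset.card π))) (_ : DecidableRel G.Adj),
      degSeq G = π ∧ G.Connected ∧
      lambda1 G ≤ 2 * (c : ℝ) / ((G.edgeFinset.card : ℝ) - (D : ℝ) / 2) := by
  have h6 : 6 * D ≤ Multiset.card π := by omega
  have hD2 : 2 ≤ D := hmin D hDmem
  rcases Nat.lt_or_ge 2 D with hD3 | hD3
  · obtain ⟨G0, inst0, hG0⟩ := hg
    have hmem : ∀ q, q ∈ π ↔ ∃ v, G0.degree v = q := by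
      intro q
      conv_lhs => rw [← hG0]
      simp [degSeq]
    have hdm : ∀ v, G0.degree v ∈ π := fun v => (hmem _).2 ⟨v, rfl⟩
    have hm : ∀ v, ∃ w, w ≠ v ∧ G0.degree w = G0.degree v := by
      intro v
      by_contra hcon
      push Not at hcon
      have h1 := hmult _ (hdm v)
      have h2 : π.count (G0.degree v) ≤ 1 := by
        have hcnt := congrArg (Multiset.count (G0.degree v)) hG0
        rw [← hcnt, degSeq, Multiset.count_map]
        have h3 : Multiset.card (Multiset.filter (fun a => G0.degree v = G0.degree a) (Finset.univ.val)) =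
            (Finset.univ.filter (fun a => G0.degree v = G0.degree a)).card := rfl
        rw [h3, Finset.card_le_one]
        intro a ha b hb
        simp at ha hb
        have ha' : a = v := by
          by_contra hne; exact hcon a hne ha.symm
        have hb' : b = v := by
          by_contra hne; exact hcon b hne hb.symm
        rw [ha', hb']
      omega
    have hfe := MDP.feas_ig G0 (d := fun v => G0.degree v) (fun v => MDP.rs_ig G0 v)
    obtain ⟨G, σ, s, hconn, hdeg, hcut, himb⟩ := MDP.comb (d := fun v => G0.degree v) (D := D) hD3
      (fun v => hmin _ (hdm v)) (fun v => hmax _ (hdm v)) (by simpa using h6) hm ((hmem D).1 hDmem)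
      (by rw [G0.sum_degrees_eq_twice_card_edges]; exact even_two_mul _) ⟨_, hfe⟩
    classical
    have hdG : ∀ v, G.degree v = G0.degree (σ v) := by
      intro v
      have := hdeg v
      rw [MDP.rs_ig G v] at this
      exact_mod_cast this
    have hpos : ∀ v, 2 ≤ G.degree v := fun v => by rw [hdG]; exact hmin _ (hdm _)
    refine ⟨G, inferInstance, ?_, ?_, ?_⟩
    · refine Eq.trans ?_ hG0
      simp only [degSeq, hdG]
      have h2 := congrArg Finset.val (Finset.map_univ_equiv σ)
      rw [Finset.map_val] at h2
      refine (Multiset.map_map (fun v => G0.degree v) σ _).symm.trans ?_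
      exact congrArg (Multiset.map (fun v => G0.degree v)) h2
    · have : Nonempty (Fin (Multiset.card π)) := ⟨⟨0, by omega⟩⟩
      exact ⟨hconn⟩
    · have hE : 6 * D ≤ G.edgeFinset.card := by
        have h1 := G.sum_degrees_eq_twice_card_edges
        have h2 : ∑ v : Fin (Multiset.card π), 2 ≤ ∑ v, G.degree v := Finset.sum_le_sum (fun v _ => hpos v)
        simp at h2
        omega
      have hce : (∑ q ∈ (Finset.Icc 1 D).filter (fun q => ∀ v, G0.degree v ≠ q), q) = c := by
        rw [hc]
        congr 1
        apply Finset.filter_congr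
        intro q _
        rw [hmem]; push Not; rfl
      refine MDP.spectral_bound G (fun v => by have := hpos v; omega) hconn s (by omega) hE ?_ ?_
      · rw [← hce]; convert hcut
      · simp only [hdG]; exact himb
  · have hDe : D = 2 := by omega
    subst hDe
    have hall : ∀ d ∈ π, d = 2 := fun d hd => le_antisymm (hmax d hd) (hmin d hd)
    have hπ : π = Multiset.replicate (Multiset.card π) 2 := Multiset.eq_replicate_card.2 hall
    have hc1 : c = 1 := by
      rw [hc]
      have : (Finset.Icc 1 2).filter (fun d => d ∉ π) = {1} := by
        ext q
        simp only [Finset.mem_filter, Finset.mem_Icc, Finset.mem_singleton]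
        constructor
        · rintro ⟨⟨h1, h2⟩, h3⟩
          rcases Nat.lt_or_ge q 2 with h | h
          · omega
          · exact absurd (show q ∈ π by rw [show q = 2 by omega]; exact hDmem) h3
        · rintro rfl
          exact ⟨by omega, fun h => by have := hall _ h; omega⟩
      rw [this]; simp
    have key : ∀ n : ℕ, 12 ≤ n → ∃ (G : SimpleGraph (Fin n)) (_ : DecidableRel G.Adj),
        degSeq G = Multiset.replicate n 2 ∧ G.Connected ∧
        lambda1 G ≤ 2 * ((1 : ℕ) : ℝ) / ((G.edgeFinset.card : ℝ) - ((2 : ℕ) : ℝ) / 2) := by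
      intro n hn
      obtain ⟨m, rfl⟩ : ∃ m, n = m + 3 := ⟨n - 3, by omega⟩
      have hdeg : ∀ v : Fin (m + 3), (cycleGraph (m + 3)).degree v = 2 := fun v => cycleGraph_degree_three_le
      refine ⟨cycleGraph (m + 3), inferInstance, ?_, cycleGraph_connected, ?_⟩
      · simp only [degSeq, hdeg]
        simp
      · have hE : (cycleGraph (m + 3)).edgeFinset.card = m + 3 := by
          have h1 := (cycleGraph (m + 3)).sum_degrees_eq_twice_card_edges
          simp only [hdeg] at h1
          simp at h1
          omega
        rw [hE]
        have := MDP.cyc_bound m (by omega)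
        norm_num at this ⊢
        exact this
    obtain ⟨G, inst, h1, h2, h3⟩ := key (Multiset.card π) (by omega)
    refine ⟨G, inst, ?_, h2, ?_⟩
    · rw [h1, ← hπ]
    · rw [hc1]; exact h3
end
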